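/- Let d ≥ 4, 1 < p ≤ 2 and λ ≥ 2. For each j ≥ 1 let E_j ⊂ (I_j ∩ ℕ) × ℤ^d be finite with #(E_j ∩ Q) ≤ λ^p l(Q) for every Q ∈ D_j, and let B_{n,z} = K_n ∗ b_{n,z} with |b_{n,z}| ≤ χ_{q_z}. Then ‖ Σ_{j≥1} 2^{j(d−1)/2} Σ_{(n,z) ∈ E_j} B_{n,z} ‖_{L^2(ℝ^d)}^2 ≤ C λ^{2p/(d−1)} log₂(λ) Σ_{j≥1} 2^{j(d−1)} #E_j, with C independent of λ, the sets E_j and the functions b_{n,z}. -/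

import Mathlib

open MeasureTheory Real Set
open scoped Classical FourierTransform RealInnerProductSpace NNReal ENNReal

noncomputable section

/-- Euclidean space `ℝ^d`. -/
abbrev Rd (d : ℕ) := EuclideanSpace ℝ (Fin d)

/-- `a` is a "distance function": smooth away from the origin, positive away from the
origin, and homogeneous of degree one. -/
structure IsDistFn {d : ℕ} (a : Rd d → ℝ) : Prop where
  smooth : ContDiffOn ℝ (⊤ : ℕ∞) a {ξ : Rd d | ξ ≠ 0}
  pos : ∀ ξ : Rd d, ξ ≠ 0 → 0 < a ξ
  homog : ∀ t : ℝ, 0 < t → ∀ ξ : Rd d, a (t • ξ) = t * a ξ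

/-- Nonvanishing Gaussian curvature of the cosphere `Σ = {a = 1}`: at every point `ξ` of `Σ`
the second fundamental form, i.e. the Hessian of `a` restricted to the tangent space
`ker (da(ξ))`, is nondegenerate. -/
def CurvNondeg {d : ℕ} (a : Rd d → ℝ) : Prop :=
  ∀ ξ : Rd d, a ξ = 1 → ∀ v : Rd d, fderiv ℝ a ξ v = 0 → v ≠ 0 →
    ∃ w : Rd d, fderiv ℝ a ξ w = 0 ∧ iteratedFDeriv ℝ 2 a ξ ![v, w] ≠ 0

/-- The bump function `η`: smooth, supported in `[1/8,8]`, equal to `1` on `[1/4,4]`. -/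
structure IsBump (η : ℝ → ℝ) : Prop where
  smooth : ContDiff ℝ (⊤ : ℕ∞) η
  supp : ∀ x : ℝ, x ∉ Icc (1/8 : ℝ) 8 → η x = 0
  one : ∀ x ∈ Icc (1/4 : ℝ) 4, η x = 1

/-- The kernel `K_r`, given by the inverse Fourier transform of `ξ ↦ η(a(ξ)) e^{i r a(ξ)}`. -/
def Kker {d : ℕ} (a : Rd d → ℝ) (η : ℝ → ℝ) (r : ℝ) (x : Rd d) : ℂ :=
  ∫ ξ : Rd d, (η (a ξ) : ℂ) * Complex.exp (Complex.I * r * a ξ) *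
    Complex.exp (2 * π * Complex.I * (inner ℝ x ξ : ℝ))

/-- Convolution `K ∗ b`. -/
def conv {d : ℕ} (K b : Rd d → ℂ) (x : Rd d) : ℂ := ∫ y, K (x - y) * b y

/-- The measure `ν_d` on `ℝ`, `dν_d(r) = (1+|r|)^{d-1} dr`. -/
def nuMeas (d : ℕ) : Measure ℝ :=
  volume.withDensity fun r => ENNReal.ofReal ((1 + |r|) ^ (d - 1))

/-- The Lorentz quasinorm `‖f‖_{L^{p,q}(μ)}`. -/
def lorentzNorm {α : Type*} {E : Type*} [MeasurableSpace α] [NormedAddCommGroup E]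
    (μ : Measure α) (p : ℝ) (q : ℝ≥0∞) (f : α → E) : ℝ≥0∞ :=
  if q = ∞ then ⨆ t : ℝ, ENNReal.ofReal t * μ {x | t < ‖f x‖} ^ (1 / p)
  else (∫⁻ t in Ioi (0 : ℝ),
      (ENNReal.ofReal t * μ {x | t < ‖f x‖} ^ (1 / p)) ^ q.toReal / ENNReal.ofReal t) ^
      (1 / q.toReal)

/-- The unit cube `q_z = ∏ [z_i, z_i + 1)`. -/
def qcube (d : ℕ) (z : Fin d → ℤ) : Set (Rd d) :=
  {y : Rd d | ∀ i, (z i : ℝ) ≤ y i ∧ y i < z i + 1}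

/-- A normalized function `b_{n,z}`: measurable, bounded by the characteristic
function of `q_z`. -/
def IsNormalized {d : ℕ} (z : Fin d → ℤ) (b : Rd d → ℂ) : Prop :=
  Measurable b ∧ (∀ y, ‖b y‖ ≤ 1) ∧ ∀ y ∉ qcube d z, b y = 0

/-- A dyadic cube of side length `2^k`, `1 ≤ k ≤ j`, in the tiling of
`[2^j, 2^{j+1}) × ℝ^d`. -/
structure DyCube (d j : ℕ) where
  k : ℕ
  m : ℤ
  zv : Fin d → ℤ
  hk : 1 ≤ k ∧ k ≤ j
  hm : (2:ℤ) ^ (j - k) ≤ m ∧ m < 2 ^ (j + 1 - k)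

/-- side length of a dyadic cube -/
def DyCube.len {d j : ℕ} (Q : DyCube d j) : ℝ := 2 ^ Q.k

/-- a dyadic cube as a subset of `ℝ^{1+d}` -/
def DyCube.toSet {d j : ℕ} (Q : DyCube d j) : Set (ℝ × (Fin d → ℝ)) :=
  {p | ((Q.m : ℝ) * 2 ^ Q.k ≤ p.1 ∧ p.1 < (Q.m + 1) * 2 ^ Q.k) ∧
    ∀ i, (Q.zv i : ℝ) * 2 ^ Q.k ≤ p.2 i ∧ p.2 i < (Q.zv i + 1) * 2 ^ Q.k}

/-- center of a dyadic cube: the `r`-coordinate -/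
def DyCube.centerT {d j : ℕ} (Q : DyCube d j) : ℝ := ((Q.m : ℝ) + 1/2) * 2 ^ Q.k

/-- center of a dyadic cube: the `y`-coordinate -/
def DyCube.centerX {d j : ℕ} (Q : DyCube d j) : Rd d :=
  WithLp.toLp 2 fun i => ((Q.zv i : ℝ) + 1/2) * 2 ^ Q.k

/-- a point `(n,z) ∈ ℕ × ℤ^d` viewed as a point of `ℝ^{1+d}` -/
def embedPt (d : ℕ) (e : ℕ × (Fin d → ℤ)) : ℝ × (Fin d → ℝ) :=
  ((e.1 : ℝ), fun i => (e.2 i : ℝ))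

/-- the number of points of `E` lying in the cube `Q` -/
def cubeCount {d j : ℕ} (E : Finset (ℝ × (Fin d → ℝ))) (Q : DyCube d j) : ℕ :=
  (E.filter (· ∈ Q.toSet)).card

/-- `Q` is `λ`-dense: `#(E ∩ Q) > λ^p l(Q)` -/
def IsDense {d j : ℕ} (E : Finset (ℝ × (Fin d → ℝ))) (lam p : ℝ) (Q : DyCube d j) : Prop :=
  lam ^ p * Q.len < (cubeCount E Q : ℝ)

/-- `Q` is a maximal `λ`-dense dyadic cube -/
def IsMaxDense {d j : ℕ} (E : Finset (ℝ × (Fin d → ℝ))) (lam p : ℝ) (Q : DyCube d j) : Prop :=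
  IsDense E lam p Q ∧
    ∀ Q' : DyCube d j, IsDense E lam p Q' → Q.toSet ⊆ Q'.toSet → Q'.toSet = Q.toSet

/-- a lattice vector viewed as an element of `ℝ^d` -/
def latticeVec (d : ℕ) (z : Fin d → ℤ) : Rd d := WithLp.toLp 2 fun i => (z i : ℝ)

/-- The structural properties of the phase function `ψ = -ψ₋`: Lipschitz with constant `L`,
comparable to the norm, and homogeneous of degree one. -/
structure IsPsi {d : ℕ} (ψ : Rd d → ℝ) (L c₁ c₂ : ℝ) : Prop where
  lip : LipschitzWith (Real.toNNReal L) ψ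
  lower : ∀ x : Rd d, c₁ * ‖x‖ ≤ ψ x
  upper : ∀ x : Rd d, ψ x ≤ c₂ * ‖x‖
  homog : ∀ t : ℝ, 0 < t → ∀ x : Rd d, ψ (t • x) = t * ψ x

/-- The stationary phase kernel estimate for `K_r`, `r ≥ 2`:
`|K_r(x)| ≤ C_N (1+|x|+|r|)^{-(d-1)/2} (1+|ψ(x)-r|)^{-N}`. -/
def KernelEst {d : ℕ} (a : Rd d → ℝ) (η : ℝ → ℝ) (ψ : Rd d → ℝ) : Prop :=
  ∀ N : ℕ, ∃ C : ℝ, 0 < C ∧ ∀ r : ℝ, 2 ≤ r → ∀ x : Rd d,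
    ‖Kker a η r x‖ ≤ C * (1 + ‖x‖ + |r|) ^ (-(((d:ℝ) - 1) / 2)) * (1 + |ψ x - r|) ^ (-(N : ℝ))

/-- The two-sided stationary phase kernel estimate for `K_r`, `|r| ≥ 2`, with the
two phase functions `ψ₊`, `ψ₋`:
`|K_r(x)| ≤ C_N (1+|x|+|r|)^{-(d-1)/2} ∑_± (1+|ψ_±(x)+r|)^{-N}`. -/
def KernelEstPM {d : ℕ} (a : Rd d → ℝ) (η : ℝ → ℝ) (ψp ψm : Rd d → ℝ) : Prop :=
  ∀ N : ℕ, ∃ C : ℝ, 0 < C ∧ ∀ r : ℝ, 2 ≤ |r| → ∀ x : Rd d,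
    ‖Kker a η r x‖ ≤ C * (1 + ‖x‖ + |r|) ^ (-(((d:ℝ) - 1) / 2)) *
      ((1 + |ψp x + r|) ^ (-(N : ℝ)) + (1 + |ψm x + r|) ^ (-(N : ℝ)))

/-- The linear map `w ↦ p w + q ⟨θ, w⟩ θ`. -/
def stretch {E : Type*} [NormedAddCommGroup E] [InnerProductSpace ℝ E] (θ : E) (p q : ℝ) :
    E →ₗ[ℝ] E :=
  p • LinearMap.id + q • (innerₛₗ ℝ θ).smulRight θ

lemma stretch_apply {E : Type*} [NormedAddCommGroup E] [InnerProductSpace ℝ E] (θ : E) (p q : ℝ)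
    (w : E) : stretch θ p q w = p • w + (q * inner ℝ θ w) • θ := by
  simp [stretch, smul_smul]

lemma det_stretch {E : Type*} [NormedAddCommGroup E] [InnerProductSpace ℝ E]
    [FiniteDimensional ℝ E] {n : ℕ} (hE : Module.finrank ℝ E = n + 1) (θ : E) {p : ℝ} (hp : 0 < p)
    (q : ℝ) : LinearMap.det (stretch θ p q) = p ^ n * (p + q * ‖θ‖ ^ 2) := by
  have : stretch θ p q = p • LinearMap.transvection ((q / p) • (innerₛₗ ℝ θ)) θ := by
    ext w
    rw [stretch_apply]
    simp only [LinearMap.smul_apply, LinearMap.transvection.apply, smul_add, smul_smul,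
      innerₛₗ_apply_apply, smul_eq_mul]
    congr 2
    field_simp
  rw [this, LinearMap.det_smul, LinearMap.transvection.det, hE]
  simp only [LinearMap.smul_apply, innerₛₗ_apply_apply, real_inner_self_eq_norm_sq, smul_eq_mul]
  field_simp
  ring

/-- The Japanese-bracket integral `∫ (1 + ‖w‖)^{-M}` is finite for `M > dim E`. -/
lemma lintegral_bracket_lt_top {E : Type*} [NormedAddCommGroup E] [InnerProductSpace ℝ E]
    [FiniteDimensional ℝ E] [MeasurableSpace E] [BorelSpace E] {M : ℕ}
    (hM : Module.finrank ℝ E < M) :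
    ∫⁻ w : E, ENNReal.ofReal ((1 + ‖w‖)⁻¹ ^ M) < ∞ := by
  have := finite_integral_one_add_norm (E := E) (μ := volume) (r := M) (by exact_mod_cast hM)
  convert this using 3
  rw [Real.rpow_neg (by positivity), Real.rpow_natCast, inv_pow]

lemma lintegral_comp_linearMap {E : Type*} [NormedAddCommGroup E] [InnerProductSpace ℝ E]
    [FiniteDimensional ℝ E] [MeasurableSpace E] [BorelSpace E] {A : E →ₗ[ℝ] E}
    (hA : LinearMap.det A ≠ 0) {f : E → ℝ≥0∞} (hf : Measurable f) :
    ∫⁻ w, f (A w) = ENNReal.ofReal |(LinearMap.det A)⁻¹| * ∫⁻ w, f w := by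
  have h := Measure.map_linearMap_addHaar_eq_smul_addHaar (volume : Measure E) hA
  have hm : Measurable A := A.continuous_of_finiteDimensional.measurable
  rw [← lintegral_map hf hm, h, lintegral_smul_measure, smul_eq_mul]

lemma lintegral_comp_add_smul {E : Type*} [NormedAddCommGroup E] [InnerProductSpace ℝ E]
    [FiniteDimensional ℝ E] [MeasurableSpace E] [BorelSpace E] (c : E) {t : ℝ} (ht : 1 ≤ t)
    {f : E → ℝ≥0∞} (hf : Measurable f) :
    ∫⁻ w, f (c + t • w) ≤ ∫⁻ w, f w := by
  have hdet : LinearMap.det (t • (LinearMap.id : E →ₗ[ℝ] E)) = t ^ Module.finrank ℝ E := by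
    simp
  have h := lintegral_comp_linearMap (A := t • (LinearMap.id : E →ₗ[ℝ] E))
    (by rw [hdet]; positivity) (f := fun w => f (c + w)) (hf.comp (measurable_const_add c))
  simp only [LinearMap.smul_apply, LinearMap.id_apply] at h
  rw [h, lintegral_add_left_eq_self (f := f), hdet]
  have : ENNReal.ofReal |(t ^ Module.finrank ℝ E)⁻¹| ≤ 1 := by
    rw [ENNReal.ofReal_le_one, abs_of_nonneg (by positivity)]
    exact inv_le_one_of_one_le₀ (one_le_pow₀ ht)
  calc _ ≤ 1 * ∫⁻ w, f w := by gcongr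
    _ = _ := one_mul _

/-- Integral of the bracket adapted to a plate of thickness `L` and radius `1/p`. -/
lemma exists_lintegral_plate_le {E : Type*} [NormedAddCommGroup E] [InnerProductSpace ℝ E]
    [FiniteDimensional ℝ E] [MeasurableSpace E] [BorelSpace E] {n : ℕ}
    (hE : Module.finrank ℝ E = n + 1) {M : ℕ} (hM : n + 1 < M) {α β : ℝ} (hα : 0 < α) :
    ∃ C : ℝ, 0 < C ∧ ∀ (θ c : E), α ≤ ‖θ‖ → ‖θ‖ ≤ β → ∀ p L : ℝ, 0 < p → 0 < L →
      ∫⁻ w, ENNReal.ofReal ((1 + |(inner ℝ (c + (2 * π) • w) θ : ℝ)| / L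
        + p * ‖c + (2 * π) • w‖)⁻¹ ^ M) ≤ ENNReal.ofReal (C * (L * (p ^ n)⁻¹)) := by
  set I := ∫⁻ w : E, ENNReal.ofReal ((1 + ‖w‖)⁻¹ ^ M) with hI
  have hfin : I < ∞ := lintegral_bracket_lt_top (by omega)
  refine ⟨((1 + |β|) ^ M) * (α ^ 2)⁻¹ * (I.toReal + 1), by positivity, ?_⟩
  intro θ c h1 h2 p L hp hL
  have hθ : 0 < ‖θ‖ := hα.trans_le h1
  have hβ : 0 < β := hθ.trans_le h2
  set f : E → ℝ≥0∞ := fun w => ENNReal.ofReal ((1 + |(inner ℝ w θ : ℝ)| / L + p * ‖w‖)⁻¹ ^ M)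
    with hf
  have hfm : Measurable f := by
    apply Measurable.ennreal_ofReal; fun_prop
  have hpi : (1 : ℝ) ≤ 2 * π := by linarith [pi_gt_three]
  refine (lintegral_comp_add_smul c hpi hfm).trans ?_
  have hdet := det_stretch hE θ hp (1 / L)
  have hdpos : 0 < LinearMap.det (stretch θ p (1 / L)) := by rw [hdet]; positivity
  have hpt : ∀ w, f w ≤ ENNReal.ofReal ((1 + |β|) ^ M) *
      (fun v : E => ENNReal.ofReal ((1 + ‖v‖)⁻¹ ^ M)) (stretch θ p (1 / L) w) := by
    intro w
    simp only [hf]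
    rw [← ENNReal.ofReal_mul (by positivity), ← mul_pow]
    apply ENNReal.ofReal_le_ofReal
    apply pow_le_pow_left₀ (by positivity)
    rw [inv_le_iff_one_le_mul₀ (by positivity)]
    have : ‖stretch θ p (1 / L) w‖ ≤ p * ‖w‖ + |(inner ℝ w θ : ℝ)| / L * β := by
      rw [stretch_apply]
      refine (norm_add_le _ _).trans ?_
      rw [norm_smul, norm_smul, Real.norm_of_nonneg hp.le, real_inner_comm, Real.norm_eq_abs,
        abs_mul, abs_of_nonneg (by positivity : 0 ≤ 1 / L)]
      have : 1 / L * |(inner ℝ w θ : ℝ)| * ‖θ‖ ≤ 1 / L * |(inner ℝ w θ : ℝ)| * β := by gcongr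
      calc _ ≤ p * ‖w‖ + 1 / L * |(inner ℝ w θ : ℝ)| * β := by linarith
        _ = _ := by ring
    have h3 : 1 + ‖stretch θ p (1 / L) w‖ ≤
        (1 + |β|) * (1 + |(inner ℝ w θ : ℝ)| / L + p * ‖w‖) := by
      rw [abs_of_pos hβ]
      have : 0 ≤ |(inner ℝ w θ : ℝ)| / L := by positivity
      have : 0 ≤ p * ‖w‖ := by positivity
      nlinarith
    have h4 : 0 < 1 + ‖stretch θ p (1 / L) w‖ := by positivity
    calc 1 = (1 + ‖stretch θ p (1 / L) w‖)⁻¹ * (1 + ‖stretch θ p (1 / L) w‖) := by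
          field_simp
      _ ≤ (1 + ‖stretch θ p (1 / L) w‖)⁻¹ *
          ((1 + |β|) * (1 + |(inner ℝ w θ : ℝ)| / L + p * ‖w‖)) := by gcongr
      _ = _ := by ring
  calc ∫⁻ w, f w ≤ ∫⁻ w, ENNReal.ofReal ((1 + |β|) ^ M) *
      (fun v : E => ENNReal.ofReal ((1 + ‖v‖)⁻¹ ^ M)) (stretch θ p (1 / L) w) :=
        lintegral_mono hpt
    _ = ENNReal.ofReal ((1 + |β|) ^ M) * (ENNReal.ofReal
        |(LinearMap.det (stretch θ p (1 / L)))⁻¹| * I) := by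
        rw [lintegral_const_mul', lintegral_comp_linearMap (f := fun v : E => ENNReal.ofReal ((1 + ‖v‖)⁻¹ ^ M)) hdpos.ne']
        · apply Measurable.ennreal_ofReal; fun_prop
        · exact ENNReal.ofReal_ne_top
    _ = ENNReal.ofReal ((1 + |β|) ^ M * (|(LinearMap.det (stretch θ p (1 / L)))⁻¹| * I.toReal)) := by
        rw [ENNReal.ofReal_mul (by positivity), ENNReal.ofReal_mul (by positivity),
          ENNReal.ofReal_toReal hfin.ne]
    _ ≤ _ := by
        apply ENNReal.ofReal_le_ofReal
        have h5 : |(LinearMap.det (stretch θ p (1 / L)))⁻¹| ≤ (α ^ 2)⁻¹ * (L * (p ^ n)⁻¹) := by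
          rw [abs_of_pos (by positivity), hdet]
          have : p ^ n * (α ^ 2 / L) ≤ p ^ n * (p + 1 / L * ‖θ‖ ^ 2) := by
            have : α ^ 2 / L ≤ 1 / L * ‖θ‖ ^ 2 := by
              rw [div_eq_mul_one_div, mul_comm]; gcongr
            gcongr; linarith
          calc _ ≤ (p ^ n * (α ^ 2 / L))⁻¹ := by gcongr
            _ = _ := by field_simp
        calc _ ≤ (1 + |β|) ^ M * ((α ^ 2)⁻¹ * (L * (p ^ n)⁻¹) * (I.toReal + 1)) := by
              gcongr; linarith
          _ = _ := by ring

/-- Volume of a tube of width `ε` around a line. -/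
lemma exists_volume_tube_le {E : Type*} [NormedAddCommGroup E] [InnerProductSpace ℝ E]
    [FiniteDimensional ℝ E] [MeasurableSpace E] [BorelSpace E] {n : ℕ}
    (hE : Module.finrank ℝ E = n + 1) {α β : ℝ} (hα : 0 < α) :
    ∃ C : ℝ, 0 < C ∧ ∀ (σ : E), α ≤ ‖σ‖ → ‖σ‖ ≤ β → ∀ ε : ℝ, 0 < ε →
      volume {θ : E | ‖θ‖ ≤ β ∧ ∃ t : ℝ, |t| ≤ β ∧ ‖θ - t • σ‖ ≤ ε} ≤
        ENNReal.ofReal (C * ε ^ n) := by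
  set R : ℝ := 1 + (|β| + |β|) * (α ^ 2)⁻¹ * |β| with hR
  set V := volume (Metric.closedBall (0 : E) R) with hV
  have hVfin : V < ∞ := measure_closedBall_lt_top
  set U := volume (Metric.closedBall (0 : E) β) with hU
  have hUfin : U < ∞ := measure_closedBall_lt_top
  refine ⟨(1 + β ^ 2) * (V.toReal + 1) + U.toReal, by positivity, ?_⟩
  intro σ h1 h2 ε hε
  have hσ : 0 < ‖σ‖ := hα.trans_le h1
  have hβ : 0 < β := hσ.trans_le h2
  have hRpos : 0 < R := by positivity
  rcases le_total 1 ε with h | h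
  · calc _ ≤ U := by
          apply measure_mono
          rintro θ ⟨h3, -⟩
          simpa using h3
      _ = ENNReal.ofReal U.toReal := by rw [ENNReal.ofReal_toReal hUfin.ne]
      _ ≤ _ := by
          apply ENNReal.ofReal_le_ofReal
          have : 1 ≤ ε ^ n := one_le_pow₀ h
          have h0 : 0 ≤ U.toReal := ENNReal.toReal_nonneg
          have h00 : 0 ≤ (1 + β ^ 2) * (V.toReal + 1) := by positivity
          nlinarith
  · have hdet := det_stretch hE σ hε 1
    have hsub : {θ : E | ‖θ‖ ≤ β ∧ ∃ t : ℝ, |t| ≤ β ∧ ‖θ - t • σ‖ ≤ ε} ⊆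
        stretch σ ε 1 '' (Metric.closedBall (0 : E) R) := by
      rintro θ ⟨-, t, ht, hw⟩
      obtain ⟨w, hwdef⟩ : ∃ w, w = ε⁻¹ • (θ - t • σ) := ⟨_, rfl⟩
      have hwn : ‖w‖ ≤ 1 := by
        rw [hwdef, norm_smul, norm_inv, Real.norm_of_nonneg hε.le, inv_mul_le_iff₀ hε]; linarith
      set c : ℝ := (t - inner ℝ σ w) / (ε + ‖σ‖ ^ 2) with hc
      refine ⟨w + c • σ, ?_, ?_⟩
      · rw [mem_closedBall_zero_iff]
        have hi : |(inner ℝ σ w : ℝ)| ≤ β := by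
          refine (abs_real_inner_le_norm _ _).trans ?_
          nlinarith [norm_nonneg w]
        have hcb : |c| ≤ (|β| + |β|) * (α ^ 2)⁻¹ := by
          rw [hc, abs_div, abs_of_pos (by positivity : 0 < ε + ‖σ‖ ^ 2), div_eq_mul_inv]
          have h5 : α ^ 2 ≤ ε + ‖σ‖ ^ 2 := by nlinarith
          have h6 : |t - inner ℝ σ w| ≤ |β| + |β| := by
            rw [abs_of_pos hβ]
            exact (abs_sub _ _).trans (by linarith)
          gcongr
        refine (norm_add_le _ _).trans ?_
        rw [norm_smul, Real.norm_eq_abs, hR]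
        have : |c| * ‖σ‖ ≤ (|β| + |β|) * (α ^ 2)⁻¹ * |β| := by
          gcongr; exact h2.trans (le_abs_self _)
        linarith
      · rw [stretch_apply]
        have h7 : ε • w = θ - t • σ := by rw [hwdef, smul_smul, mul_inv_cancel₀ hε.ne', one_smul]
        rw [smul_add, h7, inner_add_right, inner_smul_right, real_inner_self_eq_norm_sq, smul_smul]
        have h8 : ε * c + 1 * (inner ℝ σ w + c * ‖σ‖ ^ 2) = t := by
          rw [hc]; field_simp; ring
        calc θ - t • σ + (ε * c) • σ + (1 * (inner ℝ σ w + c * ‖σ‖ ^ 2)) • σ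
            = θ - t • σ + (ε * c + 1 * (inner ℝ σ w + c * ‖σ‖ ^ 2)) • σ := by
              rw [add_smul]; abel
          _ = θ := by rw [h8]; abel
    refine (measure_mono hsub).trans ?_
    rw [Measure.addHaar_image_linearMap, hdet]
    rw [← hV, ← ENNReal.ofReal_toReal hVfin.ne, ← ENNReal.ofReal_mul (by positivity)]
    apply ENNReal.ofReal_le_ofReal
    rw [abs_of_pos (by positivity), ENNReal.toReal_ofReal (by positivity)]
    have : ε + 1 * ‖σ‖ ^ 2 ≤ 1 + β ^ 2 := by nlinarith
    calc ε ^ n * (ε + 1 * ‖σ‖ ^ 2) * V.toReal ≤ ε ^ n * (1 + β ^ 2) * (V.toReal + 1) := by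
          gcongr; linarith
      _ ≤ _ := by
          have : 0 ≤ ε ^ n * U.toReal := by positivity
          nlinarith

/-- Volume lower bound for a small conic neighbourhood of width `ε`. -/
lemma exists_le_volume_stretch {E : Type*} [NormedAddCommGroup E] [InnerProductSpace ℝ E]
    [FiniteDimensional ℝ E] [MeasurableSpace E] [BorelSpace E] {n : ℕ}
    (hE : Module.finrank ℝ E = n + 1) {α c : ℝ} (hα : 0 < α) (hc : 0 < c) :
    ∃ κ : ℝ, 0 < κ ∧ ∀ (θ : E), α ≤ ‖θ‖ → ∀ ε : ℝ, 0 < ε →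
      ENNReal.ofReal (κ * ε ^ n) ≤
        volume ((fun ζ => θ + stretch θ ε 1 ζ) '' Metric.ball (0 : E) c) := by
  set V := volume (Metric.ball (0 : E) c) with hV
  have hVfin : V < ∞ := measure_ball_lt_top
  have hVpos : 0 < V := Metric.measure_ball_pos _ _ hc
  have hV0 : 0 < V.toReal := ENNReal.toReal_pos hVpos.ne' hVfin.ne
  refine ⟨α ^ 2 * V.toReal, by positivity, ?_⟩
  intro θ h1 ε hε
  have : (fun ζ => θ + stretch θ ε 1 ζ) '' Metric.ball (0 : E) c =
      (fun w => θ + w) '' (stretch θ ε 1 '' Metric.ball (0 : E) c) := by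
    rw [← image_comp]; rfl
  rw [this]
  rw [image_add_left, measure_preimage_add, Measure.addHaar_image_linearMap, det_stretch hE θ hε 1,
    ← hV, ← ENNReal.ofReal_toReal hVfin.ne, ← ENNReal.ofReal_mul (by positivity)]
  apply ENNReal.ofReal_le_ofReal
  rw [abs_of_pos (by positivity), ENNReal.toReal_ofReal (by positivity)]
  have : α ^ 2 ≤ ε + 1 * ‖θ‖ ^ 2 := by nlinarith
  calc α ^ 2 * V.toReal * ε ^ n = ε ^ n * α ^ 2 * V.toReal := by ring
    _ ≤ _ := by gcongr

lemma ContDiff.integral_zero_one {P : Type*} [NormedAddCommGroup P] [NormedSpace ℝ P]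
    {G : P × ℝ → ℝ} (hG : ContDiff ℝ (⊤ : ℕ∞) G) :
    ContDiff ℝ (⊤ : ℕ∞) fun p => ∫ t in (0 : ℝ)..1, G (p, t) := by
  obtain ⟨κ, hκ1, hκ2, hκ3, -⟩ : ∃ κ : ℝ → ℝ, ContDiff ℝ (⊤ : ℕ∞) κ ∧ HasCompactSupport κ ∧
      (∀ t ∈ Icc (-1 : ℝ) 1, κ t = 1) ∧ True := by
    let b : ContDiffBump (0 : ℝ) := ⟨1, 2, by norm_num, by norm_num⟩
    refine ⟨b, b.contDiff, b.hasCompactSupport, fun t ht => ?_, trivial⟩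
    apply b.one_of_mem_closedBall
    rw [mem_closedBall_zero_iff, Real.norm_eq_abs, abs_le]; exact ht
  let g : P → ℝ → ℝ := fun p s => κ s * G (p, -s)
  have hg : ContDiff ℝ (⊤ : ℕ∞) ↿g := by
    change ContDiff ℝ (⊤ : ℕ∞) fun q : P × ℝ => κ q.2 * G (q.1, -q.2)
    exact (hκ1.comp contDiff_snd).mul (hG.comp (contDiff_fst.prodMk contDiff_snd.neg))
  have hf : LocallyIntegrable (indicator (Ioc (0 : ℝ) 1) (fun _ => (1 : ℝ))) volume := by
    apply Integrable.locallyIntegrable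
    exact (integrable_indicator_iff measurableSet_Ioc).2 (by simp [integrableOn_const_iff])
  have h := contDiffOn_convolution_right_with_param (n := (⊤ : ℕ∞))
    (ContinuousLinearMap.mul ℝ ℝ) (g := g) (s := univ)
    isOpen_univ hκ2 (fun p x _ hx => by simp [g, image_eq_zero_of_notMem_tsupport hx]) hf
    hg.contDiffOn
  rw [univ_prod_univ, contDiffOn_univ] at h
  have h2 := h.comp (contDiff_id.prodMk (contDiff_const (c := (0 : ℝ))) : ContDiff ℝ (⊤ : ℕ∞)
    fun p : P => (p, (0 : ℝ)))
  convert h2 using 1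
  ext p
  simp only [Function.comp, convolution_def, ContinuousLinearMap.mul_apply', id]
  rw [intervalIntegral.integral_of_le zero_le_one, ← integral_indicator measurableSet_Ioc]
  congr 1
  ext t
  by_cases ht : t ∈ Ioc (0 : ℝ) 1
  · simp [ht, g, hκ3 (-t) ⟨by linarith [ht.2], by linarith [ht.1]⟩]
  · simp [ht]

/-- The quadratic Taylor remainder `∫₀¹ (1-t) f''(w + t v)(v, v) dt`. -/
def quadRem {E : Type*} [NormedAddCommGroup E] [NormedSpace ℝ E] (f : E → ℝ) (w v ζ : E) : ℝ :=
  ∫ t in (0 : ℝ)..1, (1 - t) * fderiv ℝ (fderiv ℝ f) (w + t • v) ζ ζ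

lemma eq_add_quadRem {E : Type*} [NormedAddCommGroup E] [NormedSpace ℝ E] {f : E → ℝ}
    (hf : ContDiff ℝ (⊤ : ℕ∞) f) (w v : E) :
    f (w + v) = f w + fderiv ℝ f w v + quadRem f w v v := by
  have hd : ContDiff ℝ (⊤ : ℕ∞) (fderiv ℝ f) := hf.fderiv_right (by simp)
  have h1 : ∀ t : ℝ, HasDerivAt (fun t : ℝ => w + t • v) v t := fun t => by
    simpa using ((hasDerivAt_id t).smul_const v).const_add w
  have hf1 : ∀ t : ℝ, HasDerivAt (fun t : ℝ => f (w + t • v)) (fderiv ℝ f (w + t • v) v) t :=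
    fun t => ((hf.differentiable (by simp)) _).hasFDerivAt.comp_hasDerivAt t (h1 t)
  have hf2 : ∀ t : ℝ, HasDerivAt (fun t : ℝ => fderiv ℝ f (w + t • v) v)
      (fderiv ℝ (fderiv ℝ f) (w + t • v) v v) t := fun t => by
    have := ((hd.differentiable (by simp)) _).hasFDerivAt.comp_hasDerivAt t (h1 t)
    exact this.clm_apply (hasDerivAt_const t v) |>.congr_deriv (by simp)
  have hF : ∀ t ∈ uIcc (0 : ℝ) 1, HasDerivAt
      (fun t : ℝ => (1 - t) * fderiv ℝ f (w + t • v) v + f (w + t • v))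
      ((1 - t) * fderiv ℝ (fderiv ℝ f) (w + t • v) v v) t := fun t _ => by
    have := (((hasDerivAt_id t).const_sub 1).mul (hf2 t)).add (hf1 t)
    refine this.congr_deriv ?_
    simp only [id]; ring
  have hc : Continuous fun t : ℝ => (1 - t) * fderiv ℝ (fderiv ℝ f) (w + t • v) v v := by
    have : Continuous (fderiv ℝ (fderiv ℝ f)) := (hd.continuous_fderiv (by simp))
    fun_prop
  have := intervalIntegral.integral_eq_sub_of_hasDerivAt hF (hc.intervalIntegrable _ _)
  rw [quadRem, this]
  simp only [sub_self, zero_mul, one_smul, zero_smul, add_zero, sub_zero, one_mul, zero_add]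
  ring

/-! ### Distance functions -/

namespace IsDistFn

variable {d : ℕ} {a : Rd d → ℝ}

lemma map_zero (ha : IsDistFn a) : a 0 = 0 := by
  have := ha.homog 2 two_pos 0
  rw [smul_zero] at this; linarith

lemma nonneg (ha : IsDistFn a) (ξ : Rd d) : 0 ≤ a ξ := by
  rcases eq_or_ne ξ 0 with rfl | h
  · rw [ha.map_zero]
  · exact (ha.pos ξ h).le

lemma isOpen_ne : IsOpen {ξ : Rd d | ξ ≠ 0} := isOpen_compl_singleton

lemma contDiffAt (ha : IsDistFn a) {ξ : Rd d} (h : ξ ≠ 0) : ContDiffAt ℝ (⊤ : ℕ∞) a ξ :=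
  ha.smooth.contDiffAt (isOpen_ne.mem_nhds h)

lemma differentiableAt (ha : IsDistFn a) {ξ : Rd d} (h : ξ ≠ 0) : DifferentiableAt ℝ a ξ :=
  (ha.contDiffAt h).differentiableAt (by simp)

lemma exists_bounds (ha : IsDistFn a) : ∃ c₁ c₂ : ℝ, 0 < c₁ ∧ 0 < c₂ ∧
    ∀ ξ : Rd d, c₁ * ‖ξ‖ ≤ a ξ ∧ a ξ ≤ c₂ * ‖ξ‖ := by
  have hS : IsCompact (Metric.sphere (0 : Rd d) 1) := isCompact_sphere _ _
  have hc : ContinuousOn a (Metric.sphere (0 : Rd d) 1) := ha.smooth.continuousOn.mono (by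
    intro ξ hξ; rintro rfl; simp at hξ)
  rcases (Metric.sphere (0 : Rd d) 1).eq_empty_or_nonempty with hE | hE
  · refine ⟨1, 1, one_pos, one_pos, fun ξ => ?_⟩
    have : ξ = 0 := by
      by_contra h
      have : ‖ξ‖⁻¹ • ξ ∈ Metric.sphere (0 : Rd d) 1 := by
        simp [norm_smul, h]
      rw [hE] at this; exact this
    subst this; simp [ha.map_zero]
  · obtain ⟨x, hx, hmin⟩ := hS.exists_isMinOn hE hc
    obtain ⟨y, hy, hmax⟩ := hS.exists_isMaxOn hE hc
    have hne : ∀ {z : Rd d}, z ∈ Metric.sphere (0 : Rd d) 1 → z ≠ 0 := by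
      intro ξ hξ; rintro rfl; simp at hξ
    refine ⟨a x, a y, ha.pos x (hne hx), ha.pos y (hne hy), fun ξ => ?_⟩
    rcases eq_or_ne ξ 0 with rfl | h
    · simp [ha.map_zero]
    · have hn : 0 < ‖ξ‖ := norm_pos_iff.2 h
      have hm : ‖ξ‖⁻¹ • ξ ∈ Metric.sphere (0 : Rd d) 1 := by
        simp [norm_smul, h]
      have e : a ξ = a (‖ξ‖⁻¹ • ξ) * ‖ξ‖ := by
        rw [ha.homog _ (inv_pos.2 hn)]; field_simp
      rw [e]
      exact ⟨mul_le_mul_of_nonneg_right (hmin hm) hn.le, mul_le_mul_of_nonneg_right (hmax hm) hn.le⟩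

lemma fderiv_smul (ha : IsDistFn a) {t : ℝ} (ht : 0 < t) {ξ : Rd d} (h : ξ ≠ 0) :
    fderiv ℝ a (t • ξ) = fderiv ℝ a ξ := by
  have h1 : HasFDerivAt (fun ξ => a (t • ξ)) (t • fderiv ℝ a (t • ξ)) ξ := by
    have h2 := (ha.differentiableAt (smul_ne_zero ht.ne' h)).hasFDerivAt
    have h3 : HasFDerivAt (fun ξ : Rd d => t • ξ) (t • ContinuousLinearMap.id ℝ (Rd d)) ξ :=
      (hasFDerivAt_id ξ).const_smul t
    refine (h2.comp ξ h3).congr_fderiv ?_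
    ext; simp
  have h4 : HasFDerivAt (fun ξ => a (t • ξ)) (t • fderiv ℝ a ξ) ξ := by
    have : (fun ξ => a (t • ξ)) = fun ξ => t * a ξ := funext fun ξ => ha.homog t ht ξ
    rw [this]
    exact (ha.differentiableAt h).hasFDerivAt.const_mul t
  exact smul_right_injective _ ht.ne' (h1.unique h4)

lemma fderiv_self (ha : IsDistFn a) {ξ : Rd d} (h : ξ ≠ 0) : fderiv ℝ a ξ ξ = a ξ := by
  have h1 : HasDerivAt (fun t : ℝ => a (t • ξ)) (fderiv ℝ a ξ ξ) 1 := by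
    have h2 : HasFDerivAt a (fderiv ℝ a ξ) ((1 : ℝ) • ξ) := by
      rw [one_smul]; exact (ha.differentiableAt h).hasFDerivAt
    have h3 : HasDerivAt (fun t : ℝ => t • ξ) ξ 1 := by
      simpa using (hasDerivAt_id (1 : ℝ)).smul_const ξ
    exact h2.comp_hasDerivAt 1 h3
  have h4 : HasDerivAt (fun t : ℝ => a (t • ξ)) (a ξ) 1 := by
    have : HasDerivAt (fun t : ℝ => t * a ξ) (a ξ) 1 := by
      simpa using (hasDerivAt_id (1 : ℝ)).mul_const (a ξ)
    refine this.congr_of_eventuallyEq ?_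
    filter_upwards [lt_mem_nhds (zero_lt_one (α := ℝ))] with t ht using ha.homog t ht ξ
  exact h1.unique h4

lemma gradient_smul (ha : IsDistFn a) {t : ℝ} (ht : 0 < t) {ξ : Rd d} (h : ξ ≠ 0) :
    gradient a (t • ξ) = gradient a ξ := by
  simp only [gradient, ha.fderiv_smul ht h]

lemma inner_gradient (v ξ : Rd d) : (inner ℝ (gradient a ξ) v : ℝ) = fderiv ℝ a ξ v := by
  simp [gradient]

lemma inner_gradient_self (ha : IsDistFn a) {ξ : Rd d} (h : ξ ≠ 0) :
    (inner ℝ (gradient a ξ) ξ : ℝ) = a ξ := by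
  rw [inner_gradient, ha.fderiv_self h]

/-- Smooth truncation near the origin. -/
lemma exists_cutoff (ha : IsDistFn a) {ε : ℝ} (hε : 0 < ε) :
    ∃ f : Rd d → ℝ, ContDiff ℝ (⊤ : ℕ∞) f ∧ ∀ ξ, ε ≤ ‖ξ‖ → f ξ = a ξ := by
  let b : ContDiffBump (0 : Rd d) := ⟨ε / 2, ε, by positivity, by linarith⟩
  refine ⟨fun ξ => (1 - b ξ) * a ξ, ?_, fun ξ hξ => ?_⟩
  · rw [contDiff_iff_contDiffAt]
    intro ξ
    rcases eq_or_ne ξ 0 with rfl | h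
    · have : (fun ξ => (1 - b ξ) * a ξ) =ᶠ[nhds 0] fun _ => 0 := by
        filter_upwards [b.eventuallyEq_one] with ξ hξ
        simp only [Pi.one_apply] at hξ
        rw [hξ]; ring
      exact contDiffAt_const.congr_of_eventuallyEq this
    · exact (contDiffAt_const.sub b.contDiffAt).mul (ha.contDiffAt h)
  · have : b ξ = 0 := b.zero_of_le_dist (by simpa using hξ)
    simp [this]

end IsDistFn

lemma norm_iteratedFDeriv_section_le {P V F : Type*} [NormedAddCommGroup P] [NormedSpace ℝ P]
    [NormedAddCommGroup V] [NormedSpace ℝ V] [NormedAddCommGroup F] [NormedSpace ℝ F]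
    {U : P × V → F} (hU : ContDiff ℝ (⊤ : ℕ∞) U) (p : P) (v : V) (i : ℕ) :
    ‖iteratedFDeriv ℝ i (fun x => U (p, x)) v‖ ≤ ‖iteratedFDeriv ℝ i U (p, v)‖ := by
  have h1 : (fun x => U (p, x)) =
      (fun q => U ((p, 0) + q)) ∘ ContinuousLinearMap.inr ℝ P V := by
    ext x; simp
  have h2 : ContDiff ℝ (⊤ : ℕ∞) fun q => U ((p, 0) + q) := hU.comp (contDiff_const.add contDiff_id)
  rw [h1, ContinuousLinearMap.iteratedFDeriv_comp_right _ h2 v (i := i)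
    (by exact_mod_cast le_top), iteratedFDeriv_comp_add_left]
  refine (ContinuousMultilinearMap.norm_compContinuousLinearMap_le _ _).trans ?_
  have h3 : ‖ContinuousLinearMap.inr ℝ P V‖ ≤ 1 :=
    ContinuousLinearMap.opNorm_le_bound _ zero_le_one (fun x => by simp)
  have h4 : ∏ _j : Fin i, ‖ContinuousLinearMap.inr ℝ P V‖ ≤ 1 :=
    Finset.prod_le_one (fun _ _ => norm_nonneg _) (fun _ _ => h3)
  calc _ ≤ ‖iteratedFDeriv ℝ i U ((p, 0) + ContinuousLinearMap.inr ℝ P V v)‖ * 1 := by gcongr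
    _ = _ := by simp

/-- Uniform rapid decay of the Fourier transform of a compactly supported smooth family. -/
lemma exists_fourier_decay {P V : Type*} [NormedAddCommGroup P] [NormedSpace ℝ P]
    [NormedAddCommGroup V] [NormedSpace ℝ V] [FiniteDimensional ℝ V] [MeasurableSpace V]
    [BorelSpace V] (μ : Measure V) [μ.IsAddHaarMeasure] {U : P × V → ℂ}
    (hU : ContDiff ℝ (⊤ : ℕ∞) U) {K : Set P} (hK : IsCompact K) {S : Set V} (hS : IsCompact S)
    (hUS : ∀ p, ∀ v, v ∉ S → U (p, v) = 0) (M : ℕ) :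
    ∃ C : ℝ, 0 ≤ C ∧ ∀ p ∈ K, ∀ ℓ : V →L[ℝ] ℝ, ∀ v : V, ‖v‖ ≤ 1 →
      |ℓ v| ^ M * ‖∫ x, U (p, x) * Complex.exp ((ℓ x : ℂ) * Complex.I) ∂μ‖ ≤ C := by
  have hB : ∀ i : ℕ, ∃ B : ℝ, 0 ≤ B ∧ ∀ p ∈ K, ∀ v ∈ S, ‖iteratedFDeriv ℝ i U (p, v)‖ ≤ B := by
    intro i
    obtain ⟨B, hB⟩ := (hK.prod hS).exists_bound_of_continuousOn
      (hU.continuous_iteratedFDeriv (m := i) (by exact_mod_cast le_top)).continuousOn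
    exact ⟨max B 0, le_max_right _ _, fun p hp v hv => (hB (p, v) ⟨hp, hv⟩).trans (le_max_left _ _)⟩
  choose B hB0 hB using hB
  refine ⟨(2 * π) ^ M * (2 ^ M * ∑ q ∈ Finset.range 1 ×ˢ Finset.range (M + 1),
    B q.2 * (μ S).toReal), by
      have : ∀ q ∈ Finset.range 1 ×ˢ Finset.range (M + 1), 0 ≤ B q.2 * (μ S).toReal :=
        fun q _ => mul_nonneg (hB0 _) ENNReal.toReal_nonneg
      have := Finset.sum_nonneg this
      positivity, ?_⟩
  intro p hp ℓ v hv
  set f : V → ℂ := fun x => U (p, x) with hf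
  have hfs : ContDiff ℝ (⊤ : ℕ∞) f := hU.comp (contDiff_const.prodMk contDiff_id)
  have hfsupp : tsupport f ⊆ S := closure_minimal (fun x hx => by
    by_contra h; exact hx (hUS p x h)) hS.isClosed
  have hz : ∀ i x, x ∉ S → iteratedFDeriv ℝ i f x = 0 := by
    intro i x hx
    by_contra h
    exact hx (hfsupp (support_iteratedFDeriv_subset (𝕜 := ℝ) i h))
  have hcont : ∀ i : ℕ, Continuous (iteratedFDeriv ℝ i f) := fun i =>
    hfs.continuous_iteratedFDeriv (m := i) (by exact_mod_cast le_top)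
  have hint : ∀ k i : ℕ, Integrable (fun v => ‖v‖ ^ k * ‖iteratedFDeriv ℝ i f v‖) μ := by
    intro k i
    apply Continuous.integrable_of_hasCompactSupport
    · exact (continuous_norm.pow k).mul (hcont i).norm
    · refine HasCompactSupport.intro hS fun x hx => ?_
      rw [hz i x hx]; simp
  have hkey := VectorFourier.pow_mul_norm_iteratedFDeriv_fourierIntegral_le
    (ContinuousLinearMap.apply ℝ ℝ : V →L[ℝ] (V →L[ℝ] ℝ) →L[ℝ] ℝ) (μ := μ) (K := (⊤ : ℕ∞))
    (N := (⊤ : ℕ∞)) hfs (fun k n _ _ => hint k n) (k := 0) (n := M) le_top le_top v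
    (-((2 * π)⁻¹ • ℓ))
  rw [norm_iteratedFDeriv_zero] at hkey
  have hFI : VectorFourier.fourierIntegral 𝐞 μ
      (ContinuousLinearMap.apply ℝ ℝ : V →L[ℝ] (V →L[ℝ] ℝ) →L[ℝ] ℝ).toLinearMap₁₂ f
      (-((2 * π)⁻¹ • ℓ)) = ∫ x, U (p, x) * Complex.exp ((ℓ x : ℂ) * Complex.I) ∂μ := by
    rw [VectorFourier.fourierIntegral]
    congr 1
    ext x
    have hx : 2 * π * -((ContinuousLinearMap.apply ℝ ℝ :
        V →L[ℝ] (V →L[ℝ] ℝ) →L[ℝ] ℝ).toLinearMap₁₂ x (-((2 * π)⁻¹ • ℓ))) = ℓ x := by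
      change 2 * π * -(-((2 * π)⁻¹ * ℓ x)) = ℓ x
      field_simp
    rw [Circle.smul_def, Real.fourierChar_apply, smul_eq_mul, hx, mul_comm]
  rw [hFI] at hkey
  have hsum : ∑ q ∈ Finset.range 1 ×ˢ Finset.range (M + 1),
      ∫ v, ‖v‖ ^ q.1 * ‖iteratedFDeriv ℝ q.2 f v‖ ∂μ ≤
      ∑ q ∈ Finset.range 1 ×ˢ Finset.range (M + 1), B q.2 * (μ S).toReal := by
    apply Finset.sum_le_sum
    rintro ⟨k, i⟩ hq
    simp only [Finset.mem_product, Finset.mem_range] at hq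
    obtain rfl : k = 0 := by omega
    have h1 : ∀ x, ‖x‖ ^ 0 * ‖iteratedFDeriv ℝ i f x‖ ≤ S.indicator (fun _ => B i) x := by
      intro x
      by_cases hx : x ∈ S
      · rw [indicator_of_mem hx, pow_zero, one_mul]
        exact (norm_iteratedFDeriv_section_le hU p x i).trans (hB i p hp x hx)
      · rw [indicator_of_notMem hx, hz i x hx]; simp
    calc _ ≤ ∫ x, S.indicator (fun _ => B i) x ∂μ := by
          apply integral_mono (hint 0 i) _ h1
          rw [integrable_indicator_iff hS.measurableSet]
          exact integrableOn_const hS.measure_lt_top.ne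
      _ = _ := by
          rw [integral_indicator_const _ hS.measurableSet, smul_eq_mul, mul_comm, Measure.real]
  have e1 : |(ContinuousLinearMap.apply ℝ ℝ : V →L[ℝ] (V →L[ℝ] ℝ) →L[ℝ] ℝ) v (-((2 * π)⁻¹ • ℓ))| =
      (2 * π)⁻¹ * |ℓ v| := by
    simp [abs_mul, abs_of_pos pi_pos]
  simp only [e1, pow_zero, mul_one, Nat.cast_zero, mul_zero, zero_add] at hkey
  have hv1 : ‖v‖ ^ M ≤ 1 := pow_le_one₀ (norm_nonneg _) hv
  set J := ‖∫ x, U (p, x) * Complex.exp ((ℓ x : ℂ) * Complex.I) ∂μ‖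
  have hpos : 0 ≤ ∑ q ∈ Finset.range 1 ×ˢ Finset.range (M + 1),
      ∫ v, ‖v‖ ^ q.1 * ‖iteratedFDeriv ℝ q.2 f v‖ ∂μ :=
    Finset.sum_nonneg fun q _ => integral_nonneg fun x => by positivity
  calc |ℓ v| ^ M * J = (2 * π) ^ M * (((2 * π)⁻¹ * |ℓ v|) ^ M * J) := by
        rw [mul_pow _ |ℓ v|, inv_pow]; field_simp
    _ ≤ (2 * π) ^ M * (‖v‖ ^ M * 2 ^ M * ∑ p ∈ Finset.range 1 ×ˢ Finset.range (M + 1),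
          ∫ v, ‖v‖ ^ p.1 * ‖iteratedFDeriv ℝ p.2 f v‖ ∂μ) := by gcongr
    _ ≤ (2 * π) ^ M * (1 * 2 ^ M * ∑ q ∈ Finset.range 1 ×ˢ Finset.range (M + 1),
          B q.2 * (μ S).toReal) := by gcongr
    _ = _ := by rw [one_mul]

/-- The oscillatory integral `∫ u(ξ) e^{i (r a(ξ) + 2π⟨x, ξ⟩)} dξ`. -/
def oscInt {d : ℕ} (a u : Rd d → ℝ) (r : ℝ) (x : Rd d) : ℂ :=
  ∫ ξ : Rd d, (u ξ : ℂ) * Complex.exp (((r * a ξ + 2 * π * inner ℝ x ξ : ℝ) : ℂ) * Complex.I)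

/-- The gradient `r ∇a(θ) + 2π x` of the phase function `r a(θ) + 2π⟨x, θ⟩`. -/
def phaseGrad {d : ℕ} (a : Rd d → ℝ) (r : ℝ) (x θ : Rd d) : Rd d :=
  r • gradient a θ + (2 * π) • x

/-- The smooth amplitude obtained after rescaling the oscillatory integral. -/
def ampl {d : ℕ} (f u φ : Rd d → ℝ) (χ : ℝ → ℝ) (q : (ℝ × ℝ × Rd d) × (ℝ × Rd d)) : ℂ :=
  ((χ q.2.1 * φ q.2.2 * q.2.1 ^ d * u (q.2.1 • q.1.2.2 + q.1.1 • q.2.2) : ℝ) : ℂ) *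
    Complex.exp (((q.1.2.1 * quadRem f (q.2.1 • q.1.2.2) (q.1.1 • q.2.2) q.2.2 : ℝ) : ℂ)
      * Complex.I)

lemma contDiff_ampl {d : ℕ} {f u φ : Rd d → ℝ} {χ : ℝ → ℝ} (hf : ContDiff ℝ (⊤ : ℕ∞) f)
    (hu : ContDiff ℝ (⊤ : ℕ∞) u) (hφ : ContDiff ℝ (⊤ : ℕ∞) φ) (hχ : ContDiff ℝ (⊤ : ℕ∞) χ) :
    ContDiff ℝ (⊤ : ℕ∞) (ampl f u φ χ) := by
  have hd : ContDiff ℝ (⊤ : ℕ∞) (fderiv ℝ (fderiv ℝ f)) :=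
    (hf.fderiv_right (m := (⊤ : ℕ∞)) (by simp)).fderiv_right (by simp)
  have hq : ContDiff ℝ (⊤ : ℕ∞) fun q : (ℝ × ℝ × Rd d) × (ℝ × Rd d) =>
      quadRem f (q.2.1 • q.1.2.2) (q.1.1 • q.2.2) q.2.2 := by
    unfold quadRem
    apply ContDiff.integral_zero_one (G := fun Q : ((ℝ × ℝ × Rd d) × (ℝ × Rd d)) × ℝ =>
      (1 - Q.2) * fderiv ℝ (fderiv ℝ f) (Q.1.2.1 • Q.1.1.2.2 + Q.2 • (Q.1.1.1 • Q.1.2.2))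
        Q.1.2.2 Q.1.2.2)
    have h1 : ContDiff ℝ (⊤ : ℕ∞) fun Q : ((ℝ × ℝ × Rd d) × (ℝ × Rd d)) × ℝ =>
      fderiv ℝ (fderiv ℝ f) (Q.1.2.1 • Q.1.1.2.2 + Q.2 • (Q.1.1.1 • Q.1.2.2)) :=
      hd.comp (by fun_prop)
    exact (by fun_prop : ContDiff ℝ (⊤ : ℕ∞) fun Q : ((ℝ × ℝ × Rd d) × (ℝ × Rd d)) × ℝ =>
      1 - Q.2).mul ((h1.clm_apply (by fun_prop)).clm_apply (by fun_prop))
  have hofR : ContDiff ℝ (⊤ : ℕ∞) (fun t : ℝ => (t : ℂ)) := Complex.ofRealCLM.contDiff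
  unfold ampl
  refine (hofR.comp ?_).mul (Complex.contDiff_exp.comp ((hofR.comp ?_).mul contDiff_const))
  · exact (((hχ.comp (by fun_prop)).mul (hφ.comp (by fun_prop))).mul (by fun_prop)).mul
      (hu.comp (by fun_prop))
  · exact (by fun_prop : ContDiff ℝ (⊤ : ℕ∞) fun q : (ℝ × ℝ × Rd d) × (ℝ × Rd d) => q.1.2.1).mul hq

lemma quadRem_smul {E : Type*} [NormedAddCommGroup E] [NormedSpace ℝ E] (f : E → ℝ) (w v ζ : E)
    (s : ℝ) : quadRem f w v (s • ζ) = s ^ 2 * quadRem f w v ζ := by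
  unfold quadRem
  rw [← intervalIntegral.integral_const_mul]
  congr 1
  ext t
  simp only [map_smul, smul_apply, smul_eq_mul]
  ring

/-- The linear form `(ρ, ζ) ↦ ρ⟨y, θ⟩ + s⟨y, ζ⟩`. -/
def phaseForm {d : ℕ} (y θ : Rd d) (s : ℝ) : (ℝ × Rd d) →L[ℝ] ℝ :=
  (inner ℝ y θ : ℝ) • ContinuousLinearMap.fst ℝ ℝ (Rd d) +
    s • (innerSL ℝ y).comp (ContinuousLinearMap.snd ℝ ℝ (Rd d))

lemma phaseForm_apply {d : ℕ} (y θ : Rd d) (s : ℝ) (v : ℝ × Rd d) :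
    phaseForm y θ s v = (inner ℝ y θ : ℝ) * v.1 + s * inner ℝ y v.2 := by
  simp [phaseForm]

lemma ampl_mul_exp {d : ℕ} {a f u φ : Rd d → ℝ} {χ : ℝ → ℝ} (ha : IsDistFn a)
    {α : ℝ} (hα : 0 < α) (hf : ContDiff ℝ (⊤ : ℕ∞) f) (hfa : ∀ ξ, α / 4 ≤ ‖ξ‖ → f ξ = a ξ)
    (hu : ∀ ξ, u ξ ≠ 0 → α ≤ ‖ξ‖) (hφ : ∀ ζ, α / 4 < ‖ζ‖ → φ ζ = 0)
    (hχ : ∀ t, t ∉ Icc (1 / 2 : ℝ) 2 → χ t = 0) {s r τ : ℝ} (hs : 0 ≤ s) (hs1 : s ≤ 1)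
    (hτ : r * s ^ 2 = τ) (x θ : Rd d) (v : ℝ × Rd d) :
    ampl f u φ χ ((s, τ, θ), v) *
        Complex.exp ((phaseForm (phaseGrad a r x θ) θ s v : ℂ) * Complex.I) =
      ((χ v.1 * φ v.2 * v.1 ^ d : ℝ) : ℂ) * ((u (v.1 • θ + s • v.2) : ℂ) *
        Complex.exp (((r * f (v.1 • θ + s • v.2) + 2 * π * inner ℝ x (v.1 • θ + s • v.2) : ℝ) : ℂ)
          * Complex.I)) := by
  obtain ⟨ρ, ζ⟩ := v
  unfold ampl
  dsimp only
  by_cases h0 : χ ρ = 0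
  · simp [h0]
  by_cases h1 : φ ζ = 0
  · simp [h1]
  by_cases h2 : u (ρ • θ + s • ζ) = 0
  · simp [h2]
  have hρ : ρ ∈ Icc (1 / 2 : ℝ) 2 := by by_contra h; exact h0 (hχ _ h)
  have hζ : ‖ζ‖ ≤ α / 4 := by by_contra h; exact h1 (hφ _ (not_le.1 h))
  have hξ := hu _ h2
  have hsζ : ‖s • ζ‖ ≤ α / 4 := by
    rw [norm_smul, Real.norm_of_nonneg hs]
    calc s * ‖ζ‖ ≤ 1 * (α / 4) := by gcongr
      _ = _ := one_mul _
  have hρθ : 3 * α / 4 ≤ ‖ρ • θ‖ := by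
    have := norm_add_le (ρ • θ) (s • ζ); linarith
  have hρ0 : 0 < ρ := by linarith [hρ.1]
  have hθ : θ ≠ 0 := by rintro rfl; simp at hρθ; linarith
  have hev : f =ᶠ[nhds (ρ • θ)] a := by
    have : {ξ : Rd d | α / 4 < ‖ξ‖} ∈ nhds (ρ • θ) :=
      (isOpen_lt continuous_const continuous_norm).mem_nhds (by simp only [mem_ofPred_eq]; linarith)
    filter_upwards [this] with ξ hξ using hfa ξ (le_of_lt hξ)
  have hquad := eq_add_quadRem hf (ρ • θ) (s • ζ)
  rw [quadRem_smul, hev.fderiv_eq, ha.fderiv_smul hρ0 hθ, hev.eq_of_nhds, ha.homog ρ hρ0,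
    ← ha.inner_gradient_self hθ, map_smul, ← IsDistFn.inner_gradient, smul_eq_mul] at hquad
  rw [hquad]
  push_cast
  rw [mul_assoc, mul_assoc ((χ ρ : ℂ) * φ ζ * ρ ^ d), ← Complex.exp_add]
  congr 3
  rw [phaseForm_apply, phaseGrad, ← hτ]
  simp only [inner_add_left, inner_add_right, real_inner_smul_left, real_inner_smul_right]
  push_cast
  ring

lemma one_add_add_pow_le {X Y : ℝ} (hX : 0 ≤ X) (hY : 0 ≤ Y) (M : ℕ) :
    (1 + X + Y) ^ M ≤ 3 ^ M * (1 + X ^ M + Y ^ M) := by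
  have h : 1 + X + Y ≤ 3 * max 1 (max X Y) := by
    have h1 := le_max_left 1 (max X Y)
    have h2 := (le_max_left X Y).trans (le_max_right 1 (max X Y))
    have h3 := (le_max_right X Y).trans (le_max_right 1 (max X Y))
    linarith
  calc (1 + X + Y) ^ M ≤ (3 * max 1 (max X Y)) ^ M := by gcongr
    _ = 3 ^ M * (max 1 (max X Y)) ^ M := mul_pow _ _ _
    _ ≤ _ := by
        gcongr
        have := pow_nonneg hX M
        have := pow_nonneg hY M
        rcases max_cases 1 (max X Y) with ⟨h, -⟩ | ⟨h, -⟩ <;> rw [h]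
        · simp only [one_pow]; linarith
        · rcases max_cases X Y with ⟨h, -⟩ | ⟨h, -⟩ <;> rw [h] <;> linarith

set_option maxHeartbeats 1000000 in
/-- Pointwise control of the oscillatory integral by the phase gradient. -/
lemma exists_oscInt_le {d : ℕ} {a u : Rd d → ℝ} (ha : IsDistFn a) (hu : ContDiff ℝ (⊤ : ℕ∞) u)
    {α β : ℝ} (hα : 0 < α) (hβ : α ≤ β) (hsupp : ∀ ξ, u ξ ≠ 0 → α ≤ ‖ξ‖ ∧ ‖ξ‖ ≤ β) (M : ℕ) :
    ∃ C : ℝ, 0 < C ∧ ∀ (r : ℝ) (x : Rd d), ‖oscInt a u r x‖ₑ ≤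
      ∫⁻ θ in {θ : Rd d | α / 4 ≤ ‖θ‖ ∧ ‖θ‖ ≤ 4 * β}, ENNReal.ofReal (C *
        (1 + |(inner ℝ (phaseGrad a r x θ) θ : ℝ)| +
          (√(1 + |r|))⁻¹ * ‖phaseGrad a r x θ‖)⁻¹ ^ M) := by
  obtain ⟨f, hf, hfa⟩ := ha.exists_cutoff (ε := α / 4) (by positivity)
  let bχ : ContDiffBump (1 : ℝ) := ⟨1 / 4, 1 / 2, by norm_num, by norm_num⟩
  let bφ : ContDiffBump (0 : Rd d) := ⟨α / 8, α / 4, by positivity, by linarith⟩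
  set χ : ℝ → ℝ := bχ.normed volume with hχd
  set φ : Rd d → ℝ := bφ.normed volume with hφd
  have hχs : ContDiff ℝ (⊤ : ℕ∞) χ := bχ.contDiff_normed
  have hφs : ContDiff ℝ (⊤ : ℕ∞) φ := bφ.contDiff_normed
  have hχ0 : ∀ t, t ∉ Icc (1 / 2 : ℝ) 2 → χ t = 0 := by
    intro t ht
    by_contra h
    have : t ∈ Function.support χ := h
    rw [hχd, bχ.support_normed_eq, Metric.mem_ball, Real.dist_eq, abs_lt] at this
    simp only [bχ] at this
    exact ht ⟨by linarith [this.1], by linarith [this.2]⟩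
  have hφ0 : ∀ ζ, α / 4 < ‖ζ‖ → φ ζ = 0 := by
    intro ζ hζ
    by_contra h
    have : ζ ∈ Function.support φ := h
    rw [hφd, bφ.support_normed_eq, mem_ball_zero_iff] at this
    simp only [bφ] at this
    linarith
  set S : Set (ℝ × Rd d) := Icc (1 / 2 : ℝ) 2 ×ˢ Metric.closedBall 0 (α / 4) with hS
  have hSc : IsCompact S := isCompact_Icc.prod (isCompact_closedBall _ _)
  set K : Set (ℝ × ℝ × Rd d) := Icc (0 : ℝ) 1 ×ˢ Icc (-1 : ℝ) 1 ×ˢ Metric.closedBall 0 (4 * β)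
    with hK
  have hKc : IsCompact K := isCompact_Icc.prod (isCompact_Icc.prod (isCompact_closedBall _ _))
  have hUs := contDiff_ampl hf hu hφs hχs
  have hUS : ∀ p, ∀ v, v ∉ S → ampl f u φ χ (p, v) = 0 := by
    intro p v hv
    have : χ v.1 = 0 ∨ φ v.2 = 0 := by
      by_contra! h
      refine hv ⟨?_, ?_⟩
      · by_contra h1; exact h.1 (hχ0 _ h1)
      · rw [mem_closedBall_zero_iff]; by_contra h1; exact h.2 (hφ0 _ (not_le.1 h1))
    rcases this with h | h <;> simp [ampl, h]
  obtain ⟨C0, hC0, hdec0⟩ := exists_fourier_decay ((volume : Measure ℝ).prod (volume : Measure (Rd d))) hUs hKc hSc hUS 0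
  obtain ⟨C1, hC1, hdec1⟩ := exists_fourier_decay ((volume : Measure ℝ).prod (volume : Measure (Rd d))) hUs hKc hSc hUS M
  rw [← Measure.volume_eq_prod] at hdec0 hdec1
  refine ⟨3 ^ M * (C0 + C1 + C1) + 1, by positivity, ?_⟩
  intro r x
  set s : ℝ := (√(1 + |r|))⁻¹ with hsd
  have hs0 : 0 < s := by positivity
  have hs1 : s ≤ 1 := by
    apply inv_le_one_of_one_le₀
    rw [Real.one_le_sqrt]; linarith [abs_nonneg r]
  have hs2 : s ^ 2 = (1 + |r|)⁻¹ := by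
    rw [hsd, inv_pow, Real.sq_sqrt (by positivity)]
  set τ : ℝ := r * s ^ 2 with hτ
  have hτ1 : τ ∈ Icc (-1 : ℝ) 1 := by
    rw [mem_Icc, ← abs_le, hτ, hs2, abs_mul, abs_of_pos (by positivity : 0 < (1 + |r|)⁻¹),
      ← div_eq_mul_inv, div_le_one (by positivity)]
    linarith
  set m : Rd d → ℂ := fun ξ => (u ξ : ℂ) *
    Complex.exp (((r * f ξ + 2 * π * inner ℝ x ξ : ℝ) : ℂ) * Complex.I) with hm
  have hmc : Continuous m := by
    have := hu.continuous
    have := hf.continuous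
    rw [hm]
    fun_prop
  have hosc : oscInt a u r x = ∫ ξ, m ξ := by
    unfold oscInt
    congr 1
    ext ξ
    by_cases h : u ξ = 0
    · simp [hm, h]
    · simp only [hm, hfa ξ (by linarith [(hsupp ξ h).1])]
  set H : (ℝ × Rd d) → Rd d → ℂ := fun v θ =>
    ((χ v.1 * φ v.2 * v.1 ^ d : ℝ) : ℂ) * m (v.1 • θ + s • v.2) with hH
  have hHeq : ∀ v θ, ampl f u φ χ ((s, τ, θ), v) *
      Complex.exp ((phaseForm (phaseGrad a r x θ) θ s v : ℂ) * Complex.I) = H v θ := fun v θ =>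
    ampl_mul_exp ha hα hf hfa (fun ξ h => (hsupp ξ h).1) hφ0 hχ0 hs0.le hs1 hτ.symm x θ v
  have hHne : ∀ v θ, H v θ ≠ 0 → v ∈ S ∧ α / 4 ≤ ‖θ‖ ∧ ‖θ‖ ≤ 4 * β := by
    intro v θ h
    rw [← hHeq] at h
    have hv : v ∈ S := by
      by_contra h1; rw [hUS _ v h1] at h; simp at h
    refine ⟨hv, ?_⟩
    have hune : u (v.1 • θ + s • v.2) ≠ 0 := by
      intro h1; simp [ampl, h1] at h
    obtain ⟨h1, h2⟩ := hsupp _ hune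
    have hζ : ‖v.2‖ ≤ α / 4 := by simpa using hv.2
    have hsζ : ‖s • v.2‖ ≤ α / 4 := by
      rw [norm_smul, Real.norm_of_nonneg hs0.le]
      calc s * ‖v.2‖ ≤ 1 * (α / 4) := by gcongr
        _ = _ := one_mul _
    have h3 := norm_add_le (v.1 • θ) (s • v.2)
    have h4 : ‖v.1 • θ‖ ≤ ‖v.1 • θ + s • v.2‖ + ‖s • v.2‖ := norm_le_add_norm_add _ _
    have h5 : ‖v.1 • θ‖ = v.1 * ‖θ‖ := by
      rw [norm_smul, Real.norm_of_nonneg]; linarith [hv.1.1]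
    rw [h5] at h3 h4
    have h6 := hv.1.1
    have h7 := hv.1.2
    have h8 := norm_nonneg θ
    constructor <;> nlinarith
  have hHc : Continuous ↿H := by
    have := hχs.continuous
    have := hφs.continuous
    change Continuous fun p : (ℝ × Rd d) × Rd d => H p.1 p.2
    rw [hH]
    fun_prop
  have hHcs : HasCompactSupport ↿H := by
    refine HasCompactSupport.intro (hSc.prod (isCompact_closedBall (0 : Rd d) (4 * β))) ?_
    rintro ⟨v, θ⟩ h
    by_contra h1
    obtain ⟨h2, -, h3⟩ := hHne v θ h1
    exact h ⟨h2, by simpa using h3⟩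
  have hin : ∀ v, ∫ θ, H v θ = ((χ v.1 * φ v.2 : ℝ) : ℂ) * ∫ ξ, m ξ := by
    intro v
    by_cases h : χ v.1 = 0
    · simp [hH, h]
    have hv : 0 < v.1 := by
      by_contra h1; exact h (hχ0 _ fun h2 => h1 (by linarith [h2.1]))
    rw [hH]
    dsimp only
    rw [integral_const_mul, Measure.integral_comp_smul volume (fun w => m (w + s • v.2)) v.1,
      integral_add_right_eq_self m, finrank_euclideanSpace_fin, abs_of_pos (by positivity),
      Complex.real_smul, ← mul_assoc]
    congr 1
    norm_cast
    field_simp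
  have htot : ∫ v, ∫ θ, H v θ = ∫ ξ, m ξ := by
    simp_rw [hin]
    rw [integral_mul_const]
    have : ∫ v : ℝ × Rd d, ((χ v.1 * φ v.2 : ℝ) : ℂ) = 1 := by
      rw [show (∫ v : ℝ × Rd d, ((χ v.1 * φ v.2 : ℝ) : ℂ)) = ((∫ v : ℝ × Rd d, χ v.1 * φ v.2 : ℝ) : ℂ)
        from integral_ofReal, Measure.volume_eq_prod, integral_prod_mul, bχ.integral_normed,
        bφ.integral_normed]
      simp
    rw [this, one_mul]
  rw [hosc, ← htot, integral_integral_swap_of_hasCompactSupport hHc hHcs]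
  refine (enorm_integral_le_lintegral_enorm _).trans ?_
  have hA : MeasurableSet {θ : Rd d | α / 4 ≤ ‖θ‖ ∧ ‖θ‖ ≤ 4 * β} :=
    (measurableSet_le measurable_const measurable_norm).inter
      (measurableSet_le measurable_norm measurable_const)
  rw [← lintegral_indicator hA]
  apply lintegral_mono
  intro θ
  by_cases hθ : θ ∈ {θ : Rd d | α / 4 ≤ ‖θ‖ ∧ ‖θ‖ ≤ 4 * β}
  · rw [indicator_of_mem hθ]
    beta_reduce
    rw [← ofReal_norm]
    apply ENNReal.ofReal_le_ofReal
    set y := phaseGrad a r x θ with hy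
    have hp : (s, τ, θ) ∈ K := ⟨⟨hs0.le, hs1⟩, hτ1, by simpa using hθ.2⟩
    have hJ : ∫ v, H v θ = ∫ v, ampl f u φ χ ((s, τ, θ), v) *
      Complex.exp ((phaseForm y θ s v : ℂ) * Complex.I) :=
      integral_congr_ae (ae_of_all _ fun v => (hHeq v θ).symm)
    rw [hJ]
    set J := ‖∫ v, ampl f u φ χ ((s, τ, θ), v) *
      Complex.exp ((phaseForm y θ s v : ℂ) * Complex.I)‖ with hJd
    have b0 := hdec0 _ hp (phaseForm y θ s) 0 (by simp)
    have b1 := hdec1 _ hp (phaseForm y θ s) (1, 0) (by simp)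
    have b2 : (s * ‖y‖) ^ M * J ≤ C1 := by
      have := hdec1 _ hp (phaseForm y θ s) (0, ‖y‖⁻¹ • y) (by
        rcases eq_or_ne y 0 with h | h
        · simp [h]
        · simp [norm_smul, h])
      rw [phaseForm_apply] at this
      simp only [mul_zero, zero_add, real_inner_smul_right, real_inner_self_eq_norm_sq] at this
      have e : |s * (‖y‖⁻¹ * ‖y‖ ^ 2)| = s * ‖y‖ := by
        rw [abs_of_nonneg (by positivity)]
        rcases eq_or_ne ‖y‖ 0 with h | h
        · simp [h]
        · field_simp
      rwa [e] at this
    rw [pow_zero, one_mul] at b0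
    rw [phaseForm_apply] at b1
    simp only [mul_one, inner_zero_right, mul_zero, add_zero] at b1
    have hpos : 0 < 1 + |(inner ℝ y θ : ℝ)| + s * ‖y‖ := by positivity
    have hJ0 : 0 ≤ J := norm_nonneg _
    have := one_add_add_pow_le (abs_nonneg (inner ℝ y θ : ℝ)) (by positivity : 0 ≤ s * ‖y‖) M
    rw [inv_pow, ← div_eq_mul_inv, le_div_iff₀ (by positivity)]
    calc J * (1 + |(inner ℝ y θ : ℝ)| + s * ‖y‖) ^ M
        ≤ J * (3 ^ M * (1 + |(inner ℝ y θ : ℝ)| ^ M + (s * ‖y‖) ^ M)) := by gcongr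
      _ = 3 ^ M * (J + |(inner ℝ y θ : ℝ)| ^ M * J + (s * ‖y‖) ^ M * J) := by ring
      _ ≤ 3 ^ M * (C0 + C1 + C1) := by gcongr
      _ ≤ _ := by linarith
  · rw [indicator_of_notMem hθ]
    have : ∀ v, H v θ = 0 := fun v => by
      by_contra h; exact hθ (hHne v θ h).2
    simp [this]

lemma exists_nhds_norm_sub_le {E F : Type*} [NormedAddCommGroup E] [NormedSpace ℝ E]
    [FiniteDimensional ℝ E] [NormedAddCommGroup F] [NormedSpace ℝ F] {f : E → F} {f' : E →L[ℝ] F}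
    {x : E} (hf : HasStrictFDerivAt f f' x) (hinj : ∀ v, f' v = 0 → v = 0) :
    ∃ c : ℝ, 0 < c ∧ ∃ B ∈ nhds x, ∀ y ∈ B, ∀ z ∈ B, ‖y - z‖ ≤ c * ‖f y - f z‖ := by
  obtain ⟨K, hK, hanti⟩ := LinearMap.exists_antilipschitzWith (f' : E →ₗ[ℝ] F)
    (LinearMap.ker_eq_bot'.2 hinj)
  have hK' : (0 : ℝ) < K := hK
  have h := hf.isLittleO.def (c := (2 * (K : ℝ))⁻¹) (by positivity)
  rw [nhds_prod_eq, Filter.eventually_prod_self_iff'] at h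
  obtain ⟨B, hB, hBs⟩ := h
  refine ⟨2 * K, by positivity, B, hB, fun y hy z hz => ?_⟩
  have h1 := hBs y hy z hz
  have h2 : ‖y - z‖ ≤ K * ‖f' (y - z)‖ := by
    have := hanti.le_mul_dist (y - z) 0
    simpa [dist_eq_norm] using this
  dsimp only at h1
  have h3 : ‖f' (y - z)‖ ≤ ‖f y - f z‖ + ‖f y - f z - f' (y - z)‖ := by
    have := norm_sub_le (f y - f z) (f y - f z - f' (y - z))
    simpa using this
  have h4 : K * ‖f' (y - z)‖ ≤ K * (‖f y - f z‖ + (2 * (K : ℝ))⁻¹ * ‖y - z‖) := by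
    gcongr; linarith
  have h5 : (K : ℝ) * ((2 * (K : ℝ))⁻¹ * ‖y - z‖) = ‖y - z‖ / 2 := by field_simp
  rw [mul_add, h5] at h4
  linarith

namespace IsDistFn

variable {d : ℕ} {a : Rd d → ℝ}

lemma ne_zero_of_eq_one (ha : IsDistFn a) {σ : Rd d} (h : a σ = 1) : σ ≠ 0 := by
  rintro rfl; rw [ha.map_zero] at h; exact zero_ne_one h

lemma norm_gradient_sub (ξ ζ : Rd d) :
    ‖gradient a ξ - gradient a ζ‖ = ‖fderiv ℝ a ξ - fderiv ℝ a ζ‖ := by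
  simp only [gradient]
  rw [← map_sub, LinearIsometryEquiv.norm_map]

lemma contDiffAt_fderiv (ha : IsDistFn a) {ξ : Rd d} (h : ξ ≠ 0) :
    ContDiffAt ℝ (⊤ : ℕ∞) (fderiv ℝ a) ξ :=
  (ha.contDiffAt h).fderiv_right (by simp)

/-- Nonvanishing curvature makes the Gauss map locally bi-Lipschitz. -/
lemma exists_nhds_gauss (ha : IsDistFn a) (hc : CurvNondeg a) {σ : Rd d} (hσ : a σ = 1) :
    ∃ c : ℝ, 0 < c ∧ ∃ B ∈ nhds σ, ∀ y ∈ B, ∀ z ∈ B, a y = 1 → a z = 1 →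
      ‖y - z‖ ≤ c * ‖gradient a y - gradient a z‖ := by
  have h0 := ha.ne_zero_of_eq_one hσ
  have h1 : HasStrictFDerivAt a (fderiv ℝ a σ) σ := (ha.contDiffAt h0).hasStrictFDerivAt (by simp)
  have h2 : HasStrictFDerivAt (fderiv ℝ a) (fderiv ℝ (fderiv ℝ a) σ) σ :=
    (ha.contDiffAt_fderiv h0).hasStrictFDerivAt (by simp)
  have h3 := h1.smul h2
  have hE : ∀ v, fderiv ℝ (fderiv ℝ a) σ v σ = 0 := by
    intro v
    have e1 : HasFDerivAt (fun ξ => fderiv ℝ a ξ ξ)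
        ((fderiv ℝ a σ).comp (ContinuousLinearMap.id ℝ (Rd d)) +
          (fderiv ℝ (fderiv ℝ a) σ).flip σ) σ :=
      h2.hasFDerivAt.clm_apply (hasFDerivAt_id σ)
    have e2 : HasFDerivAt (fun ξ => fderiv ℝ a ξ ξ) (fderiv ℝ a σ) σ := by
      refine h1.hasFDerivAt.congr_of_eventuallyEq ?_
      filter_upwards [isOpen_ne.mem_nhds h0] with ξ hξ using ha.fderiv_self hξ
    have := congrArg (fun L : Rd d →L[ℝ] ℝ => L v) (e1.unique e2)
    simpa using this
  obtain ⟨c, hc0, B, hB, h⟩ := exists_nhds_norm_sub_le h3 (fun v hv => by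
    by_contra hv0
    have hv1 : ∀ w, fderiv ℝ (fderiv ℝ a) σ v w + fderiv ℝ a σ v * fderiv ℝ a σ w = 0 := by
      intro w
      have := congrArg (fun L : Rd d →L[ℝ] ℝ => L w) hv
      simpa [hσ] using this
    have hv2 : fderiv ℝ a σ v = 0 := by
      have := hv1 σ
      rwa [hE, ha.fderiv_self h0, hσ, zero_add, mul_one] at this
    obtain ⟨w, -, hw⟩ := hc σ hσ v hv2 hv0
    apply hw
    rw [iteratedFDeriv_two_apply]
    have := hv1 w
    rw [hv2, zero_mul, add_zero] at this
    simpa using this)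
  refine ⟨c, hc0, B, hB, fun y hy z hz ay az => ?_⟩
  have := h y hy z hz
  rw [norm_gradient_sub]
  simpa [ay, az] using this

lemma isCompact_level (ha : IsDistFn a) : IsCompact {σ : Rd d | a σ = 1} := by
  obtain ⟨c₁, c₂, h1, h2, hb⟩ := ha.exists_bounds
  have hcl : IsClosed {σ : Rd d | a σ = 1} := by
    have : {σ : Rd d | a σ = 1} = {ξ : Rd d | c₂⁻¹ ≤ ‖ξ‖} ∩ a ⁻¹' {1} := by
      ext ξ
      simp only [mem_ofPred_eq, mem_inter_iff, mem_preimage, mem_singleton_iff]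
      refine ⟨fun h => ⟨?_, h⟩, fun h => h.2⟩
      have := (hb ξ).2
      rw [h] at this
      rwa [inv_le_iff_one_le_mul₀' h2]
    rw [this]
    apply ContinuousOn.preimage_isClosed_of_isClosed _ (isClosed_le continuous_const continuous_norm)
      isClosed_singleton
    apply ha.smooth.continuousOn.mono
    rintro ξ hξ rfl
    simp only [mem_ofPred_eq, norm_zero] at hξ
    have : 0 < c₂⁻¹ := by positivity
    linarith
  refine (isCompact_closedBall (0 : Rd d) c₁⁻¹).of_isClosed_subset hcl fun ξ hξ => ?_
  have := (hb ξ).1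
  simp only [mem_ofPred_eq] at hξ
  rw [hξ] at this
  rw [mem_closedBall_zero_iff, ← one_div, le_div_iff₀ h1]
  linarith

lemma map_inv_smul (ha : IsDistFn a) {θ : Rd d} (h : θ ≠ 0) : a ((a θ)⁻¹ • θ) = 1 := by
  have := ha.pos θ h
  rw [ha.homog _ (by positivity)]; field_simp

lemma exists_volume_gradient_le {n : ℕ} {a : Rd (n + 1) → ℝ} (ha : IsDistFn a) (hc : CurvNondeg a)
    {α β : ℝ} (hα : 0 < α) (hβ : 0 < β) :
    ∃ C : ℝ, 0 < C ∧ ∀ (y : Rd (n + 1)) (ε : ℝ), 0 < ε →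
      volume {θ : Rd (n + 1) | (α ≤ ‖θ‖ ∧ ‖θ‖ ≤ β) ∧ ‖gradient a θ - y‖ ≤ ε} ≤
        ENNReal.ofReal (C * ε ^ n) := by
  obtain ⟨c₁, c₂, h1, h2, hb⟩ := ha.exists_bounds
  have key := ha.isCompact_level.induction_on (p := fun S : Set (Rd (n + 1)) =>
    ∃ C : ℝ, 0 < C ∧ ∀ (y : Rd (n + 1)) (ε : ℝ), 0 < ε →
      volume {θ : Rd (n + 1) | ((α ≤ ‖θ‖ ∧ ‖θ‖ ≤ β) ∧ ‖gradient a θ - y‖ ≤ ε) ∧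
        (a θ)⁻¹ • θ ∈ S} ≤ ENNReal.ofReal (C * ε ^ n)) ?_ ?_ ?_ ?_
  · obtain ⟨C, hC, h⟩ := key
    refine ⟨C, hC, fun y ε hε => le_trans (measure_mono ?_) (h y ε hε)⟩
    intro θ hθ
    refine ⟨hθ, ha.map_inv_smul ?_⟩
    rintro rfl
    have := hθ.1.1
    rw [norm_zero] at this; linarith
  · exact ⟨1, one_pos, fun y ε hε => by simp⟩
  · rintro S T hST ⟨C, hC, h⟩
    refine ⟨C, hC, fun y ε hε => le_trans (measure_mono ?_) (h y ε hε)⟩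
    rintro θ ⟨h3, h4⟩
    exact ⟨h3, hST h4⟩
  · rintro S T ⟨C, hC, h⟩ ⟨C', hC', h'⟩
    refine ⟨C + C', by positivity, fun y ε hε => ?_⟩
    rw [add_mul, ENNReal.ofReal_add (by positivity) (by positivity)]
    refine le_trans (measure_mono ?_) ((measure_union_le _ _).trans (add_le_add (h y ε hε)
      (h' y ε hε)))
    rintro θ ⟨hθ, h3 | h3⟩
    · exact Or.inl ⟨hθ, h3⟩
    · exact Or.inr ⟨hθ, h3⟩
  · intro σ hσ
    obtain ⟨c, hc0, B, hB, hBs⟩ := ha.exists_nhds_gauss hc hσ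
    refine ⟨B ∩ {σ : Rd (n + 1) | a σ = 1}, Filter.inter_mem (mem_nhdsWithin_of_mem_nhds hB)
      self_mem_nhdsWithin, ?_⟩
    set β' : ℝ := max β (max (c₂ * β) c₁⁻¹) with hβ'
    have hb1 : β ≤ β' := le_max_left _ _
    have hb2 : c₂ * β ≤ β' := (le_max_left _ _).trans (le_max_right _ _)
    have hb3 : c₁⁻¹ ≤ β' := (le_max_right _ _).trans (le_max_right _ _)
    obtain ⟨C, hC, hT⟩ := exists_volume_tube_le (E := Rd (n + 1)) (n := n) (by simp)
      (α := c₂⁻¹) (β := β') (by positivity)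
    refine ⟨C * (c₂ * β * (c * 2)) ^ n, by positivity, fun y ε hε => ?_⟩
    rcases Set.eq_empty_or_nonempty {θ : Rd (n + 1) | ((α ≤ ‖θ‖ ∧ ‖θ‖ ≤ β) ∧
      ‖gradient a θ - y‖ ≤ ε) ∧ (a θ)⁻¹ • θ ∈ B ∩ {σ : Rd (n + 1) | a σ = 1}} with he | ⟨ω, hω⟩
    · rw [he]; simp
    have hne : ∀ {θ : Rd (n + 1)}, α ≤ ‖θ‖ → θ ≠ 0 := by
      rintro θ h rfl; rw [norm_zero] at h; linarith
    set σ' := (a ω)⁻¹ • ω with hσ'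
    have hσ1 : a σ' = 1 := hω.2.2
    rw [mul_assoc, ← mul_pow]
    refine le_trans (measure_mono ?_) (hT σ' ?_ ?_ (c₂ * β * (c * 2) * ε) (by positivity))
    · rintro θ ⟨⟨⟨h3, h4⟩, h5⟩, h6⟩
      have ht := ha.pos θ (hne h3)
      have hta : a θ ≤ c₂ * β := (hb θ).2.trans (by gcongr)
      refine ⟨h4.trans hb1, a θ, ?_, ?_⟩
      · rw [abs_of_pos ht]; exact hta.trans hb2
      · have e : θ - a θ • σ' = a θ • ((a θ)⁻¹ • θ - σ') := by
          rw [smul_sub, smul_inv_smul₀ ht.ne']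
        have h7 := hBs _ h6.1 _ hω.2.1 h6.2 hω.2.2
        rw [ha.gradient_smul (inv_pos.2 ht) (hne h3),
          ha.gradient_smul (inv_pos.2 (ha.pos ω (hne hω.1.1.1))) (hne hω.1.1.1)] at h7
        have h8 : ‖gradient a θ - gradient a ω‖ ≤ 2 * ε := by
          have := norm_sub_le (gradient a θ - y) (gradient a ω - y)
          rw [sub_sub_sub_cancel_right] at this
          linarith [hω.1.2]
        rw [e, norm_smul, Real.norm_of_nonneg ht.le]
        calc a θ * ‖(a θ)⁻¹ • θ - σ'‖ ≤ (c₂ * β) * (c * (2 * ε)) := by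
              gcongr; exact h7.trans (by gcongr)
          _ = _ := by ring
    · rw [inv_le_iff_one_le_mul₀' h2, ← hσ1]; exact (hb _).2
    · refine le_trans ?_ hb3
      rw [← one_div, le_div_iff₀ h1, mul_comm, ← hσ1]; exact (hb _).1

lemma measurable_gradient (a : Rd d → ℝ) : Measurable (gradient a) := by
  unfold gradient
  exact (LinearIsometryEquiv.continuous _).measurable.comp (measurable_fderiv ℝ a)

end IsDistFn

lemma measurable_phaseGrad {d : ℕ} (a : Rd d → ℝ) (r : ℝ) (x : Rd d) :
    Measurable (phaseGrad a r x) :=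
  ((IsDistFn.measurable_gradient a).const_smul r).add_const _

lemma inv_pow_le_tsum_indicator {t : ℝ} (ht : 0 ≤ t) (n : ℕ) :
    ENNReal.ofReal ((1 + t)⁻¹ ^ (n + 1)) ≤ ∑' l : ℕ, ENNReal.ofReal (2 ^ (n + 1) *
      (2 ^ l)⁻¹ ^ (n + 1)) * (if t ≤ 2 ^ l then 1 else 0) := by
  have hex : ∃ l : ℕ, t ≤ 2 ^ l := (pow_unbounded_of_one_lt t one_lt_two).imp fun _ h => h.le
  set l := Nat.find hex with hl
  have h1 : t ≤ 2 ^ l := Nat.find_spec hex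
  refine le_trans ?_ (ENNReal.le_tsum l)
  rw [if_pos h1, mul_one, ← mul_pow]
  apply ENNReal.ofReal_le_ofReal
  apply pow_le_pow_left₀ (by positivity)
  rcases Nat.eq_zero_or_pos l with h | h
  · rw [h]
    have : (1 + t)⁻¹ ≤ 1 := inv_le_one_of_one_le₀ (by linarith)
    norm_num; linarith
  · have h2 : ¬ t ≤ 2 ^ (l - 1) := Nat.find_min hex (by omega)
    push Not at h2
    have h3 : (2 : ℝ) ^ l = 2 * 2 ^ (l - 1) := by
      rw [← pow_succ']; congr 1; omega
    rw [h3, mul_inv, ← mul_assoc, mul_inv_cancel₀ two_ne_zero, one_mul]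
    gcongr; linarith

/-- Integral form of stationary phase. -/
lemma exists_lintegral_phaseGrad_le {n : ℕ} {a : Rd (n + 1) → ℝ} (ha : IsDistFn a)
    (hc : CurvNondeg a) {α β : ℝ} (hα : 0 < α) (hβ : 0 < β) :
    ∃ C : ℝ, 0 < C ∧ ∀ (r : ℝ) (x : Rd (n + 1)),
      ∫⁻ θ in {θ : Rd (n + 1) | α ≤ ‖θ‖ ∧ ‖θ‖ ≤ β},
        ENNReal.ofReal ((1 + (√(1 + |r|))⁻¹ * ‖phaseGrad a r x θ‖)⁻¹ ^ (n + 1)) ≤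
        ENNReal.ofReal (C * (√(1 + |r|))⁻¹ ^ n) := by
  obtain ⟨C, hC, hV⟩ := ha.exists_volume_gradient_le hc hα hβ
  set A : Set (Rd (n + 1)) := {θ : Rd (n + 1) | α ≤ ‖θ‖ ∧ ‖θ‖ ≤ β} with hA
  have hAm : MeasurableSet A := (measurableSet_le measurable_const measurable_norm).inter
      (measurableSet_le measurable_norm measurable_const)
  have hAfin : volume A < ∞ :=
    lt_of_le_of_lt (measure_mono (fun θ hθ => by simpa using hθ.2)) (measure_closedBall_lt_top
      (x := (0 : Rd (n + 1))) (r := β))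
  set V := (volume A).toReal with hVd
  have hV0 : 0 ≤ V := ENNReal.toReal_nonneg
  refine ⟨V * 2 ^ n + 2 ^ (n + 1) * C * 2 ^ n * 2, by positivity, fun r x => ?_⟩
  set s := (√(1 + |r|))⁻¹ with hs
  have hs0 : 0 < s := by positivity
  have hs2 : s ^ 2 = (1 + |r|)⁻¹ := by
    rw [hs, inv_pow, Real.sq_sqrt (by positivity)]
  rcases le_total |r| 1 with hr | hr
  · have hs1 : 1 ≤ 2 * s := by
      have : (1 / 2 : ℝ) ≤ (1 + |r|)⁻¹ := by
        rw [one_div]; gcongr; linarith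
      nlinarith
    calc _ ≤ ∫⁻ θ in A, 1 := by
          apply lintegral_mono
          intro θ
          simp only
          rw [← ENNReal.ofReal_one]
          apply ENNReal.ofReal_le_ofReal
          apply pow_le_one₀ (by positivity)
          apply inv_le_one_of_one_le₀
          have : 0 ≤ s * ‖phaseGrad a r x θ‖ := by positivity
          linarith
      _ = ENNReal.ofReal V := by
          rw [setLIntegral_one, hVd, ENNReal.ofReal_toReal hAfin.ne]
      _ ≤ _ := by
          apply ENNReal.ofReal_le_ofReal
          have : 1 ≤ (2 * s) ^ n := one_le_pow₀ hs1
          rw [mul_pow] at this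
          have h3 : 0 ≤ 2 ^ (n + 1) * C * 2 ^ n * 2 * s ^ n := by positivity
          nlinarith
  · have hr0 : 0 < |r| := by linarith
    have hrs : 1 / (s * |r|) ≤ 2 * s := by
      rw [div_le_iff₀ (by positivity)]
      have : s ^ 2 * (1 + |r|) = 1 := by rw [hs2]; field_simp
      nlinarith [sq_nonneg s]
    have hm : ∀ l : ℕ, MeasurableSet {θ : Rd (n + 1) | s * ‖phaseGrad a r x θ‖ ≤ 2 ^ l} :=
      fun l => measurableSet_le ((measurable_phaseGrad a r x).norm.const_mul s) measurable_const
    calc _ ≤ ∫⁻ θ in A, ∑' l : ℕ, ENNReal.ofReal (2 ^ (n + 1) * (2 ^ l)⁻¹ ^ (n + 1)) *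
          (if s * ‖phaseGrad a r x θ‖ ≤ 2 ^ l then 1 else 0) :=
          lintegral_mono fun θ => inv_pow_le_tsum_indicator (by positivity) n
      _ = ∑' l : ℕ, ∫⁻ θ in A, ENNReal.ofReal (2 ^ (n + 1) * (2 ^ l)⁻¹ ^ (n + 1)) *
          (if s * ‖phaseGrad a r x θ‖ ≤ 2 ^ l then 1 else 0) := by
          apply lintegral_tsum
          intro l
          exact (Measurable.const_mul (Measurable.ite (hm l) measurable_const measurable_const)
            _).aemeasurable
      _ ≤ ∑' l : ℕ, ENNReal.ofReal (2 ^ (n + 1) * C * 2 ^ n * s ^ n * (1 / 2) ^ l) := by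
          apply ENNReal.tsum_le_tsum
          intro l
          rw [lintegral_const_mul' _ _ ENNReal.ofReal_ne_top]
          have e : ∫⁻ θ in A, (if s * ‖phaseGrad a r x θ‖ ≤ 2 ^ l then (1 : ℝ≥0∞) else 0) =
              volume {θ : Rd (n + 1) | (α ≤ ‖θ‖ ∧ ‖θ‖ ≤ β) ∧ s * ‖phaseGrad a r x θ‖ ≤ 2 ^ l} := by
            have := lintegral_indicator_one (μ := volume.restrict A) (hm l)
            rw [Measure.restrict_apply (hm l)] at this
            rw [inter_comm] at this
            exact this
          have hsub : {θ : Rd (n + 1) | (α ≤ ‖θ‖ ∧ ‖θ‖ ≤ β) ∧ s * ‖phaseGrad a r x θ‖ ≤ 2 ^ l} ⊆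
              {θ : Rd (n + 1) | (α ≤ ‖θ‖ ∧ ‖θ‖ ≤ β) ∧
                ‖gradient a θ - (-(r⁻¹ * (2 * π))) • x‖ ≤ 2 ^ l * (2 * s)} := by
            rintro θ ⟨h1, h2⟩
            refine ⟨h1, ?_⟩
            have hr1 : r ≠ 0 := by rintro rfl; simp at hr0
            have e : phaseGrad a r x θ = r • (gradient a θ - (-(r⁻¹ * (2 * π))) • x) := by
              rw [phaseGrad, smul_sub, smul_smul, mul_neg, ← mul_assoc, mul_inv_cancel₀ hr1, one_mul,
                neg_smul, sub_neg_eq_add]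
            rw [e, norm_smul, Real.norm_eq_abs, ← mul_assoc] at h2
            calc _ ≤ 2 ^ l / (s * |r|) := by rw [le_div_iff₀ (by positivity)]; linarith
              _ = 2 ^ l * (1 / (s * |r|)) := by ring
              _ ≤ _ := by gcongr
          rw [e]
          calc _ ≤ ENNReal.ofReal (2 ^ (n + 1) * (2 ^ l)⁻¹ ^ (n + 1)) *
              ENNReal.ofReal (C * (2 ^ l * (2 * s)) ^ n) := by
                gcongr; exact (measure_mono hsub).trans (hV _ _ (by positivity))
            _ = _ := by
                rw [← ENNReal.ofReal_mul (by positivity)]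
                congr 1
                have : ((2 : ℝ) ^ l) ≠ 0 := by positivity
                rw [one_div, inv_pow 2 l]
                generalize (2 : ℝ) ^ l = w at this ⊢
                rw [inv_pow, pow_succ w, mul_pow w, mul_pow 2 s]
                field_simp
      _ = ENNReal.ofReal (2 ^ (n + 1) * C * 2 ^ n * s ^ n * 2) := by
          rw [← ENNReal.ofReal_tsum_of_nonneg (fun l => by positivity)
            (summable_geometric_two.mul_left _), tsum_mul_left, tsum_geometric_two]
      _ ≤ _ := by
          apply ENNReal.ofReal_le_ofReal
          have : 0 ≤ V * 2 ^ n * s ^ n := by positivity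
          nlinarith

lemma isCompact_shell {E : Type*} [NormedAddCommGroup E] [ProperSpace E] (α β : ℝ) :
    IsCompact {θ : E | α ≤ ‖θ‖ ∧ ‖θ‖ ≤ β} := by
  refine (isCompact_closedBall (0 : E) β).of_isClosed_subset ?_ fun θ hθ => by simpa using hθ.2
  exact (isClosed_le continuous_const continuous_norm).inter
    (isClosed_le continuous_norm continuous_const)

namespace IsDistFn

variable {d : ℕ} {a : Rd d → ℝ}

lemma exists_norm_gradient_le (ha : IsDistFn a) :
    ∃ B : ℝ, 0 < B ∧ ∀ θ : Rd d, θ ≠ 0 → ‖gradient a θ‖ ≤ B := by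
  have hc : ContinuousOn (fun θ => ‖fderiv ℝ a θ‖) {θ : Rd d | 1 ≤ ‖θ‖ ∧ ‖θ‖ ≤ 1} := by
    intro θ hθ
    refine ((ha.contDiffAt_fderiv ?_).continuousAt.norm).continuousWithinAt
    rintro rfl
    have := hθ.1
    rw [norm_zero] at this; linarith
  obtain ⟨B, hB⟩ := (isCompact_shell 1 1).bddAbove_image hc
  refine ⟨max B 1, by positivity, fun θ hθ => ?_⟩
  have h0 : 0 < ‖θ‖ := norm_pos_iff.2 hθ
  have h1 : ‖(‖θ‖⁻¹ • θ)‖ = 1 := by rw [norm_smul, norm_inv, norm_norm, inv_mul_cancel₀ h0.ne']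
  rw [← ha.gradient_smul (inv_pos.2 h0) hθ, gradient, LinearIsometryEquiv.norm_map]
  exact (hB ⟨_, ⟨h1.ge, h1.le⟩, rfl⟩).trans (le_max_left _ _)

lemma exists_norm_gradient_add_sub_le (ha : IsDistFn a) {α β : ℝ} (hα : 0 < α) :
    ∃ B : ℝ, 0 < B ∧ ∀ θ h : Rd d, α ≤ ‖θ‖ → ‖θ‖ ≤ β → ‖h‖ ≤ α / 2 →
      ‖gradient a (θ + h) - gradient a θ‖ ≤ B * ‖h‖ := by
  have hne : ∀ {θ : Rd d}, α / 2 ≤ ‖θ‖ → θ ≠ 0 := by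
    rintro θ h rfl; rw [norm_zero] at h; linarith
  have hc : ContinuousOn (fun θ => ‖fderiv ℝ (fderiv ℝ a) θ‖)
      {θ : Rd d | α / 2 ≤ ‖θ‖ ∧ ‖θ‖ ≤ β + α / 2} := by
    intro θ hθ
    exact (((ha.contDiffAt_fderiv (hne hθ.1)).fderiv_right (m := 0) (by simp)).continuousAt.norm
      ).continuousWithinAt
  obtain ⟨B, hB⟩ := (isCompact_shell _ _).bddAbove_image hc
  refine ⟨max B 1, by positivity, fun θ h h1 h2 h3 => ?_⟩
  have hs : ∀ ω ∈ Metric.closedBall θ (α / 2), α / 2 ≤ ‖ω‖ ∧ ‖ω‖ ≤ β + α / 2 := by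
    intro ω hω
    rw [mem_closedBall_iff_norm] at hω
    have e1 := norm_sub_norm_le θ ω
    have e2 := norm_sub_norm_le ω θ
    rw [norm_sub_rev] at e1
    constructor <;> linarith
  have := (convex_closedBall θ (α / 2)).norm_image_sub_le_of_norm_fderiv_le (𝕜 := ℝ)
    (f := fderiv ℝ a) (C := max B 1) (x := θ) (y := θ + h)
    (fun ω hω => (ha.contDiffAt_fderiv (hne (hs ω hω).1)).differentiableAt (by simp))
    (fun ω hω => (hB ⟨ω, hs ω hω, rfl⟩).trans (le_max_left _ _))
    (Metric.mem_closedBall_self (by positivity)) (by simpa [mem_closedBall_iff_norm] using h3)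
  rw [norm_gradient_sub]
  simpa using this

end IsDistFn

/-- Pointwise decay of `oscInt`, both in `r` and away from the cone. -/
lemma exists_oscInt_le_decay {n : ℕ} {a u : Rd (n + 1) → ℝ} (ha : IsDistFn a)
    (hc : CurvNondeg a) (hu : ContDiff ℝ (⊤ : ℕ∞) u) {α β : ℝ} (hα : 0 < α) (hβ : α ≤ β)
    (hsupp : ∀ ξ, u ξ ≠ 0 → α ≤ ‖ξ‖ ∧ ‖ξ‖ ≤ β) (M : ℕ) :
    ∃ C : ℝ, 0 < C ∧ ∀ (r : ℝ) (x : Rd (n + 1)), ‖oscInt a u r x‖ ≤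
      C * (√(1 + |r|))⁻¹ ^ n * (1 + ‖x‖ / (1 + |r|))⁻¹ ^ M := by
  obtain ⟨C, hC, h⟩ := exists_oscInt_le ha hu hα hβ hsupp (n + 1 + M)
  obtain ⟨C', hC', h'⟩ := exists_lintegral_phaseGrad_le ha hc (α := α / 4) (β := 4 * β)
    (by positivity) (by linarith)
  obtain ⟨B, hB, hB'⟩ := ha.exists_norm_gradient_le
  refine ⟨C * (1 + B) ^ M * C', by positivity, fun r x => ?_⟩
  set s := (√(1 + |r|))⁻¹ with hs
  have hs0 : 0 < s := by positivity
  have hs2 : s ^ 2 = (1 + |r|)⁻¹ := by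
    rw [hs, inv_pow, Real.sq_sqrt (by positivity)]
  have hs1 : s ≤ 1 := inv_le_one_of_one_le₀ (Real.one_le_sqrt.2 (by linarith [abs_nonneg r]))
  have hsr : s ^ 2 * |r| ≤ 1 := by
    rw [hs2, inv_mul_le_iff₀ (by positivity)]; linarith [abs_nonneg r]
  have hA : MeasurableSet {θ : Rd (n + 1) | α / 4 ≤ ‖θ‖ ∧ ‖θ‖ ≤ 4 * β} :=
    (isCompact_shell _ _).measurableSet
  have key : ‖oscInt a u r x‖ₑ ≤ ENNReal.ofReal (C * (1 + B) ^ M * (1 + ‖x‖ / (1 + |r|))⁻¹ ^ M) *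
      ENNReal.ofReal (C' * s ^ n) := by
    refine (h r x).trans (le_trans ?_ (mul_le_mul_right (h' r x) _))
    rw [← lintegral_const_mul' _ _ ENNReal.ofReal_ne_top]
    refine setLIntegral_mono' hA fun θ hθ => ?_
    rw [← ENNReal.ofReal_mul (by positivity)]
    apply ENNReal.ofReal_le_ofReal
    have hθ0 : θ ≠ 0 := by
      rintro rfl
      have := hθ.1
      rw [norm_zero] at this; linarith
    set y := phaseGrad a r x θ with hy
    have hy0 : 0 ≤ s * ‖y‖ := by positivity
    have h1 : 2 * π * ‖x‖ ≤ ‖y‖ + |r| * B := by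
      have e : (2 * π) • x = y - r • gradient a θ := by rw [hy, phaseGrad]; abel
      have := norm_sub_le y (r • gradient a θ)
      rw [← e, norm_smul, norm_smul, Real.norm_of_nonneg (by positivity), Real.norm_eq_abs] at this
      exact this.trans (by gcongr; exact hB' θ hθ0)
    have h2 : ‖x‖ ≤ ‖y‖ + |r| * B := by
      refine le_trans ?_ h1
      nlinarith [pi_gt_three, norm_nonneg x]
    have h3 : 1 + ‖x‖ / (1 + |r|) ≤ (1 + B) * (1 + s * ‖y‖) := by
      have e : ‖x‖ / (1 + |r|) = s ^ 2 * ‖x‖ := by rw [hs2]; ring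
      rw [e]
      have : s ^ 2 * ‖x‖ ≤ s ^ 2 * (‖y‖ + |r| * B) := by gcongr
      nlinarith [mul_le_mul_of_nonneg_right hsr hB.le, mul_le_mul_of_nonneg_right hs1 hy0,
        mul_nonneg hB.le hy0]
    have h4 : (1 + |(inner ℝ y θ : ℝ)| + s * ‖y‖)⁻¹ ≤ (1 + s * ‖y‖)⁻¹ := by
      gcongr; linarith [abs_nonneg (inner ℝ y θ : ℝ)]
    have h5 : (1 + s * ‖y‖)⁻¹ ≤ (1 + B) * (1 + ‖x‖ / (1 + |r|))⁻¹ := by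
      rw [← div_eq_mul_inv, le_div_iff₀ (by positivity), inv_mul_le_iff₀ (by positivity)]
      linarith
    calc C * (1 + |(inner ℝ y θ : ℝ)| + s * ‖y‖)⁻¹ ^ (n + 1 + M)
        ≤ C * (1 + s * ‖y‖)⁻¹ ^ (n + 1 + M) := by gcongr
      _ = C * (1 + s * ‖y‖)⁻¹ ^ M * (1 + s * ‖y‖)⁻¹ ^ (n + 1) := by ring
      _ ≤ C * ((1 + B) * (1 + ‖x‖ / (1 + |r|))⁻¹) ^ M * (1 + s * ‖y‖)⁻¹ ^ (n + 1) := by gcongr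
      _ = C * (1 + B) ^ M * (1 + ‖x‖ / (1 + |r|))⁻¹ ^ M * (1 + s * ‖y‖)⁻¹ ^ (n + 1) := by
          rw [mul_pow]; ring
  rw [← ENNReal.ofReal_mul (by positivity), ← ofReal_norm,
    ENNReal.ofReal_le_ofReal_iff (by positivity)] at key
  refine key.trans (le_of_eq ?_)
  ring

/-- The bracket `1 + |⟨y, θ⟩| / L + p |y|` attached to a plate normal to `θ`. -/
def plateBracket {d : ℕ} (θ : Rd d) (L p : ℝ) (y : Rd d) : ℝ :=
  1 + |(inner ℝ y θ : ℝ)| / L + p * ‖y‖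

lemma one_le_plateBracket {d : ℕ} (θ : Rd d) {L p : ℝ} (hL : 0 ≤ L) (hp : 0 ≤ p) (y : Rd d) :
    1 ≤ plateBracket θ L p y := by
  have h1 : 0 ≤ |(inner ℝ y θ : ℝ)| / L := by positivity
  have h2 : 0 ≤ p * ‖y‖ := by positivity
  unfold plateBracket; linarith

/-- The superposition of plates that dominates the kernels near a fixed time. -/
def plateMajorant {d : ℕ} (a : Rd d → ℝ) (A : Set (Rd d)) (M : ℕ) (r₀ L p : ℝ) (w : Rd d) :
    ℝ≥0∞ :=
  ∫⁻ θ in A, ENNReal.ofReal ((plateBracket θ L p (phaseGrad a r₀ w θ))⁻¹ ^ M)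

lemma measurable_plateIntegrand {d : ℕ} (a : Rd d → ℝ) (M : ℕ) (r₀ L p : ℝ) :
    Measurable (fun q : Rd d × Rd d =>
      ENNReal.ofReal ((plateBracket q.2 L p (phaseGrad a r₀ q.1 q.2))⁻¹ ^ M)) := by
  have h : Measurable (fun q : Rd d × Rd d => phaseGrad a r₀ q.1 q.2) :=
    (((IsDistFn.measurable_gradient a).comp measurable_snd).const_smul r₀).add
      (measurable_fst.const_smul (2 * π))
  refine ENNReal.measurable_ofReal.comp ((Measurable.inv ?_).pow_const M)
  unfold plateBracket
  exact ((continuous_abs.measurable.comp (h.inner measurable_snd)).div_const L).const_add 1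
    |>.add (h.norm.const_mul p)

lemma measurable_plateMajorant {d : ℕ} (a : Rd d → ℝ) (A : Set (Rd d)) (M : ℕ) (r₀ L p : ℝ) :
    Measurable (plateMajorant a A M r₀ L p) :=
  (measurable_plateIntegrand a M r₀ L p).lintegral_prod_right'

lemma exists_lintegral_plateMajorant_le {n M : ℕ} (a : Rd (n + 1) → ℝ) (hM : n + 1 < M) {α β : ℝ}
    (hα : 0 < α) :
    ∃ C : ℝ, 0 < C ∧ ∀ r₀ L p : ℝ, 0 < L → 0 < p →
      ∫⁻ w, plateMajorant a {θ | α ≤ ‖θ‖ ∧ ‖θ‖ ≤ β} M r₀ L p w ≤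
        ENNReal.ofReal (C * (L * (p ^ n)⁻¹)) := by
  obtain ⟨C, hC, h⟩ := exists_lintegral_plate_le (E := Rd (n + 1)) (n := n) (by simp) hM hα (β := β)
  have hAc := isCompact_shell (E := Rd (n + 1)) α β
  set A : Set (Rd (n + 1)) := {θ | α ≤ ‖θ‖ ∧ ‖θ‖ ≤ β} with hA
  have hAfin : volume A < ∞ := hAc.measure_lt_top
  refine ⟨C * ((volume A).toReal + 1), by positivity, fun r₀ L p hL hp => ?_⟩
  unfold plateMajorant
  rw [lintegral_lintegral_swap (measurable_plateIntegrand a M r₀ L p).aemeasurable]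
  calc _ ≤ ∫⁻ θ in A, ENNReal.ofReal (C * (L * (p ^ n)⁻¹)) :=
        setLIntegral_mono' hAc.measurableSet fun θ hθ => h θ (r₀ • gradient a θ) hθ.1 hθ.2 p L hp hL
    _ = ENNReal.ofReal (C * (L * (p ^ n)⁻¹)) * ENNReal.ofReal (volume A).toReal := by
        rw [setLIntegral_const, ENNReal.ofReal_toReal hAfin.ne]
    _ ≤ _ := by
        rw [← ENNReal.ofReal_mul (by positivity)]
        apply ENNReal.ofReal_le_ofReal
        have : 0 ≤ C * (L * (p ^ n)⁻¹) := by positivity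
        nlinarith

lemma norm_phaseGrad_sub_le {d : ℕ} {a : Rd d → ℝ} {B C₁ L r r₀ : ℝ} {x w θ : Rd d}
    (hB : ‖gradient a θ‖ ≤ B) (hL : 0 ≤ L) (hr : |r - r₀| ≤ 2 * L) (hx : ‖x - w‖ ≤ C₁ * L) :
    ‖phaseGrad a r x θ - phaseGrad a r₀ w θ‖ ≤ (2 * B + 2 * π * C₁) * L := by
  have e : phaseGrad a r x θ - phaseGrad a r₀ w θ = (r - r₀) • gradient a θ + (2 * π) • (x - w) := by
    simp only [phaseGrad, sub_smul, smul_sub]; abel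
  rw [e]
  refine (norm_add_le _ _).trans ?_
  rw [norm_smul, norm_smul, Real.norm_eq_abs, Real.norm_of_nonneg (by positivity : 0 ≤ 2 * π)]
  have h1 : |r - r₀| * ‖gradient a θ‖ ≤ 2 * L * B := by gcongr
  have h2 : 2 * π * ‖x - w‖ ≤ 2 * π * (C₁ * L) := by gcongr
  linarith

lemma inv_sqrt_le_two_mul {r r₀ : ℝ} (h : |r - r₀| ≤ r₀ / 2) :
    (√(1 + |r|))⁻¹ ≤ 2 * (√(1 + r₀))⁻¹ ∧ (√(1 + r₀))⁻¹ ≤ 2 * (√(1 + |r|))⁻¹ := by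
  have h0 : 0 ≤ r₀ := by linarith [abs_nonneg (r - r₀)]
  rw [abs_le] at h
  have hr : |r| = r := abs_of_nonneg (by linarith)
  have key : ∀ {x y : ℝ}, 0 ≤ x → 0 ≤ y → y ≤ 1 + 2 * x → (√(1 + x))⁻¹ ≤ 2 * (√(1 + y))⁻¹ := by
    intro x y hx hy hxy
    have hy' : 0 < √(1 + y) := by positivity
    rw [← div_eq_mul_inv, le_div_iff₀ hy', inv_mul_le_iff₀ (by positivity)]
    apply Real.sqrt_le_iff.2
    refine ⟨by positivity, ?_⟩
    rw [mul_pow, Real.sq_sqrt (by positivity)]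
    linarith
  exact ⟨key (abs_nonneg r) h0 (by linarith), key h0 (abs_nonneg r) (by linarith)⟩

/-- Domination of the kernels by plates thinner than the parabolic scale. -/
lemma exists_oscInt_le_plateMajorant {n : ℕ} {a u : Rd (n + 1) → ℝ} (ha : IsDistFn a)
    (hu : ContDiff ℝ (⊤ : ℕ∞) u) {α β : ℝ} (hα : 0 < α) (hβ : α ≤ β)
    (hsupp : ∀ ξ, u ξ ≠ 0 → α ≤ ‖ξ‖ ∧ ‖ξ‖ ≤ β) (M : ℕ) {C₁ : ℝ} (hC₁ : 0 < C₁) :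
    ∃ C : ℝ, 0 < C ∧ ∀ L r₀ : ℝ, 1 ≤ L → 4 * L ≤ r₀ → L * (√(1 + r₀))⁻¹ ≤ 1 →
      ∀ (r : ℝ) (x w : Rd (n + 1)), |r - r₀| ≤ 2 * L → ‖x - w‖ ≤ C₁ * L →
      ‖oscInt a u r x‖ₑ ≤ ENNReal.ofReal C *
        plateMajorant a {θ | α / 4 ≤ ‖θ‖ ∧ ‖θ‖ ≤ 4 * β} M r₀ L (√(1 + r₀))⁻¹ w := by
  obtain ⟨C, hC, h⟩ := exists_oscInt_le ha hu hα hβ hsupp M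
  obtain ⟨B, hB, hB'⟩ := ha.exists_norm_gradient_le
  set D := 2 * B + 2 * π * C₁ with hD
  have hD0 : 0 < D := by positivity
  have hβ0 : 0 < β := by linarith
  refine ⟨C * (3 + 4 * β * D + D) ^ M, by positivity, fun L r₀ hL hr₀ hs r x w hr hx => ?_⟩
  refine (h r x).trans ?_
  rw [plateMajorant, ← lintegral_const_mul' _ _ ENNReal.ofReal_ne_top]
  refine setLIntegral_mono' (isCompact_shell _ _).measurableSet fun θ hθ => ?_
  rw [← ENNReal.ofReal_mul (by positivity)]
  apply ENNReal.ofReal_le_ofReal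
  have hθ0 : θ ≠ 0 := by
    rintro rfl
    have := hθ.1
    rw [norm_zero] at this; linarith
  have hd := norm_phaseGrad_sub_le (hB' θ hθ0) (by linarith) hr hx
  rw [← hD, norm_sub_rev] at hd
  set y := phaseGrad a r x θ
  set y' := phaseGrad a r₀ w θ
  obtain ⟨-, hs2⟩ := inv_sqrt_le_two_mul (hr.trans (by linarith : 2 * L ≤ r₀ / 2))
  set s := (√(1 + |r|))⁻¹ with hsd
  set s₀ := (√(1 + r₀))⁻¹ with hs₀d
  have hs0 : 0 < s := by positivity
  have hs₀0 : 0 < s₀ := inv_pos.2 (Real.sqrt_pos.2 (by linarith))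
  have h0 : 0 < 1 + |(inner ℝ y θ : ℝ)| + s * ‖y‖ := by positivity
  have hb := one_le_plateBracket θ (by linarith : 0 ≤ L) hs₀0.le y'
  have key : plateBracket θ L s₀ y' ≤ (3 + 4 * β * D + D) *
      (1 + |(inner ℝ y θ : ℝ)| + s * ‖y‖) := by
    have e1 : |(inner ℝ y' θ : ℝ)| / L ≤ |(inner ℝ y θ : ℝ)| + 4 * β * D := by
      rw [div_le_iff₀ (by linarith)]
      have e : (inner ℝ y' θ : ℝ) = inner ℝ y θ + inner ℝ (y' - y) θ := by
        rw [inner_sub_left]; ring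
      have e2 : |(inner ℝ (y' - y) θ : ℝ)| ≤ D * L * (4 * β) :=
        (abs_real_inner_le_norm _ _).trans (by gcongr; exact hθ.2)
      have e3 : |(inner ℝ y' θ : ℝ)| ≤ |(inner ℝ y θ : ℝ)| + D * L * (4 * β) := by
        rw [e]; exact (abs_add_le _ _).trans (by gcongr)
      nlinarith [abs_nonneg (inner ℝ y θ : ℝ)]
    have e2 : s₀ * ‖y'‖ ≤ 2 * (s * ‖y‖) + D := by
      have h1 : ‖y'‖ ≤ ‖y‖ + D * L := by
        have := norm_add_le y (y' - y)
        rw [add_sub_cancel] at this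
        linarith
      calc s₀ * ‖y'‖ ≤ s₀ * (‖y‖ + D * L) := by gcongr
        _ = s₀ * ‖y‖ + D * (L * s₀) := by ring
        _ ≤ 2 * s * ‖y‖ + D * 1 := by gcongr
        _ = _ := by ring
    unfold plateBracket
    have i0 := abs_nonneg (inner ℝ y θ : ℝ)
    have i1 : 0 ≤ s * ‖y‖ := by positivity
    nlinarith [mul_pos hβ0 hD0, mul_nonneg (mul_pos hβ0 hD0).le i0, mul_nonneg hD0.le i0,
      mul_nonneg (mul_pos hβ0 hD0).le i1, mul_nonneg hD0.le i1]
  have h5 : (1 + |(inner ℝ y θ : ℝ)| + s * ‖y‖)⁻¹ ≤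
      (3 + 4 * β * D + D) * (plateBracket θ L s₀ y')⁻¹ := by
    rw [← div_eq_mul_inv, le_div_iff₀ (by linarith), inv_mul_le_iff₀ (by positivity), mul_comm _ (_ + _)]
    linarith
  calc C * (1 + |(inner ℝ y θ : ℝ)| + s * ‖y‖)⁻¹ ^ M
      ≤ C * ((3 + 4 * β * D + D) * (plateBracket θ L s₀ y')⁻¹) ^ M := by gcongr
    _ = _ := by rw [mul_pow]; ring

lemma measurable_plateIntegrand_right {d : ℕ} (a : Rd d → ℝ) (M : ℕ) (r₀ L p : ℝ) (w : Rd d) :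
    Measurable (fun θ : Rd d =>
      ENNReal.ofReal ((plateBracket θ L p (phaseGrad a r₀ w θ))⁻¹ ^ M)) :=
  (measurable_plateIntegrand a M r₀ L p).comp
    (f := fun θ : Rd d => ((w, θ) : Rd d × Rd d)) measurable_prodMk_left

set_option maxHeartbeats 1000000 in
/-- A point value of the bracket is controlled by an average over a plate of directions. -/
lemma exists_inv_pow_le_plateMajorant {n : ℕ} {a : Rd (n + 1) → ℝ} (ha : IsDistFn a)
    {α β : ℝ} (hα : 0 < α) (hβ : α ≤ β) (M : ℕ) {C₁ : ℝ} (hC₁ : 0 < C₁) :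
    ∃ C : ℝ, 0 < C ∧ ∀ L r₀ : ℝ, 1 ≤ L → 4 * L ≤ r₀ →
      ∀ (r : ℝ) (x w θ : Rd (n + 1)), |r - r₀| ≤ 2 * L → ‖x - w‖ ≤ C₁ * L → α ≤ ‖θ‖ → ‖θ‖ ≤ β →
      ENNReal.ofReal ((1 + ‖phaseGrad a r x θ‖ / L)⁻¹ ^ M) ≤ ENNReal.ofReal (C * (r₀ / L) ^ n) *
        plateMajorant a {θ | α / 4 ≤ ‖θ‖ ∧ ‖θ‖ ≤ 4 * β} M r₀ L L⁻¹ w := by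
  obtain ⟨B, hB, hB'⟩ := ha.exists_norm_gradient_le
  obtain ⟨B₂, hB₂, hB₂'⟩ := ha.exists_norm_gradient_add_sub_le hα (β := β)
  have hβ0 : 0 < β := by linarith
  set c : ℝ := min (1 / (2 * β)) (α / 4) with hcd
  have hc0 : 0 < c := by positivity
  have hcβ : β * c ≤ 1 / 2 := by
    have : c ≤ 1 / (2 * β) := min_le_left _ _
    calc β * c ≤ β * (1 / (2 * β)) := by gcongr
      _ = 1 / 2 := by field_simp
  have hcα : c ≤ α / 4 := min_le_right _ _
  obtain ⟨κ, hκ, hvol⟩ := exists_le_volume_stretch (E := Rd (n + 1)) (n := n) (by simp) hα hc0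
  set D := 2 * B + 2 * π * C₁ + B₂ * (2 * c) with hD
  have hD0 : 0 < D := by positivity
  set K := (1 + 4 * β) * (1 + D) with hK
  have hK0 : 0 < K := by positivity
  refine ⟨K ^ M * κ⁻¹, by positivity, fun L r₀ hL hr₀ r x w θ hr hx hθ1 hθ2 => ?_⟩
  have hL0 : 0 < L := by linarith
  have hr₀0 : 0 < r₀ := by linarith
  set ε := L / r₀ with hε
  have hε0 : 0 < ε := by positivity
  have hε1 : ε ≤ 1 := by rw [hε, div_le_one hr₀0]; linarith
  have hθ0 : θ ≠ 0 := by
    rintro rfl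
    rw [norm_zero] at hθ1; linarith
  set y := phaseGrad a r x θ with hy
  set S := (fun ζ => θ + stretch θ ε 1 ζ) '' Metric.ball (0 : Rd (n + 1)) c with hS
  have key : ∀ θ' ∈ S, (α / 4 ≤ ‖θ'‖ ∧ ‖θ'‖ ≤ 4 * β) ∧
      plateBracket θ' L L⁻¹ (phaseGrad a r₀ w θ') ≤ K * (1 + ‖y‖ / L) := by
    rintro _ ⟨ζ, hζ, rfl⟩
    rw [mem_ball_zero_iff] at hζ
    simp only [stretch_apply, one_mul]
    set t : ℝ := 1 + inner ℝ θ ζ with ht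
    have ht1 : |(inner ℝ θ ζ : ℝ)| ≤ 1 / 2 :=
      (abs_real_inner_le_norm _ _).trans ((mul_le_mul hθ2 hζ.le (norm_nonneg _) hβ0.le).trans hcβ)
    rw [abs_le] at ht1
    have ht2 : 1 / 2 ≤ t := by linarith
    have ht3 : t ≤ 3 / 2 := by linarith
    have ht0 : 0 < t := by linarith
    set h : Rd (n + 1) := (t⁻¹ * ε) • ζ with hh
    have e : θ + (ε • ζ + (inner ℝ θ ζ : ℝ) • θ) = t • (θ + h) := by
      rw [hh, smul_add, smul_smul, ← mul_assoc, mul_inv_cancel₀ ht0.ne', one_mul, ht, add_smul,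
        one_smul]
      abel
    have hti : t⁻¹ ≤ 2 := by
      rw [inv_le_comm₀ ht0 two_pos]; linarith
    have hhn : ‖h‖ ≤ 2 * c * ε := by
      rw [hh, norm_smul, Real.norm_of_nonneg (by positivity)]
      calc t⁻¹ * ε * ‖ζ‖ ≤ 2 * ε * c := by gcongr
        _ = _ := by ring
    have hhα : ‖h‖ ≤ α / 2 := by
      refine hhn.trans ?_
      nlinarith
    have n1 : α / 2 ≤ ‖θ + h‖ := by
      have := norm_sub_le (θ + h) h
      rw [add_sub_cancel_right] at this; linarith
    have n2 : ‖θ + h‖ ≤ 3 / 2 * β := by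
      have := norm_add_le θ h
      linarith
    have hθh0 : θ + h ≠ 0 := by
      intro h0; rw [h0, norm_zero] at n1; linarith
    rw [e]
    have n3 : ‖t • (θ + h)‖ = t * ‖θ + h‖ := by rw [norm_smul, Real.norm_of_nonneg ht0.le]
    have n4 : t * ‖θ + h‖ ≤ 4 * β := by nlinarith
    refine ⟨⟨by rw [n3]; nlinarith, by rw [n3]; exact n4⟩, ?_⟩
    set y' := phaseGrad a r₀ w (t • (θ + h)) with hy'
    have hyy : ‖y'‖ ≤ ‖y‖ + D * L := by
      have h1 := norm_phaseGrad_sub_le (hB' θ hθ0) (by linarith) hr hx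
      have h2 : y' - phaseGrad a r₀ w θ = r₀ • (gradient a (θ + h) - gradient a θ) := by
        rw [hy', phaseGrad, phaseGrad, ha.gradient_smul ht0 hθh0, smul_sub]; abel
      have h3 : ‖y' - phaseGrad a r₀ w θ‖ ≤ B₂ * (2 * c) * L := by
        rw [h2, norm_smul, Real.norm_of_nonneg hr₀0.le]
        calc _ ≤ r₀ * (B₂ * (2 * c * ε)) := by
              gcongr; exact (hB₂' θ h hθ1 hθ2 hhα).trans (by gcongr)
          _ = B₂ * (2 * c) * (r₀ * ε) := by ring
          _ = _ := by rw [hε, mul_div_cancel₀ _ hr₀0.ne']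
      have e : y' = y - (y - phaseGrad a r₀ w θ) + (y' - phaseGrad a r₀ w θ) := by abel
      have h4 := norm_add_le (y - (y - phaseGrad a r₀ w θ)) (y' - phaseGrad a r₀ w θ)
      have h5 := norm_sub_le y (y - phaseGrad a r₀ w θ)
      rw [← e] at h4
      have h6 : D * L = (2 * B + 2 * π * C₁) * L + B₂ * (2 * c) * L := by rw [hD]; ring
      rw [← hy] at h1
      linarith
    have i1 : |(inner ℝ y' (t • (θ + h)) : ℝ)| ≤ ‖y'‖ * (4 * β) :=
      (abs_real_inner_le_norm _ _).trans (by rw [n3]; gcongr)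
    have i2 : ‖y'‖ / L ≤ ‖y‖ / L + D := by
      rw [div_add' _ _ _ hL0.ne']; gcongr
    have i3 : |(inner ℝ y' (t • (θ + h)) : ℝ)| / L ≤ 4 * β * (‖y'‖ / L) := by
      rw [← mul_div_assoc]; gcongr; linarith
    have i4 : 0 ≤ ‖y‖ / L := by positivity
    unfold plateBracket
    rw [inv_mul_eq_div]
    have i5 : 4 * β * (‖y'‖ / L) ≤ 4 * β * (‖y‖ / L + D) := by gcongr
    have i6 : 0 ≤ (1 + 4 * β) * (D * (‖y‖ / L)) := by positivity
    have i7 : K * (1 + ‖y‖ / L) = 1 + 4 * β * (‖y‖ / L + D) + (‖y‖ / L + D) +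
        (4 * β + (1 + 4 * β) * (D * (‖y‖ / L))) := by rw [hK]; ring
    rw [i7]
    linarith
  have hSA : S ⊆ {θ : Rd (n + 1) | α / 4 ≤ ‖θ‖ ∧ ‖θ‖ ≤ 4 * β} := fun θ' h => (key θ' h).1
  have hpt : ∀ θ' ∈ S, ENNReal.ofReal ((K ^ M)⁻¹ * (1 + ‖y‖ / L)⁻¹ ^ M) ≤
      ENNReal.ofReal ((plateBracket θ' L L⁻¹ (phaseGrad a r₀ w θ'))⁻¹ ^ M) := by
    intro θ' h
    apply ENNReal.ofReal_le_ofReal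
    have hb := one_le_plateBracket θ' hL0.le (inv_nonneg.2 hL0.le) (phaseGrad a r₀ w θ')
    rw [← inv_pow, ← mul_pow, ← mul_inv]
    gcongr
    exact (key θ' h).2
  have h1 : ENNReal.ofReal ((K ^ M)⁻¹ * (1 + ‖y‖ / L)⁻¹ ^ M) * volume S ≤
      plateMajorant a {θ | α / 4 ≤ ‖θ‖ ∧ ‖θ‖ ≤ 4 * β} M r₀ L L⁻¹ w := by
    rw [plateMajorant]
    calc _ = ∫⁻ _ in S, ENNReal.ofReal ((K ^ M)⁻¹ * (1 + ‖y‖ / L)⁻¹ ^ M) :=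
          (setLIntegral_const _ _).symm
      _ ≤ ∫⁻ θ' in S, ENNReal.ofReal ((plateBracket θ' L L⁻¹ (phaseGrad a r₀ w θ'))⁻¹ ^ M) :=
          setLIntegral_mono (measurable_plateIntegrand_right a M r₀ L L⁻¹ w) hpt
      _ ≤ _ := lintegral_mono_set hSA
  have h2 := hvol θ hθ1 ε hε0
  calc ENNReal.ofReal ((1 + ‖y‖ / L)⁻¹ ^ M)
      = ENNReal.ofReal (K ^ M * κ⁻¹ * (r₀ / L) ^ n) *
        (ENNReal.ofReal ((K ^ M)⁻¹ * (1 + ‖y‖ / L)⁻¹ ^ M) * ENNReal.ofReal (κ * ε ^ n)) := by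
        rw [← ENNReal.ofReal_mul (by positivity), ← ENNReal.ofReal_mul (by positivity)]
        congr 1
        have : r₀ / L = ε⁻¹ := by rw [hε, inv_div]
        rw [this, inv_pow ε]
        have : ε ^ n ≠ 0 := by positivity
        field_simp
    _ ≤ _ := by
        gcongr
        exact le_trans (by gcongr) h1

/-- Domination of the kernels by plates thicker than the parabolic scale. -/
lemma exists_oscInt_le_plateMajorant' {n : ℕ} {a u : Rd (n + 1) → ℝ} (ha : IsDistFn a)
    (hc : CurvNondeg a) (hu : ContDiff ℝ (⊤ : ℕ∞) u) {α β : ℝ} (hα : 0 < α) (hβ : α ≤ β)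
    (hsupp : ∀ ξ, u ξ ≠ 0 → α ≤ ‖ξ‖ ∧ ‖ξ‖ ≤ β) (M : ℕ) {C₁ : ℝ} (hC₁ : 0 < C₁) :
    ∃ C : ℝ, 0 < C ∧ ∀ L r₀ : ℝ, 1 ≤ L → 4 * L ≤ r₀ → 1 ≤ L * (√(1 + r₀))⁻¹ →
      ∀ (r : ℝ) (x w : Rd (n + 1)), |r - r₀| ≤ 2 * L → ‖x - w‖ ≤ C₁ * L →
      ‖oscInt a u r x‖ₑ ≤ ENNReal.ofReal (C * ((√(1 + r₀))⁻¹ ^ n * (r₀ / L) ^ n)) *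
        plateMajorant a {θ | α / 4 / 4 ≤ ‖θ‖ ∧ ‖θ‖ ≤ 4 * (4 * β)} M r₀ L L⁻¹ w := by
  obtain ⟨C, hC, h⟩ := exists_oscInt_le ha hu hα hβ hsupp (n + 1 + M)
  have hα4 : 0 < α / 4 := by positivity
  have hβ0 : 0 < β := by linarith
  obtain ⟨C', hC', h'⟩ := exists_lintegral_phaseGrad_le ha hc hα4 (β := 4 * β) (by linarith)
  obtain ⟨C₂, hC₂, h₂⟩ := exists_inv_pow_le_plateMajorant ha hα4 (β := 4 * β) (by linarith) M hC₁
  refine ⟨C * 2 ^ M * C₂ * C' * 2 ^ n, by positivity, fun L r₀ hL hr₀ hs r x w hr hx => ?_⟩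
  set G := plateMajorant a {θ | α / 4 / 4 ≤ ‖θ‖ ∧ ‖θ‖ ≤ 4 * (4 * β)} M r₀ L L⁻¹ w with hG
  have hL0 : 0 < L := by linarith
  have hr₀0 : 0 < r₀ := by linarith
  obtain ⟨hs1, hs2⟩ := inv_sqrt_le_two_mul (hr.trans (by linarith : 2 * L ≤ r₀ / 2))
  have h'' := h' r x
  have h3 := h r x
  set s := (√(1 + |r|))⁻¹ with hsd
  set s₀ := (√(1 + r₀))⁻¹ with hs₀d
  have hs0 : 0 < s := by positivity
  have hs₀0 : 0 < s₀ := inv_pos.2 (Real.sqrt_pos.2 (by linarith))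
  have key : ‖oscInt a u r x‖ₑ ≤ ENNReal.ofReal (C * 2 ^ M) *
      (ENNReal.ofReal (C₂ * (r₀ / L) ^ n) * G) * ENNReal.ofReal (C' * s ^ n) := by
    refine h3.trans (le_trans ?_ (mul_le_mul_right h'' _))
    have hm : Measurable fun θ : Rd (n + 1) =>
        ENNReal.ofReal ((1 + s * ‖phaseGrad a r x θ‖)⁻¹ ^ (n + 1)) :=
      ENNReal.measurable_ofReal.comp (Measurable.pow_const
        (Measurable.inv (((measurable_phaseGrad a r x).norm.const_mul s).const_add 1)) _)
    rw [← lintegral_const_mul _ hm]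
    refine setLIntegral_mono' (isCompact_shell _ _).measurableSet fun θ hθ => ?_
    refine le_trans ?_ (mul_le_mul_left (mul_le_mul_right
      (h₂ L r₀ hL hr₀ r x w θ hr hx hθ.1 hθ.2) _) _)
    rw [← ENNReal.ofReal_mul (by positivity), ← ENNReal.ofReal_mul (by positivity)]
    apply ENNReal.ofReal_le_ofReal
    set y := phaseGrad a r x θ
    have i1 : (1 + |(inner ℝ y θ : ℝ)| + s * ‖y‖)⁻¹ ≤ (1 + s * ‖y‖)⁻¹ := by
      gcongr; linarith [abs_nonneg (inner ℝ y θ : ℝ)]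
    have i2 : (1 + s * ‖y‖)⁻¹ ≤ 2 * (1 + ‖y‖ / L)⁻¹ := by
      rw [← div_eq_mul_inv, le_div_iff₀ (by positivity), inv_mul_le_iff₀ (by positivity)]
      have : ‖y‖ / L ≤ 2 * (s * ‖y‖) := by
        rw [div_le_iff₀ hL0]
        have : 1 ≤ L * (2 * s) := hs.trans (by gcongr)
        nlinarith [norm_nonneg y]
      linarith
    calc C * (1 + |(inner ℝ y θ : ℝ)| + s * ‖y‖)⁻¹ ^ (n + 1 + M)
        ≤ C * (1 + s * ‖y‖)⁻¹ ^ (n + 1 + M) := by gcongr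
      _ = C * (1 + s * ‖y‖)⁻¹ ^ M * (1 + s * ‖y‖)⁻¹ ^ (n + 1) := by ring
      _ ≤ C * (2 * (1 + ‖y‖ / L)⁻¹) ^ M * (1 + s * ‖y‖)⁻¹ ^ (n + 1) := by gcongr
      _ = _ := by rw [mul_pow]; ring
  refine key.trans ?_
  calc _ = ENNReal.ofReal (C * 2 ^ M * (C₂ * (r₀ / L) ^ n) * (C' * s ^ n)) * G := by
        rw [ENNReal.ofReal_mul (p := C * 2 ^ M * (C₂ * (r₀ / L) ^ n)) (by positivity),
          ENNReal.ofReal_mul (p := C * 2 ^ M) (by positivity)]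
        ring
    _ ≤ _ := by
        refine mul_le_mul_left (ENNReal.ofReal_le_ofReal ?_) _
        have : s ^ n ≤ (2 * s₀) ^ n := by gcongr
        calc C * 2 ^ M * (C₂ * (r₀ / L) ^ n) * (C' * s ^ n)
            ≤ C * 2 ^ M * (C₂ * (r₀ / L) ^ n) * (C' * (2 * s₀) ^ n) := by gcongr
          _ = _ := by rw [mul_pow]; ring

/-- The oscillatory integrals near a time `r₀` are dominated, on balls of radius `L`, by a
function of small integral. -/
lemma exists_oscInt_majorant {n : ℕ} {a u : Rd (n + 1) → ℝ} (ha : IsDistFn a)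
    (hc : CurvNondeg a) (hu : ContDiff ℝ (⊤ : ℕ∞) u) {α β : ℝ} (hα : 0 < α) (hβ : α ≤ β)
    (hsupp : ∀ ξ, u ξ ≠ 0 → α ≤ ‖ξ‖ ∧ ‖ξ‖ ≤ β) {C₁ : ℝ} (hC₁ : 0 < C₁) :
    ∃ C : ℝ, 0 < C ∧ ∀ L r₀ : ℝ, 1 ≤ L → 4 * L ≤ r₀ → ∃ G : Rd (n + 1) → ℝ≥0∞, Measurable G ∧
      ∫⁻ w, G w ≤ ENNReal.ofReal (C * (√r₀ ^ n * L)) ∧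
      ∀ (r : ℝ) (x w : Rd (n + 1)), |r - r₀| ≤ 2 * L → ‖x - w‖ ≤ C₁ * L →
        ‖oscInt a u r x‖ₑ ≤ G w := by
  obtain ⟨C, hC, h⟩ := exists_oscInt_le_plateMajorant ha hu hα hβ hsupp (n + 2) hC₁
  obtain ⟨C', hC', h'⟩ := exists_oscInt_le_plateMajorant' ha hc hu hα hβ hsupp (n + 2) hC₁
  obtain ⟨I, hI, hI'⟩ := exists_lintegral_plateMajorant_le a (M := n + 2) (by omega)
    (α := α / 4) (β := 4 * β) (by positivity)
  obtain ⟨J, hJ, hJ'⟩ := exists_lintegral_plateMajorant_le a (M := n + 2) (by omega)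
    (α := α / 4 / 4) (β := 4 * (4 * β)) (by positivity)
  refine ⟨C * I * 2 ^ n + C' * J, by positivity, fun L r₀ hL hr₀ => ?_⟩
  have hL0 : 0 < L := by linarith
  have hr₀0 : 0 < r₀ := by linarith
  have hs₀ : 0 < √r₀ := Real.sqrt_pos.2 hr₀0
  have hs₁ : 0 < √(1 + r₀) := Real.sqrt_pos.2 (by linarith)
  rcases le_total (L * (√(1 + r₀))⁻¹) 1 with hs | hs
  · refine ⟨_, (measurable_plateMajorant _ _ _ _ _ _).const_mul _, ?_, h L r₀ hL hr₀ hs⟩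
    rw [lintegral_const_mul' _ _ ENNReal.ofReal_ne_top]
    refine (mul_le_mul_right (hI' r₀ L _ hL0 (inv_pos.2 hs₁)) _).trans ?_
    rw [← ENNReal.ofReal_mul (by positivity), inv_pow, inv_inv]
    apply ENNReal.ofReal_le_ofReal
    have h1 : √(1 + r₀) ≤ 2 * √r₀ := by
      apply Real.sqrt_le_iff.2
      refine ⟨by positivity, ?_⟩
      rw [mul_pow, Real.sq_sqrt hr₀0.le]; linarith
    have h2 : √(1 + r₀) ^ n ≤ (2 * √r₀) ^ n := by gcongr
    rw [mul_pow] at h2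
    calc C * (I * (L * √(1 + r₀) ^ n)) ≤ C * (I * (L * (2 ^ n * √r₀ ^ n))) := by gcongr
      _ ≤ _ := by
        have : 0 ≤ C' * J * (√r₀ ^ n * L) := by positivity
        nlinarith
  · refine ⟨_, (measurable_plateMajorant _ _ _ _ _ _).const_mul _, ?_, h' L r₀ hL hr₀ hs⟩
    rw [lintegral_const_mul' _ _ ENNReal.ofReal_ne_top]
    refine (mul_le_mul_right (hJ' r₀ L _ hL0 (inv_pos.2 hL0)) _).trans ?_
    rw [← ENNReal.ofReal_mul (by positivity), inv_pow L, inv_inv]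
    apply ENNReal.ofReal_le_ofReal
    have h1 : (√(1 + r₀))⁻¹ * r₀ ≤ √r₀ := by
      rw [inv_mul_le_iff₀ hs₁]
      calc r₀ = √r₀ * √r₀ := (Real.mul_self_sqrt hr₀0.le).symm
        _ ≤ _ := by gcongr; linarith
    have h2 : (√(1 + r₀))⁻¹ ^ n * (r₀ / L) ^ n * L ^ n ≤ √r₀ ^ n := by
      rw [← mul_pow, ← mul_pow, mul_assoc, div_mul_cancel₀ _ hL0.ne']
      gcongr
    calc C' * ((√(1 + r₀))⁻¹ ^ n * (r₀ / L) ^ n) * (J * (L * L ^ n))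
        = C' * J * (((√(1 + r₀))⁻¹ ^ n * (r₀ / L) ^ n * L ^ n) * L) := by ring
      _ ≤ C' * J * (√r₀ ^ n * L) := by gcongr
      _ ≤ _ := by
        have : 0 ≤ C * I * 2 ^ n * (√r₀ ^ n * L) := by positivity
        nlinarith

lemma IsBump.eq_zero_of_ne {d : ℕ} {a : Rd d → ℝ} {η : ℝ → ℝ} (hη : IsBump η) {ξ : Rd d}
    (h : η (a ξ) ≠ 0) : 1 / 8 ≤ a ξ ∧ a ξ ≤ 8 := by
  by_contra h'
  exact h (hη.supp _ h')

namespace IsDistFn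

variable {d : ℕ} {a : Rd d → ℝ} {η : ℝ → ℝ}

lemma exists_shell (ha : IsDistFn a) (hη : IsBump η) : ∃ α β : ℝ, 0 < α ∧ α ≤ β ∧
    ∀ ξ, η (a ξ) ≠ 0 → α ≤ ‖ξ‖ ∧ ‖ξ‖ ≤ β := by
  obtain ⟨c₁, c₂, h1, h2, hb⟩ := ha.exists_bounds
  refine ⟨1 / 8 / c₂, max (1 / 8 / c₂) (8 / c₁), by positivity, le_max_left _ _, fun ξ hξ => ?_⟩
  obtain ⟨h3, h4⟩ := hη.eq_zero_of_ne hξ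
  refine ⟨?_, le_trans ?_ (le_max_right _ _)⟩
  · rw [div_le_iff₀ h2]; linarith [(hb ξ).2]
  · rw [le_div_iff₀ h1]; linarith [(hb ξ).1]

lemma contDiff_bump (ha : IsDistFn a) (hη : IsBump η) :
    ContDiff ℝ (⊤ : ℕ∞) (fun ξ => η (a ξ)) := by
  obtain ⟨α, β, hα, -, hs⟩ := ha.exists_shell hη
  rw [contDiff_iff_contDiffAt]
  intro ξ
  rcases eq_or_ne ξ 0 with rfl | h
  · refine (contDiffAt_const (c := (0 : ℝ))).congr_of_eventuallyEq ?_
    filter_upwards [Metric.ball_mem_nhds (0 : Rd d) hα] with ξ hξ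
    by_contra h
    rw [mem_ball_zero_iff] at hξ
    linarith [(hs ξ h).1]
  · exact hη.smooth.contDiffAt.comp ξ (ha.contDiffAt h)

lemma contDiff_bump_mul_exp (ha : IsDistFn a) (hη : IsBump η) (r : ℝ) :
    ContDiff ℝ (⊤ : ℕ∞) (fun ξ => (η (a ξ) : ℂ) * Complex.exp (Complex.I * r * a ξ)) := by
  obtain ⟨α, β, hα, -, hs⟩ := ha.exists_shell hη
  obtain ⟨f, hf, hfa⟩ := ha.exists_cutoff hα
  have e : (fun ξ => (η (a ξ) : ℂ) * Complex.exp (Complex.I * r * a ξ)) =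
      fun ξ => (η (a ξ) : ℂ) * Complex.exp (Complex.I * r * f ξ) := by
    ext ξ
    by_cases h : η (a ξ) = 0
    · simp [h]
    · rw [hfa ξ (hs ξ h).1]
  rw [e]
  have hc := Complex.ofRealCLM.contDiff (n := ((⊤ : ℕ∞) : WithTop ℕ∞))
  exact (hc.comp (ha.contDiff_bump hη)).mul ((contDiff_const.mul (hc.comp hf)).cexp)

lemma hasCompactSupport_bump_mul (ha : IsDistFn a) (hη : IsBump η) (g : Rd d → ℂ) :
    HasCompactSupport (fun ξ => (η (a ξ) : ℂ) * g ξ) := by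
  obtain ⟨α, β, hα, -, hs⟩ := ha.exists_shell hη
  refine HasCompactSupport.intro (isCompact_shell α β) fun ξ hξ => ?_
  have : η (a ξ) = 0 := by
    by_contra h
    exact hξ (hs ξ h)
  simp [this]

end IsDistFn

lemma volume_qcube (d : ℕ) (z : Fin d → ℤ) : volume (qcube d z) = 1 := by
  have e : qcube d z = (MeasurableEquiv.toLp 2 (Fin d → ℝ)).symm ⁻¹'
      (Set.pi univ fun i => Ico (z i : ℝ) (z i + 1)) := by
    ext y
    simp [qcube, Set.mem_pi]
  rw [e, (EuclideanSpace.volume_preserving_symm_measurableEquiv_toLp (Fin d)).measure_preimage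
    (MeasurableSet.univ_pi fun i => measurableSet_Ico).nullMeasurableSet, Real.volume_pi_Ico]
  simp

lemma measurableSet_qcube (d : ℕ) (z : Fin d → ℤ) : MeasurableSet (qcube d z) := by
  have : qcube d z = ⋂ i, {y : Rd d | (z i : ℝ) ≤ y i ∧ y i < z i + 1} := by
    ext y; simp [qcube]
  rw [this]
  refine MeasurableSet.iInter fun i => ?_
  have : Measurable fun y : Rd d => y i := by fun_prop
  exact (measurableSet_le measurable_const this).inter (measurableSet_lt this measurable_const)

lemma norm_le_of_mem_qcube {d : ℕ} {z : Fin d → ℤ} {y : Rd d} (hy : y ∈ qcube d z) :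
    ‖y - latticeVec d z‖ ≤ √d := by
  rw [EuclideanSpace.norm_eq]
  apply Real.sqrt_le_sqrt
  calc _ ≤ ∑ i : Fin d, (1 : ℝ) := by
        apply Finset.sum_le_sum
        intro i _
        have := hy i
        simp only [PiLp.sub_apply, latticeVec, Real.norm_eq_abs, sq_abs]
        nlinarith
    _ = d := by simp

namespace IsNormalized

variable {d : ℕ} {z : Fin d → ℤ} {b : Rd d → ℂ}

lemma norm_le_indicator (hb : IsNormalized z b) (y : Rd d) :
    ‖b y‖ ≤ (qcube d z).indicator (fun _ => (1 : ℝ)) y := by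
  by_cases h : y ∈ qcube d z
  · rw [indicator_of_mem h]; exact hb.2.1 y
  · rw [indicator_of_notMem h, hb.2.2 y h, norm_zero]

lemma integrable_indicator (d : ℕ) (z : Fin d → ℤ) :
    Integrable ((qcube d z).indicator (fun _ => (1 : ℝ))) := by
  rw [integrable_indicator_iff (measurableSet_qcube d z)]
  exact integrableOn_const (by rw [volume_qcube]; simp)

lemma integrable (hb : IsNormalized z b) : Integrable b :=
  (integrable_indicator d z).mono' hb.1.aestronglyMeasurable
    (Filter.Eventually.of_forall hb.norm_le_indicator)

lemma norm_integral_mul_le (hb : IsNormalized z b) {f : Rd d → ℂ} {S : ℝ} (hS : 0 ≤ S)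
    (hf : ∀ y ∈ qcube d z, ‖f y‖ ≤ S) : ‖∫ y, f y * b y‖ ≤ S := by
  have h : ∀ y, ‖f y * b y‖ ≤ (qcube d z).indicator (fun _ => S) y := by
    intro y
    by_cases h : y ∈ qcube d z
    · rw [indicator_of_mem h, norm_mul]
      exact (mul_le_mul (hf y h) (hb.2.1 y) (norm_nonneg _) hS).trans_eq (mul_one S)
    · rw [indicator_of_notMem h, hb.2.2 y h, mul_zero, norm_zero]
  have hi : Integrable ((qcube d z).indicator (fun _ => S)) := by
    rw [integrable_indicator_iff (measurableSet_qcube d z)]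
    exact integrableOn_const (by rw [volume_qcube]; simp)
  refine (norm_integral_le_of_norm_le hi (Filter.Eventually.of_forall h)).trans_eq ?_
  rw [integral_indicator_const _ (measurableSet_qcube d z), measureReal_def, volume_qcube]
  simp

lemma contDiff_fourier (hb : IsNormalized z b) : ContDiff ℝ (⊤ : ℕ∞) (𝓕 b) := by
  apply Real.contDiff_fourier
  intro k _
  refine ((integrable_indicator d z).const_mul ((‖latticeVec d z‖ + √d) ^ k)).mono'
    ((measurable_norm.pow_const k).mul hb.1.norm).aestronglyMeasurable
    (Filter.Eventually.of_forall fun y => ?_)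
  rw [Real.norm_of_nonneg (by positivity)]
  by_cases h : y ∈ qcube d z
  · have h1 : ‖y‖ ≤ ‖latticeVec d z‖ + √d := by
      have := norm_add_le (latticeVec d z) (y - latticeVec d z)
      rw [add_sub_cancel] at this
      linarith [norm_le_of_mem_qcube h]
    exact mul_le_mul (by gcongr) (hb.norm_le_indicator y) (norm_nonneg _) (by positivity)
  · rw [hb.2.2 y h, norm_zero, mul_zero]
    exact mul_nonneg (by positivity) (indicator_nonneg (fun _ _ => zero_le_one) _)

end IsNormalized

lemma integral_mul_fourier_eq {E : Type*} [NormedAddCommGroup E] [InnerProductSpace ℝ E]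
    [FiniteDimensional ℝ E] [MeasurableSpace E] [BorelSpace E] {m b : E → ℂ} (hm : Integrable m)
    (hb : Integrable b) (x : E) :
    ∫ ξ, m ξ * Complex.exp (2 * π * Complex.I * (inner ℝ x ξ : ℝ)) * 𝓕 b ξ =
      ∫ y, (∫ ξ, m ξ * Complex.exp (2 * π * Complex.I * (inner ℝ (x - y) ξ : ℝ))) * b y := by
  have hF : Integrable (fun q : E × E => m q.1 * b q.2 *
      Complex.exp (2 * π * Complex.I * (inner ℝ (x - q.2) q.1 : ℝ))) (volume.prod volume) := by
    refine (hm.mul_prod hb).mul_bdd (c := 1) (Continuous.aestronglyMeasurable (by fun_prop))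
      (Filter.Eventually.of_forall fun q => ?_)
    rw [show 2 * (π : ℂ) * Complex.I * ((inner ℝ (x - q.2) q.1 : ℝ) : ℂ) =
      ((2 * π * inner ℝ (x - q.2) q.1 : ℝ) : ℂ) * Complex.I by push_cast; ring]
    rw [Complex.norm_exp_ofReal_mul_I]
  calc _ = ∫ ξ, ∫ y, m ξ * b y * Complex.exp (2 * π * Complex.I * (inner ℝ (x - y) ξ : ℝ)) := by
        congr 1; ext ξ
        rw [Real.fourier_eq', ← integral_const_mul]
        congr 1; ext y
        rw [inner_sub_left, smul_eq_mul, Complex.ofReal_sub, mul_sub, sub_eq_add_neg, Complex.exp_add]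
        have : ((-2 * π * inner ℝ y ξ : ℝ) : ℂ) * Complex.I =
          -(2 * π * Complex.I * ((inner ℝ y ξ : ℝ) : ℂ)) := by push_cast; ring
        rw [this]; ring
    _ = ∫ y, ∫ ξ, m ξ * b y * Complex.exp (2 * π * Complex.I * (inner ℝ (x - y) ξ : ℝ)) :=
        integral_integral_swap hF
    _ = _ := by
        congr 1; ext y
        rw [← integral_mul_const]
        congr 1; ext ξ
        ring

/-- The Fourier transform of `K_r ∗ b` as a Schwartz function. -/
def convSpectrum {d : ℕ} {a : Rd d → ℝ} {η : ℝ → ℝ} (ha : IsDistFn a) (hη : IsBump η) (r : ℝ)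
    {z : Fin d → ℤ} {b : Rd d → ℂ} (hb : IsNormalized z b) : SchwartzMap (Rd d) ℂ :=
  HasCompactSupport.toSchwartzMap
    (f := fun ξ => (η (a ξ) : ℂ) * (Complex.exp (Complex.I * r * a ξ) * 𝓕 b ξ))
    (ha.hasCompactSupport_bump_mul hη _)
    (by
      simp only [← mul_assoc]
      exact (ha.contDiff_bump_mul_exp hη r).mul hb.contDiff_fourier)

/-- The symbol `η(a)² e^{i r a}`. -/
def overlapSymbol {d : ℕ} (a : Rd d → ℝ) (η : ℝ → ℝ) (r : ℝ) (ξ : Rd d) : ℂ :=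
  (η (a ξ) : ℂ) * ((η (a ξ) : ℂ) * Complex.exp (Complex.I * r * a ξ))

lemma integrable_bump_mul {d : ℕ} {a : Rd d → ℝ} {η : ℝ → ℝ} (ha : IsDistFn a) (hη : IsBump η)
    {g : Rd d → ℂ} (hg : Continuous g) :
    Integrable (fun ξ => (η (a ξ) : ℂ) * g ξ) :=
  ((Complex.continuous_ofReal.comp (ha.contDiff_bump hη).continuous).mul
    hg).integrable_of_hasCompactSupport (ha.hasCompactSupport_bump_mul hη g)

section

variable {d : ℕ} {a : Rd d → ℝ} {η : ℝ → ℝ} (ha : IsDistFn a) (hη : IsBump η)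
  {z : Fin d → ℤ} {b : Rd d → ℂ} (hb : IsNormalized z b)

lemma convSpectrum_apply (r : ℝ) (ξ : Rd d) : convSpectrum ha hη r hb ξ =
    (η (a ξ) : ℂ) * Complex.exp (Complex.I * r * a ξ) * 𝓕 b ξ := by
  rw [mul_assoc]; rfl

lemma conv_Kker_eq_fourierInv (r : ℝ) (x : Rd d) :
    conv (Kker a η r) b x = (𝓕⁻ (convSpectrum ha hη r hb)) x := by
  have hm : Integrable (fun ξ => (η (a ξ) : ℂ) * Complex.exp (Complex.I * r * a ξ)) :=
    (ha.contDiff_bump_mul_exp hη r).continuous.integrable_of_hasCompactSupport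
      (ha.hasCompactSupport_bump_mul hη _)
  rw [SchwartzMap.fourierInv_coe, Real.fourierInv_eq']
  unfold conv Kker
  rw [← integral_mul_fourier_eq hm hb.integrable]
  congr 1; ext ξ
  rw [convSpectrum_apply, smul_eq_mul, real_inner_comm]
  have : ((2 * π * inner ℝ ξ x : ℝ) : ℂ) * Complex.I =
    2 * π * Complex.I * ((inner ℝ ξ x : ℝ) : ℂ) := by push_cast; ring
  rw [this]; ring

lemma eLpNorm_sum_conv_Kker {ι : Type*} (s : Finset ι) (c : ι → ℂ) (r : ι → ℝ)
    (z : ι → Fin d → ℤ) (b : ι → Rd d → ℂ) (hb : ∀ e, IsNormalized (z e) (b e)) :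
    eLpNorm (fun x => ∑ e ∈ s, c e * conv (Kker a η (r e)) (b e) x) 2 volume =
      ‖∑ e ∈ s, c e • (convSpectrum ha hη (r e) (hb e)).toLp 2‖ₑ := by
  set F : SchwartzMap (Rd d) ℂ := ∑ e ∈ s, c e • convSpectrum ha hη (r e) (hb e) with hF
  have e1 : (fun x => ∑ e ∈ s, c e * conv (Kker a η (r e)) (b e) x) = 𝓕⁻ F := by
    ext x
    have : (𝓕⁻ F) = ∑ e ∈ s, c e • 𝓕⁻ (convSpectrum ha hη (r e) (hb e)) := by
      have h := map_sum (FourierTransform.fourierInvCLM ℂ (SchwartzMap (Rd d) ℂ))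
        (fun e => c e • convSpectrum ha hη (r e) (hb e)) s
      exact h.trans (Finset.sum_congr rfl fun e _ => map_smul _ _ _)
    rw [this]
    simp [conv_Kker_eq_fourierInv ha hη (hb _)]
  have e2 : ∑ e ∈ s, c e • (convSpectrum ha hη (r e) (hb e)).toLp 2 = F.toLp 2 := by
    have h := map_sum (SchwartzMap.toLpCLM ℂ ℂ 2 (volume : Measure (Rd d)))
      (fun e => c e • convSpectrum ha hη (r e) (hb e)) s
    exact (h.trans (Finset.sum_congr rfl fun e _ => map_smul _ _ _)).symm
  have e3 : ‖(𝓕⁻ F).toLp 2‖ = ‖F.toLp 2‖ := by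
    rw [← SchwartzMap.norm_fourier_toL2_eq, FourierTransform.fourier_fourierInv_eq]
  rw [e1, e2, ← ofReal_norm, ← e3, SchwartzMap.norm_toLp, ENNReal.ofReal_toReal]
  exact ((𝓕⁻ F).memLp 2 volume).eLpNorm_ne_top

lemma norm_inner_convSpectrum_le {z' : Fin d → ℤ} {b' : Rd d → ℂ} (hb' : IsNormalized z' b')
    {r r' S : ℝ} (hS : 0 ≤ S)
    (h : ∀ y ∈ qcube d z, ∀ y' ∈ qcube d z',
      ‖oscInt a (fun ξ => η (a ξ) ^ 2) (r - r') (y' - y)‖ ≤ S) :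
    ‖inner ℂ ((convSpectrum ha hη r' hb').toLp 2) ((convSpectrum ha hη r hb).toLp 2)‖ ≤ S := by
  have hm : Integrable (overlapSymbol a η (r - r')) :=
    integrable_bump_mul ha hη (ha.contDiff_bump_mul_exp hη (r - r')).continuous
  have hH : Integrable (fun ξ => overlapSymbol a η (r - r') ξ * 𝓕 b ξ) := by
    have := integrable_bump_mul ha hη
      ((ha.contDiff_bump_mul_exp hη (r - r')).continuous.mul hb.contDiff_fourier.continuous)
    simpa only [overlapSymbol, mul_assoc, Pi.mul_apply] using this
  set m := overlapSymbol a η (r - r') with hmd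
  have e1 : inner ℂ ((convSpectrum ha hη r' hb').toLp 2) ((convSpectrum ha hη r hb).toLp 2) =
      ∫ ξ, m ξ * 𝓕 b ξ * (starRingEnd ℂ) (𝓕 b' ξ) := by
    rw [L2.inner_def]
    apply integral_congr_ae
    filter_upwards [(convSpectrum ha hη r' hb').coeFn_toLp 2,
      (convSpectrum ha hη r hb).coeFn_toLp 2] with ξ h1 h2
    rw [h1, h2, RCLike.inner_apply, convSpectrum_apply, convSpectrum_apply, hmd, overlapSymbol,
      map_mul, map_mul, Complex.conj_ofReal, ← Complex.exp_conj, map_mul, map_mul,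
      Complex.conj_ofReal, Complex.conj_ofReal, Complex.conj_I]
    have : Complex.I * ((r - r' : ℝ) : ℂ) * (a ξ : ℂ) =
        Complex.I * r * a ξ + -Complex.I * r' * a ξ := by push_cast; ring
    rw [this, Complex.exp_add]
    ring
  have e2 : ∀ y', ∫ ξ, m ξ * 𝓕 b ξ * Complex.exp (2 * π * Complex.I * (inner ℝ y' ξ : ℝ)) =
      ∫ y, oscInt a (fun ξ => η (a ξ) ^ 2) (r - r') (y' - y) * b y := by
    intro y'
    calc _ = ∫ ξ, m ξ * Complex.exp (2 * π * Complex.I * (inner ℝ y' ξ : ℝ)) * 𝓕 b ξ := by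
          congr 1; ext ξ; ring
      _ = _ := by
          rw [integral_mul_fourier_eq hm hb.integrable]
          congr 1; ext y
          congr 1
          unfold oscInt
          congr 1; ext ξ
          rw [hmd, overlapSymbol, mul_assoc, mul_assoc, ← Complex.exp_add, ← mul_assoc]
          congr 1
          · push_cast; ring
          · congr 1; push_cast; ring
  have e3 : (starRingEnd ℂ) (∫ ξ, m ξ * 𝓕 b ξ * (starRingEnd ℂ) (𝓕 b' ξ)) =
      ∫ y', (starRingEnd ℂ)
        (∫ ξ, m ξ * 𝓕 b ξ * Complex.exp (2 * π * Complex.I * (inner ℝ y' ξ : ℝ))) * b' y' := by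
    rw [← integral_conj]
    have hc : Integrable (fun ξ => (starRingEnd ℂ) (m ξ * 𝓕 b ξ)) :=
      (LinearIsometryEquiv.integrable_comp_iff (Complex.conjLIE)).2 hH
    have h0 := integral_mul_fourier_eq hc hb'.integrable 0
    refine Eq.trans ?_ (h0.trans ?_)
    · congr 1; ext ξ
      simp
    · congr 1; ext y'
      rw [← integral_conj]
      congr 2; ext ξ
      rw [map_mul _ (m ξ * 𝓕 b ξ), ← Complex.exp_conj]
      congr 2
      simp [Complex.conj_ofNat]
  rw [e1, ← RCLike.norm_conj, e3]
  refine hb'.norm_integral_mul_le hS fun y' hy' => ?_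
  rw [RCLike.norm_conj, e2]
  exact hb.norm_integral_mul_le hS fun y hy => h y hy y' hy'

end

lemma abs_sub_le_norm_latticeVec_sub {d : ℕ} (z z' : Fin d → ℤ) (i : Fin d) :
    |(z i : ℝ) - z' i| ≤ ‖latticeVec d z - latticeVec d z'‖ := by
  have := PiLp.norm_apply_le (latticeVec d z - latticeVec d z') i
  simpa [latticeVec] using this

lemma norm_sub_sub_latticeVec_le {d : ℕ} {z z' : Fin d → ℤ} {y y' : Rd d} (hy : y ∈ qcube d z)
    (hy' : y' ∈ qcube d z') :
    ‖(y' - y) - (latticeVec d z' - latticeVec d z)‖ ≤ 2 * √d := by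
  have e : (y' - y) - (latticeVec d z' - latticeVec d z) =
    (y' - latticeVec d z') - (y - latticeVec d z) := by abel
  rw [e]
  linarith [norm_sub_le (y' - latticeVec d z') (y - latticeVec d z), norm_le_of_mem_qcube hy,
    norm_le_of_mem_qcube hy']

/-- Almost orthogonality of `K_n ∗ b_{n,z}` in terms of the distance of the indices. -/
def HasDecay {d : ℕ} {H : Type*} [NormedAddCommGroup H] [InnerProductSpace ℂ H]
    (v : ℕ × (Fin d → ℤ) → H) (C : ℝ) : Prop :=
  ∀ e e', ‖(inner ℂ (v e') (v e) : ℂ)‖ ≤ C * (√(1 + |(e.1 : ℝ) - e'.1|))⁻¹ ^ (d - 1) *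
    ∏ i, (1 + |(e.2 i : ℝ) - e'.2 i| / (1 + |(e.1 : ℝ) - e'.1|))⁻¹ ^ 2

/-- Almost orthogonality between different dyadic scales `k + 2 ≤ j`. -/
def HasScaleDecay {d : ℕ} {H : Type*} [NormedAddCommGroup H] [InnerProductSpace ℂ H]
    (v : ℕ × (Fin d → ℤ) → H) (C : ℝ) : Prop :=
  ∀ (j k : ℕ) (e : ℕ × (Fin d → ℤ)) (F : Finset (ℕ × (Fin d → ℤ))) (N : ℝ), k + 2 ≤ j →
    2 ^ j ≤ e.1 → e.1 < 2 ^ (j + 1) → (∀ e' ∈ F, e'.1 < 2 ^ (k + 1)) →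
    (∀ w : Fin d → ℝ, ((F.filter fun e' => ∀ i, |(e'.2 i : ℝ) - w i| ≤ 2 ^ k).card : ℝ) ≤ N) →
    ∑ e' ∈ F, ‖(inner ℂ (v e') (v e) : ℂ)‖ ≤ C * N * (√2 ^ (d - 1)) ^ j / (2 ^ (d - 1)) ^ k

lemma exists_hasDecay {n : ℕ} {a : Rd (n + 1) → ℝ} {η : ℝ → ℝ} (ha : IsDistFn a)
    (hc : CurvNondeg a) (hη : IsBump η) :
    ∃ C : ℝ, 0 < C ∧ ∀ (b : ℕ × (Fin (n + 1) → ℤ) → Rd (n + 1) → ℂ)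
      (hb : ∀ e, IsNormalized e.2 (b e)),
      HasDecay (fun e => (convSpectrum ha hη e.1 (hb e)).toLp 2) C := by
  obtain ⟨α, β, hα, hβ, hs⟩ := ha.exists_shell hη
  obtain ⟨C, hC, h⟩ := exists_oscInt_le_decay ha hc ((ha.contDiff_bump hη).pow 2) hα hβ
    (fun ξ hξ => hs ξ fun h0 => hξ (by simp [h0])) (2 * (n + 1))
  set A : ℝ := 1 + 2 * √((n + 1 : ℕ) : ℝ) with hA
  have hA1 : 1 ≤ A := by rw [hA]; linarith [Real.sqrt_nonneg ((n + 1 : ℕ) : ℝ)]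
  refine ⟨C * A ^ (2 * (n + 1)), by positivity, fun b hb e e' => ?_⟩
  refine norm_inner_convSpectrum_le ha hη (hb e) (hb e') (by positivity) fun y hy y' hy' => ?_
  refine (h _ _).trans ?_
  set S : ℝ := 1 + |(e.1 : ℝ) - e'.1| with hS
  have hS1 : 1 ≤ S := by rw [hS]; linarith [abs_nonneg ((e.1 : ℝ) - e'.1)]
  have key : (1 + ‖y' - y‖ / S)⁻¹ ^ (2 * (n + 1)) ≤ A ^ (2 * (n + 1)) *
      ∏ i, (1 + |(e.2 i : ℝ) - e'.2 i| / S)⁻¹ ^ 2 := by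
    have h1 : ∀ i, (1 + ‖y' - y‖ / S)⁻¹ ≤ A * (1 + |(e.2 i : ℝ) - e'.2 i| / S)⁻¹ := by
      intro i
      have h2 := abs_sub_le_norm_latticeVec_sub e'.2 e.2 i
      have h3 := norm_sub_sub_latticeVec_le hy hy'
      have h4 := norm_sub_norm_le (latticeVec (n + 1) e'.2 - latticeVec (n + 1) e.2) (y' - y)
      rw [norm_sub_rev _ (y' - y)] at h4
      rw [abs_sub_comm] at h2
      have h5 : |(e.2 i : ℝ) - e'.2 i| ≤ ‖y' - y‖ + (A - 1) := by rw [hA]; linarith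
      rw [← div_eq_mul_inv, inv_eq_one_div, div_le_div_iff₀ (by positivity) (by positivity)]
      have h6 : |(e.2 i : ℝ) - e'.2 i| / S ≤ ‖y' - y‖ / S + (A - 1) := by
        calc _ ≤ (‖y' - y‖ + (A - 1)) / S := by gcongr
          _ = ‖y' - y‖ / S + (A - 1) / S := add_div _ _ _
          _ ≤ _ := by gcongr; exact div_le_self (by linarith) hS1
      have h7 : 0 ≤ ‖y' - y‖ / S := by positivity
      nlinarith
    calc (1 + ‖y' - y‖ / S)⁻¹ ^ (2 * (n + 1)) = ∏ i : Fin (n + 1), (1 + ‖y' - y‖ / S)⁻¹ ^ 2 := by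
          simp [pow_mul]
      _ ≤ ∏ i, (A * (1 + |(e.2 i : ℝ) - e'.2 i| / S)⁻¹) ^ 2 := by
          refine Finset.prod_le_prod (fun i _ => by positivity) fun i _ => ?_
          have := h1 i
          gcongr
      _ = _ := by simp_rw [mul_pow, Finset.prod_mul_distrib]; simp [pow_mul]
  calc C * (√S)⁻¹ ^ n * (1 + ‖y' - y‖ / S)⁻¹ ^ (2 * (n + 1)) ≤ C * (√S)⁻¹ ^ n *
        (A ^ (2 * (n + 1)) * ∏ i, (1 + |(e.2 i : ℝ) - e'.2 i| / S)⁻¹ ^ 2) := by gcongr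
    _ = _ := by rw [Nat.add_sub_cancel]; ring

lemma exists_hasScaleDecay {n : ℕ} {a : Rd (n + 1) → ℝ} {η : ℝ → ℝ} (ha : IsDistFn a)
    (hc : CurvNondeg a) (hη : IsBump η) :
    ∃ C : ℝ, 0 < C ∧ ∀ (b : ℕ × (Fin (n + 1) → ℤ) → Rd (n + 1) → ℂ)
      (hb : ∀ e, IsNormalized e.2 (b e)),
      HasScaleDecay (fun e => (convSpectrum ha hη e.1 (hb e)).toLp 2) C := by
  obtain ⟨α, β, hα, hβ, hs⟩ := ha.exists_shell hη
  set A : ℝ := 1 + 2 * √((n + 1 : ℕ) : ℝ) with hA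
  have hA1 : 1 ≤ A := by rw [hA]; linarith [Real.sqrt_nonneg ((n + 1 : ℕ) : ℝ)]
  obtain ⟨C, hC, h⟩ := exists_oscInt_majorant ha hc ((ha.contDiff_bump hη).pow 2) hα hβ
    (fun ξ hξ => hs ξ fun h0 => hξ (by simp [h0])) (C₁ := A) (by linarith)
  set ω : ℝ := (volume (Metric.ball (0 : Rd (n + 1)) 1)).toReal with hω
  have hω' : volume (Metric.ball (0 : Rd (n + 1)) 1) = ENNReal.ofReal ω :=
    (ENNReal.ofReal_toReal measure_ball_lt_top.ne).symm
  have hω0 : 0 < ω := ENNReal.toReal_pos (Metric.measure_ball_pos _ _ one_pos).ne'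
    measure_ball_lt_top.ne
  refine ⟨C * √2 ^ n / ω, by positivity, fun b hb j k e F N hjk he1 he2 hF hN => ?_⟩
  set L : ℝ := 2 ^ k with hL
  have hL1 : 1 ≤ L := one_le_pow₀ (by norm_num)
  have hN0 : 0 ≤ N := le_trans (Nat.cast_nonneg _) (hN 0)
  have he1' : (2 : ℝ) ^ j ≤ e.1 := by exact_mod_cast he1
  have he2' : (e.1 : ℝ) ≤ 2 ^ (j + 1) := by exact_mod_cast he2.le
  have h4 : 4 * L ≤ e.1 := by
    refine le_trans ?_ he1'
    calc 4 * L = 2 ^ (k + 2) := by rw [hL, pow_add]; ring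
      _ ≤ _ := pow_le_pow_right₀ (by norm_num) hjk
  obtain ⟨G, hG, hG1, hG2⟩ := h L e.1 hL1 h4
  set p : ℕ × (Fin (n + 1) → ℤ) → ℝ := fun e' =>
    ‖(inner ℂ ((convSpectrum ha hη e'.1 (hb e')).toLp 2 : Lp ℂ 2 (volume : Measure (Rd (n + 1))))
      ((convSpectrum ha hη e.1 (hb e)).toLp 2) : ℂ)‖ with hp
  set c : ℕ × (Fin (n + 1) → ℤ) → Rd (n + 1) := fun e' =>
    latticeVec (n + 1) e'.2 - latticeVec (n + 1) e.2 with hcd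
  have hpG : ∀ e' ∈ F, ∀ w ∈ Metric.ball (c e') L, ENNReal.ofReal (p e') ≤ G w := by
    intro e' he' w hw
    rcases eq_or_ne (G w) ⊤ with h0 | h0
    · rw [h0]; exact le_top
    rw [← ENNReal.ofReal_toReal h0]
    refine ENNReal.ofReal_le_ofReal ?_
    refine norm_inner_convSpectrum_le ha hη (hb e) (hb e') ENNReal.toReal_nonneg
      fun y hy y' hy' => ?_
    have := hG2 ((e.1 : ℝ) - e'.1) (y' - y) w ?_ ?_
    · rw [← ofReal_norm] at this
      exact (ENNReal.ofReal_le_iff_le_toReal h0).1 this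
    · have h5 : (e'.1 : ℝ) ≤ 2 ^ (k + 1) := by exact_mod_cast (hF e' he').le
      rw [sub_sub_cancel_left, abs_neg, Nat.abs_cast, hL]
      rw [pow_succ] at h5; linarith
    · have h5 := norm_sub_sub_latticeVec_le hy hy'
      rw [Metric.mem_ball, dist_comm, dist_eq_norm] at hw
      have h6 := norm_add_le (y' - y - c e') (c e' - w)
      rw [sub_add_sub_cancel] at h6
      have h7 : (A - 1) ≤ (A - 1) * L := le_mul_of_one_le_right (by linarith) hL1
      have h8 : ‖y' - y - c e'‖ ≤ A - 1 := by rw [hA]; simpa using h5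
      linarith
  have hball : ∀ x : Rd (n + 1), volume (Metric.ball x L) = ENNReal.ofReal (L ^ (n + 1) * ω) := by
    intro x
    rw [Measure.addHaar_ball _ _ (by positivity), hω', ← ENNReal.ofReal_mul (by positivity)]
    simp
  have hsum : ENNReal.ofReal ((∑ e' ∈ F, p e') * (L ^ (n + 1) * ω)) ≤
      ENNReal.ofReal (N * (C * (√e.1 ^ n * L))) := by
    calc ENNReal.ofReal ((∑ e' ∈ F, p e') * (L ^ (n + 1) * ω))
        = ∑ e' ∈ F, ENNReal.ofReal (p e') * volume (Metric.ball (c e') L) := by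
          simp_rw [hball]
          rw [ENNReal.ofReal_mul (Finset.sum_nonneg fun _ _ => norm_nonneg _),
            ENNReal.ofReal_sum_of_nonneg (fun _ _ => norm_nonneg _), Finset.sum_mul]
      _ ≤ ∑ e' ∈ F, ∫⁻ w, (Metric.ball (c e') L).indicator G w := by
          refine Finset.sum_le_sum fun e' he' => ?_
          rw [lintegral_indicator Metric.isOpen_ball.measurableSet, ← setLIntegral_const]
          exact setLIntegral_mono hG (hpG e' he')
      _ = ∫⁻ w, ∑ e' ∈ F, (Metric.ball (c e') L).indicator G w :=
          (lintegral_finsetSum _ fun e' _ => hG.indicator Metric.isOpen_ball.measurableSet).symm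
      _ ≤ ∫⁻ w, ENNReal.ofReal N * G w := by
          refine lintegral_mono fun w => ?_
          have e1 : ∑ e' ∈ F, (Metric.ball (c e') L).indicator G w =
              ((F.filter fun e' => w ∈ Metric.ball (c e') L).card : ℝ≥0∞) * G w := by
            simp only [indicator_apply]
            rw [← Finset.sum_filter, Finset.sum_const, nsmul_eq_mul]
          rw [e1]
          gcongr
          rw [← ENNReal.ofReal_natCast]
          refine ENNReal.ofReal_le_ofReal (le_trans ?_ (hN fun i => w i + e.2 i))
          gcongr with e' he'
          intro hw i
          rw [Metric.mem_ball, dist_comm, dist_eq_norm] at hw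
          have := PiLp.norm_apply_le (c e' - w) i
          have h5 : (c e' - w) i = (e'.2 i : ℝ) - (w i + e.2 i) := by
            simp [hcd, latticeVec]; ring
          rw [h5, Real.norm_eq_abs] at this
          linarith
      _ = ENNReal.ofReal N * ∫⁻ w, G w := lintegral_const_mul _ hG
      _ ≤ ENNReal.ofReal N * ENNReal.ofReal (C * (√e.1 ^ n * L)) := by gcongr
      _ = _ := (ENNReal.ofReal_mul hN0).symm
  have h9 := (ENNReal.ofReal_le_ofReal_iff (by positivity)).1 hsum
  have h10 : √(e.1 : ℝ) ^ n ≤ √2 ^ n * (√2 ^ n) ^ j := by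
    calc √(e.1 : ℝ) ^ n ≤ √(2 ^ (j + 1)) ^ n := by gcongr
      _ = _ := by
        have : √((2 : ℝ) ^ (j + 1)) = √2 ^ (j + 1) := by
          rw [Real.sqrt_eq_iff_mul_self_eq (by positivity) (by positivity), ← mul_pow,
            Real.mul_self_sqrt (by norm_num)]
        rw [this]; ring
  rw [Nat.add_sub_cancel, le_div_iff₀ (by positivity), ← pow_mul, mul_comm n k, pow_mul, ← hL]
  have h11 : (∑ e' ∈ F, p e') * L ^ n * (L * ω) ≤
      (C * √2 ^ n / ω * N * (√2 ^ n) ^ j) * (L * ω) := by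
    calc (∑ e' ∈ F, p e') * L ^ n * (L * ω) = (∑ e' ∈ F, p e') * (L ^ (n + 1) * ω) := by ring
      _ ≤ N * (C * (√e.1 ^ n * L)) := h9
      _ ≤ N * (C * (√2 ^ n * (√2 ^ n) ^ j * L)) := by gcongr
      _ = _ := by field_simp
  exact le_of_mul_le_mul_right h11 (by positivity)

/-- The points of `E` are at most `Λ 2^k` in each dyadic cube of side `2^k`, `1 ≤ k ≤ j`. -/
def CellBound {d : ℕ} (E : Finset (ℕ × (Fin d → ℤ))) (j : ℕ) (Λ : ℝ) : Prop :=
  ∀ k, 1 ≤ k → k ≤ j → ∀ (m : ℤ) (w : Fin d → ℤ),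
    ((E.filter fun e => (e.1 : ℤ) / 2 ^ k = m ∧ ∀ i, e.2 i / 2 ^ k = w i).card : ℝ) ≤ Λ * 2 ^ k

lemma embedPt_injective (d : ℕ) : Function.Injective (embedPt d) := by
  rintro ⟨n, z⟩ ⟨n', z'⟩ h
  simp only [embedPt, Prod.mk.injEq, Nat.cast_inj, funext_iff, Int.cast_inj] at h
  exact Prod.ext h.1 (funext h.2)

lemma CellBound.of_cubeCount {d j : ℕ} {E : Finset (ℕ × (Fin d → ℤ))} {Λ : ℝ} (hΛ : 0 ≤ Λ)
    (hE : ∀ e ∈ E, 2 ^ j ≤ e.1 ∧ e.1 < 2 ^ (j + 1))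
    (h : ∀ Q : DyCube d j, (cubeCount (E.image (embedPt d)) Q : ℝ) ≤ Λ * Q.len) :
    CellBound E j Λ := by
  intro k hk hkj m w
  have hT : (0 : ℤ) < 2 ^ k := by positivity
  rcases (E.filter fun e => (e.1 : ℤ) / 2 ^ k = m ∧ ∀ i, e.2 i / 2 ^ k = w i).eq_empty_or_nonempty
    with h0 | ⟨e₀, he₀⟩
  · rw [h0]; simp; positivity
  rw [Finset.mem_filter] at he₀
  obtain ⟨h1, h2, -⟩ := he₀
  obtain ⟨h3, h4⟩ := hE _ h1
  have h3' : (2 : ℤ) ^ (j - k) * 2 ^ k ≤ e₀.1 := by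
    rw [← pow_add, Nat.sub_add_cancel hkj]; exact_mod_cast h3
  have h4' : (e₀.1 : ℤ) < 2 ^ (j + 1 - k) * 2 ^ k := by
    rw [← pow_add, Nat.sub_add_cancel (by omega)]; exact_mod_cast h4
  have hm : (2 : ℤ) ^ (j - k) ≤ m ∧ m < 2 ^ (j + 1 - k) := by
    rw [← h2]
    exact ⟨(Int.le_ediv_iff_mul_le hT).2 h3', (Int.ediv_lt_iff_lt_mul hT).2 h4'⟩
  refine le_trans ?_ (h ⟨k, m, w, ⟨hk, hkj⟩, hm⟩)
  have key : ∀ x u : ℤ, x / 2 ^ k = u → (u : ℝ) * 2 ^ k ≤ x ∧ (x : ℝ) < (u + 1) * 2 ^ k := by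
    intro x u hxu
    have h5 : u * 2 ^ k ≤ x := (Int.le_ediv_iff_mul_le hT).1 hxu.ge
    have h6 : x < (u + 1) * 2 ^ k := (Int.ediv_lt_iff_lt_mul hT).1 (by omega)
    exact ⟨by exact_mod_cast h5, by exact_mod_cast h6⟩
  rw [cubeCount, Finset.filter_image, Finset.card_image_of_injective _ (embedPt_injective d)]
  refine Nat.cast_le.2 (Finset.card_le_card fun e he => ?_)
  rw [Finset.mem_filter] at he ⊢
  refine ⟨he.1, ?_, fun i => key _ _ (he.2.2 i)⟩
  have := key _ _ he.2.1
  simpa [embedPt] using this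

lemma CellBound.card_ball_le {d k : ℕ} {E : Finset (ℕ × (Fin d → ℤ))} {Λ : ℝ}
    (hk : 1 ≤ k) (hE : ∀ e ∈ E, 2 ^ k ≤ e.1 ∧ e.1 < 2 ^ (k + 1)) (h : CellBound E k Λ)
    (w : Fin d → ℝ) :
    ((E.filter fun e => ∀ i, |(e.2 i : ℝ) - w i| ≤ 2 ^ k).card : ℝ) ≤ 3 ^ d * Λ * 2 ^ k := by
  have hT : (0 : ℤ) < 2 ^ k := by positivity
  set U := Fintype.piFinset fun i => Finset.Icc (⌊w i / 2 ^ k⌋ - 1) (⌊w i / 2 ^ k⌋ + 1) with hU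
  have hUc : U.card = 3 ^ d := by
    rw [hU, Fintype.card_piFinset]
    have : ∀ i, (Finset.Icc (⌊w i / 2 ^ k⌋ - 1) (⌊w i / 2 ^ k⌋ + 1)).card = 3 := by
      intro i; rw [Int.card_Icc]; omega
    simp [this]
  have hsub : (E.filter fun e => ∀ i, |(e.2 i : ℝ) - w i| ≤ 2 ^ k) ⊆
      U.biUnion fun u => E.filter fun e => (e.1 : ℤ) / 2 ^ k = 1 ∧ ∀ i, e.2 i / 2 ^ k = u i := by
    intro e he
    rw [Finset.mem_filter] at he
    rw [Finset.mem_biUnion]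
    refine ⟨fun i => e.2 i / 2 ^ k, ?_, ?_⟩
    · rw [hU, Fintype.mem_piFinset]
      intro i
      have h1 := abs_le.1 (he.2 i)
      have h2 : w i = w i / 2 ^ k * 2 ^ k := by field_simp
      have h3 := Int.floor_le (w i / 2 ^ k)
      have h4 := Int.lt_floor_add_one (w i / 2 ^ k)
      have hT' : (0 : ℝ) < 2 ^ k := by positivity
      rw [Finset.mem_Icc]
      constructor
      · rw [Int.le_ediv_iff_mul_le hT]
        have : ((⌊w i / 2 ^ k⌋ : ℝ) - 1) * 2 ^ k ≤ e.2 i := by nlinarith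
        exact_mod_cast this
      · rw [← Int.lt_add_one_iff, Int.ediv_lt_iff_lt_mul hT]
        have : (e.2 i : ℝ) < ((⌊w i / 2 ^ k⌋ : ℝ) + 1 + 1) * 2 ^ k := by nlinarith
        exact_mod_cast this
    · rw [Finset.mem_filter]
      refine ⟨he.1, ?_, fun i => rfl⟩
      obtain ⟨h3, h4⟩ := hE _ he.1
      apply le_antisymm
      · rw [← Int.lt_add_one_iff, Int.ediv_lt_iff_lt_mul hT]
        rw [pow_succ'] at h4
        exact_mod_cast h4
      · rw [Int.le_ediv_iff_mul_le hT, one_mul]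
        exact_mod_cast h3
  calc _ ≤ ((U.biUnion fun u => E.filter fun e =>
        (e.1 : ℤ) / 2 ^ k = 1 ∧ ∀ i, e.2 i / 2 ^ k = u i).card : ℝ) := by
        exact_mod_cast Finset.card_le_card hsub
    _ ≤ ∑ u ∈ U, ((E.filter fun e =>
        (e.1 : ℤ) / 2 ^ k = 1 ∧ ∀ i, e.2 i / 2 ^ k = u i).card : ℝ) := by
        exact_mod_cast Finset.card_biUnion_le
    _ ≤ ∑ u ∈ U, Λ * 2 ^ k := Finset.sum_le_sum fun u _ => h k hk le_rfl 1 u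
    _ = _ := by rw [Finset.sum_const, hUc, nsmul_eq_mul]; push_cast; ring

/-- The sum `∑_{u ∈ ℤ} (1 + |u|)⁻²`. -/
def latticeConst : ℝ := ∑' u : ℤ, (1 + |(u : ℝ)|)⁻¹ ^ 2

lemma summable_latticeConst : Summable fun u : ℤ => (1 + |(u : ℝ)|)⁻¹ ^ 2 := by
  have h1 : Summable fun n : ℕ => (1 + (n : ℝ))⁻¹ ^ 2 := by
    have := (summable_nat_add_iff 1).2 (Real.summable_nat_pow_inv.2 (by norm_num : 1 < 2))
    refine this.congr fun n => ?_
    push_cast; rw [inv_pow, add_comm]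
  refine Summable.of_nat_of_neg ?_ ?_ <;> simpa using h1

lemma latticeConst_nonneg : 0 ≤ latticeConst := tsum_nonneg fun _ => by positivity

lemma sum_prod_inv_sq_le {d : ℕ} (W : Finset (Fin d → ℤ)) (w₀ : Fin d → ℤ) :
    ∑ w ∈ W, ∏ i, (1 + |(w i : ℝ) - w₀ i|)⁻¹ ^ 2 ≤ latticeConst ^ d := by
  set U : Fin d → Finset ℤ := fun i => W.image (· i) with hU
  calc ∑ w ∈ W, ∏ i, (1 + |(w i : ℝ) - w₀ i|)⁻¹ ^ 2
      ≤ ∑ w ∈ Fintype.piFinset U,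
          ∏ i, (1 + |(w i : ℝ) - w₀ i|)⁻¹ ^ 2 := by
        refine Finset.sum_le_sum_of_subset_of_nonneg (fun w hw => ?_) fun _ _ _ =>
          Finset.prod_nonneg fun _ _ => by positivity
        rw [Fintype.mem_piFinset]
        exact fun i => Finset.mem_image_of_mem _ hw
    _ = ∏ i, ∑ u ∈ U i, (1 + |(u : ℝ) - w₀ i|)⁻¹ ^ 2 :=
        (Finset.prod_univ_sum _ (fun i (u : ℤ) => (1 + |(u : ℝ) - w₀ i|)⁻¹ ^ 2)).symm
    _ ≤ ∏ i : Fin d, latticeConst := by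
        refine Finset.prod_le_prod (fun i _ => Finset.sum_nonneg fun _ _ => by positivity)
          fun i _ => ?_
        have hs : Summable fun u : ℤ => (1 + |((u : ℤ) : ℝ) - w₀ i|)⁻¹ ^ 2 := by
          have := (Equiv.subRight (w₀ i)).summable_iff.2 summable_latticeConst
          refine this.congr fun u => ?_
          simp
        refine (hs.sum_le_tsum _ fun _ _ => by positivity).trans_eq ?_
        rw [latticeConst, ← (Equiv.subRight (w₀ i)).tsum_eq fun u : ℤ => (1 + |(u : ℝ)|)⁻¹ ^ 2]
        simp
    _ = _ := by simp

lemma CellBound.sum_shell_le {d j K : ℕ} {E : Finset (ℕ × (Fin d → ℤ))} {Λ : ℝ} (hΛ : 0 ≤ Λ)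
    (h : CellBound E j Λ) (hK : 1 ≤ K) (hKj : K ≤ j) (e : ℕ × (Fin d → ℤ)) :
    ∑ e' ∈ E with |(e.1 : ℝ) - e'.1| + 1 ≤ 2 ^ K,
      ∏ i, (1 + |(e.2 i : ℝ) - e'.2 i| / 2 ^ K)⁻¹ ^ 2 ≤ 3 * (4 * latticeConst) ^ d * Λ * 2 ^ K := by
  have hT : (0 : ℤ) < 2 ^ K := by positivity
  set F := E.filter fun e' => |(e.1 : ℝ) - e'.1| + 1 ≤ 2 ^ K with hF
  set g : ℕ × (Fin d → ℤ) → ℤ × (Fin d → ℤ) := fun e' => ((e'.1 : ℤ) / 2 ^ K, fun i => e'.2 i / 2 ^ K)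
    with hg
  set φ : ℤ × (Fin d → ℤ) → ℝ := fun q => ∏ i, (4 * (1 + |(q.2 i : ℝ) - (g e).2 i|)⁻¹ ^ 2) with hφ
  have hφ0 : ∀ q, 0 ≤ φ q := fun q => Finset.prod_nonneg fun _ _ => by positivity
  have key : ∀ x : ℤ, ((x / 2 ^ K : ℤ) : ℝ) * 2 ^ K ≤ x ∧
      (x : ℝ) < (((x / 2 ^ K : ℤ) : ℝ) + 1) * 2 ^ K := by
    intro x
    have h5 : x / 2 ^ K * 2 ^ K ≤ x := (Int.le_ediv_iff_mul_le hT).1 le_rfl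
    have h6 : x < (x / 2 ^ K + 1) * 2 ^ K := (Int.ediv_lt_iff_lt_mul hT).1 (by omega)
    exact ⟨by exact_mod_cast h5, by exact_mod_cast h6⟩
  have key2 : ∀ x y : ℤ, |((y / 2 ^ K : ℤ) : ℝ) - ((x / 2 ^ K : ℤ) : ℝ)| ≤
      |(x : ℝ) - y| / 2 ^ K + 1 := by
    intro x y
    have hx := key x
    have hy := key y
    have hT' : (0 : ℝ) < 2 ^ K := by positivity
    have h1 := abs_le.1 (le_refl |(x : ℝ) - y|)
    rw [← sub_le_iff_le_add, le_div_iff₀ hT', sub_mul, ← abs_of_pos hT', ← abs_mul, abs_of_pos hT',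
      sub_le_iff_le_add, abs_le]
    constructor <;> nlinarith
  calc ∑ e' ∈ F, ∏ i, (1 + |(e.2 i : ℝ) - e'.2 i| / 2 ^ K)⁻¹ ^ 2 ≤ ∑ e' ∈ F, φ (g e') := by
        refine Finset.sum_le_sum fun e' _ => Finset.prod_le_prod (fun _ _ => by positivity)
          fun i _ => ?_
        have h1 := key2 (e.2 i) (e'.2 i)
        have h2 : 0 ≤ |(e.2 i : ℝ) - e'.2 i| / 2 ^ K := by positivity
        have h3 : (1 + |(e.2 i : ℝ) - e'.2 i| / 2 ^ K)⁻¹ ≤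
            2 * (1 + |((g e').2 i : ℝ) - (g e).2 i|)⁻¹ := by
          rw [← div_eq_mul_inv, inv_eq_one_div, div_le_div_iff₀ (by positivity) (by positivity)]
          simp only [hg]
          linarith
        calc _ ≤ (2 * (1 + |((g e').2 i : ℝ) - (g e).2 i|)⁻¹) ^ 2 := by gcongr
          _ = _ := by ring
    _ = ∑ q ∈ F.image g, ((F.filter fun e' => g e' = q).card : ℝ) * φ q := by
        rw [Finset.sum_comp]; simp
    _ ≤ ∑ q ∈ F.image g, Λ * 2 ^ K * φ q := by
        refine Finset.sum_le_sum fun q _ => mul_le_mul_of_nonneg_right ?_ (hφ0 q)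
        refine le_trans ?_ (h K hK hKj q.1 q.2)
        refine Nat.cast_le.2 (Finset.card_le_card fun e' he' => ?_)
        rw [Finset.mem_filter] at he' ⊢
        refine ⟨(Finset.mem_filter.1 he'.1).1, by rw [← he'.2], fun i => by rw [← he'.2]⟩
    _ ≤ ∑ q ∈ Finset.Icc ((g e).1 - 1) ((g e).1 + 1) ×ˢ (F.image g).image Prod.snd,
          Λ * 2 ^ K * φ q := by
        refine Finset.sum_le_sum_of_subset_of_nonneg (fun q hq => ?_) fun q _ _ => by
          have := hφ0 q; positivity
        rw [Finset.mem_product]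
        refine ⟨?_, Finset.mem_image_of_mem _ hq⟩
        obtain ⟨e', he', rfl⟩ := Finset.mem_image.1 hq
        have h1 := (Finset.mem_filter.1 he').2
        have h2 := key2 e.1 e'.1
        have h3 : |((e.1 : ℤ) : ℝ) - (e'.1 : ℤ)| / 2 ^ K < 1 := by
          rw [div_lt_one (by positivity)]; push_cast; linarith
        have h4 : |(((e'.1 : ℤ) / 2 ^ K : ℤ) : ℝ) - (((e.1 : ℤ) / 2 ^ K : ℤ) : ℝ)| < 2 := by linarith
        have h5 : |((e'.1 : ℤ) / 2 ^ K : ℤ) - ((e.1 : ℤ) / 2 ^ K : ℤ)| < 2 := by exact_mod_cast h4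
        rw [abs_lt] at h5
        rw [Finset.mem_Icc]
        simp only [hg]
        omega
    _ = Λ * 2 ^ K * (3 * ∑ w ∈ (F.image g).image Prod.snd,
          ∏ i, (4 * (1 + |(w i : ℝ) - (g e).2 i|)⁻¹ ^ 2)) := by
        rw [← Finset.mul_sum, Finset.sum_product]
        simp only [hφ, Finset.sum_const, Int.card_Icc]
        congr 1
        rw [nsmul_eq_mul]
        congr 1
        have : ((g e).1 + 1 + 1 - ((g e).1 - 1)) = 3 := by ring
        rw [this]; rfl
    _ ≤ Λ * 2 ^ K * (3 * (4 ^ d * latticeConst ^ d)) := by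
        simp_rw [Finset.prod_mul_distrib, ← Finset.mul_sum]
        have := sum_prod_inv_sq_le ((F.image g).image Prod.snd) (g e).2
        rw [Finset.prod_const, Finset.card_univ, Fintype.card_fin]
        gcongr
    _ = _ := by rw [mul_pow]; ring

section

variable {H : Type*} [NormedAddCommGroup H] [InnerProductSpace ℂ H] {ι : Type*}

lemma norm_sum_sq_le_sum_sum_norm_inner (s : Finset ι) (V : ι → H) :
    ‖∑ i ∈ s, V i‖ ^ 2 ≤ ∑ i ∈ s, ∑ i' ∈ s, ‖(inner ℂ (V i') (V i) : ℂ)‖ := by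
  rw [← inner_self_eq_norm_sq (𝕜 := ℂ)]
  refine (RCLike.re_le_norm _).trans ?_
  simp_rw [inner_sum, sum_inner]
  exact (norm_sum_le _ _).trans (Finset.sum_le_sum fun i _ => norm_sum_le _ _)

lemma norm_sum_sq_le_near_add_far (s : Finset ι) (V : ι → H) {r : ι → ι → Prop}
    (hr : ∀ i i', r i i' → r i' i) {D : ℝ} (hD : ∀ i ∈ s, ((s.filter (r i)).card : ℝ) ≤ D) :
    ‖∑ i ∈ s, V i‖ ^ 2 ≤ D * ∑ i ∈ s, ‖V i‖ ^ 2 +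
      ∑ i ∈ s, ∑ i' ∈ s with ¬ r i i', ‖(inner ℂ (V i') (V i) : ℂ)‖ := by
  refine (norm_sum_sq_le_sum_sum_norm_inner s V).trans ?_
  rw [Finset.sum_congr rfl fun i _ => (Finset.sum_filter_add_sum_filter_not s (r i) fun i' =>
    ‖(inner ℂ (V i') (V i) : ℂ)‖).symm, Finset.sum_add_distrib]
  gcongr
  have h1 : ∑ i ∈ s, ∑ i' ∈ s with r i i', ‖V i‖ ^ 2 ≤ D * ∑ i ∈ s, ‖V i‖ ^ 2 := by
    rw [Finset.mul_sum]
    refine Finset.sum_le_sum fun i hi => ?_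
    rw [Finset.sum_const, nsmul_eq_mul]
    exact mul_le_mul_of_nonneg_right (hD i hi) (by positivity)
  have h2 : ∑ i ∈ s, ∑ i' ∈ s with r i i', ‖V i'‖ ^ 2 =
      ∑ i ∈ s, ∑ i' ∈ s with r i i', ‖V i‖ ^ 2 := by
    simp_rw [Finset.sum_filter]
    rw [Finset.sum_comm]
    refine Finset.sum_congr rfl fun i _ => Finset.sum_congr rfl fun i' _ => ?_
    simp only [show r i' i ↔ r i i' from ⟨hr _ _, hr _ _⟩]
  calc ∑ i ∈ s, ∑ i' ∈ s with r i i', ‖(inner ℂ (V i') (V i) : ℂ)‖ ≤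
        ∑ i ∈ s, ∑ i' ∈ s with r i i', (‖V i‖ ^ 2 / 2 + ‖V i'‖ ^ 2 / 2) := by
        refine Finset.sum_le_sum fun i _ => Finset.sum_le_sum fun i' _ => ?_
        have := norm_inner_le_norm (𝕜 := ℂ) (V i') (V i)
        nlinarith [sq_nonneg (‖V i‖ - ‖V i'‖)]
    _ = (∑ i ∈ s, ∑ i' ∈ s with r i i', ‖V i‖ ^ 2) / 2 +
        (∑ i ∈ s, ∑ i' ∈ s with r i i', ‖V i'‖ ^ 2) / 2 := by
        simp_rw [Finset.sum_add_distrib, Finset.sum_div]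
    _ ≤ _ := by rw [h2]; linarith

lemma norm_inner_sum_sum_le {κ : Type*} (s : Finset ι) (t : Finset κ) (V : ι → H) (W : κ → H) :
    ‖(inner ℂ (∑ i ∈ s, V i) (∑ k ∈ t, W k) : ℂ)‖ ≤
      ∑ k ∈ t, ∑ i ∈ s, ‖(inner ℂ (V i) (W k) : ℂ)‖ := by
  simp_rw [inner_sum, sum_inner]
  exact (norm_sum_le _ _).trans (Finset.sum_le_sum fun i _ => norm_sum_le _ _)

end

lemma inv_sqrt_two_lt_one : (√2)⁻¹ < (1 : ℝ) :=
  inv_lt_one_of_one_lt₀ (by rw [Real.lt_sqrt] <;> norm_num)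

/-- The constant `1 / (1 - 1/√2)` of the geometric series of ratio `1/√2`. -/
def geomConst : ℝ := (1 - (√2)⁻¹)⁻¹

lemma geomConst_nonneg : 0 ≤ geomConst := by
  have := inv_sqrt_two_lt_one
  exact inv_nonneg.2 (by linarith)

lemma sum_inv_sqrt_two_pow_le (s : Finset ℕ) {x : ℝ} (hx : 0 ≤ x) (h : ∀ k ∈ s, x ≤ √2 ^ k) :
    ∑ k ∈ s, x * (√2)⁻¹ ^ k ≤ geomConst := by
  rcases s.eq_empty_or_nonempty with rfl | hs
  · simpa using geomConst_nonneg
  rw [← Finset.mul_sum]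
  have h1 : ∑ k ∈ s, (√2)⁻¹ ^ k ≤ (√2)⁻¹ ^ (s.min' hs) * geomConst := by
    calc ∑ k ∈ s, (√2)⁻¹ ^ k ≤ ∑ k ∈ Finset.Ico (s.min' hs) (s.max' hs + 1), (√2)⁻¹ ^ k :=
          Finset.sum_le_sum_of_subset_of_nonneg (fun k hk => Finset.mem_Ico.2
            ⟨s.min'_le k hk, Nat.lt_succ_of_le (s.le_max' k hk)⟩) fun _ _ _ => by positivity
      _ ≤ _ := geom_sum_Ico_le_of_lt_one (by positivity) inv_sqrt_two_lt_one
  calc x * ∑ k ∈ s, (√2)⁻¹ ^ k ≤ x * ((√2)⁻¹ ^ (s.min' hs) * geomConst) := by gcongr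
    _ = x / √2 ^ (s.min' hs) * geomConst := by rw [inv_pow]; ring
    _ ≤ 1 * geomConst := by
        have := geomConst_nonneg
        gcongr
        exact (div_le_one (by positivity)).2 (h _ (s.min'_mem hs))
    _ = _ := one_mul _

section

variable {d : ℕ} {H : Type*} [NormedAddCommGroup H] [InnerProductSpace ℂ H]
  {v : ℕ × (Fin d → ℤ) → H} {C : ℝ}

lemma HasDecay.norm_sum_slice_sq_le (hv : HasDecay v C) (hC : 0 ≤ C)
    (E : Finset (ℕ × (Fin d → ℤ))) (n : ℕ) :
    ‖∑ e ∈ E with e.1 = n, v e‖ ^ 2 ≤ C * latticeConst ^ d * (E.filter (·.1 = n)).card := by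
  set F := E.filter (·.1 = n) with hF
  refine (norm_sum_sq_le_sum_sum_norm_inner F v).trans ?_
  have key : ∀ e ∈ F, ∑ e' ∈ F, ‖(inner ℂ (v e') (v e) : ℂ)‖ ≤ C * latticeConst ^ d := by
    intro e he
    have he1 := (Finset.mem_filter.1 he).2
    calc ∑ e' ∈ F, ‖(inner ℂ (v e') (v e) : ℂ)‖
        ≤ ∑ e' ∈ F, C * ∏ i, (1 + |(e'.2 i : ℝ) - e.2 i|)⁻¹ ^ 2 := by
          refine Finset.sum_le_sum fun e' he' => (hv e e').trans_eq ?_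
          simp [he1, (Finset.mem_filter.1 he').2, abs_sub_comm (e.2 _ : ℝ)]
      _ = C * ∑ w ∈ F.image Prod.snd, ∏ i, (1 + |(w i : ℝ) - e.2 i|)⁻¹ ^ 2 := by
          rw [← Finset.mul_sum, Finset.sum_image]
          intro x hx y hy hxy
          exact Prod.ext ((Finset.mem_filter.1 hx).2.trans (Finset.mem_filter.1 hy).2.symm) hxy
      _ ≤ _ := by gcongr; exact sum_prod_inv_sq_le _ _
  calc _ ≤ ∑ e ∈ F, C * latticeConst ^ d := Finset.sum_le_sum key
    _ = _ := by rw [Finset.sum_const, nsmul_eq_mul, mul_comm]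

lemma HasDecay.sum_far_le (hd : 4 ≤ d) (hv : HasDecay v C) (hC : 0 ≤ C) {j : ℕ}
    {E : Finset (ℕ × (Fin d → ℤ))} (hE : ∀ e ∈ E, 2 ^ j ≤ e.1 ∧ e.1 < 2 ^ (j + 1)) {ρ : ℝ}
    (hρ : 1 ≤ ρ) (h : CellBound E j (√ρ ^ (d - 1))) {e : ℕ × (Fin d → ℤ)} (he : e ∈ E) :
    ∑ e' ∈ E with ¬ |(e.1 : ℝ) - e'.1| ≤ ρ, ‖(inner ℂ (v e') (v e) : ℂ)‖ ≤
      C * √2 ^ (d - 1) * (3 * (4 * latticeConst) ^ d) * geomConst * ρ := by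
  have hL := latticeConst_nonneg
  set δ : ℕ × (Fin d → ℤ) → ℕ := fun e' => ((e.1 : ℤ) - e'.1).natAbs with hδ
  have hδ' : ∀ e', (δ e' : ℝ) = |(e.1 : ℝ) - e'.1| := by
    intro e'; rw [hδ, Nat.cast_natAbs]; push_cast; rfl
  set F := E.filter fun e' => ¬ |(e.1 : ℝ) - e'.1| ≤ ρ with hF
  set κ : ℕ × (Fin d → ℤ) → ℕ := fun e' => Nat.log 2 (δ e') + 1 with hκ
  have hδ0 : ∀ e' ∈ F, ρ < δ e' := fun e' he' => by
    rw [hδ']; exact not_le.1 (Finset.mem_filter.1 he').2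
  have hκ1 : ∀ e' ∈ F, 2 ^ κ e' ≤ 2 * δ e' := fun e' he' => by
    have h1 : δ e' ≠ 0 := by
      intro h0
      have := hδ0 e' he'
      rw [h0] at this; norm_num at this; linarith
    rw [hκ, pow_succ']
    exact Nat.mul_le_mul_left 2 (Nat.pow_log_le_self 2 h1)
  have hκ2 : ∀ e', δ e' < 2 ^ κ e' := fun e' => Nat.lt_pow_succ_log_self (by norm_num) _
  set S := (Finset.Icc 1 j).filter fun K => ρ ≤ 2 ^ K with hS
  have hmaps : ∀ e' ∈ F, κ e' ∈ S := by
    intro e' he'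
    have h2 : (δ e' : ℝ) < 2 ^ κ e' := by exact_mod_cast hκ2 e'
    rw [hS, Finset.mem_filter, Finset.mem_Icc]
    refine ⟨⟨by simp [hκ], ?_⟩, (hδ0 e' he').le.trans h2.le⟩
    have h3 := hE _ he
    have h4 := hE _ (Finset.mem_filter.1 he').1
    have h5 : δ e' < 2 ^ j := by
      rw [pow_succ] at h3 h4
      simp only [hδ]; omega
    have h6 := hκ1 e' he'
    have h7 : 2 ^ κ e' < 2 ^ (j + 1) := by rw [pow_succ 2 j]; omega
    have := (Nat.pow_lt_pow_iff_right (by norm_num : 1 < 2)).1 h7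
    omega
  rw [← Finset.sum_fiberwise_of_maps_to hmaps]
  have key : ∀ K ∈ S, ∑ e' ∈ F with κ e' = K, ‖(inner ℂ (v e') (v e) : ℂ)‖ ≤
      C * √2 ^ (d - 1) * (3 * (4 * latticeConst) ^ d) * ρ * (√ρ * (√2)⁻¹ ^ K) := by
    intro K hK
    rw [hS, Finset.mem_filter, Finset.mem_Icc] at hK
    obtain ⟨⟨hK1, hK2⟩, hK3⟩ := hK
    set q : ℝ := (√2)⁻¹ ^ K with hq
    have hq0 : 0 < q := by positivity
    have hq2 : q ^ 2 * 2 ^ K = 1 := by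
      rw [hq, ← pow_mul, mul_comm K 2, pow_mul, ← mul_pow, inv_pow, Real.sq_sqrt (by norm_num)]
      norm_num
    have hx1 : √ρ * q ≤ 1 := by
      rw [← Real.sqrt_sq hq0.le, ← Real.sqrt_mul (by linarith)]
      rw [Real.sqrt_le_one]
      calc ρ * q ^ 2 ≤ 2 ^ K * q ^ 2 := by gcongr
        _ = 1 := by rw [mul_comm]; exact hq2
    have h1 : ∀ e' ∈ F.filter (κ · = K), ‖(inner ℂ (v e') (v e) : ℂ)‖ ≤
        C * (√2 * q) ^ (d - 1) * ∏ i, (1 + |(e.2 i : ℝ) - e'.2 i| / 2 ^ K)⁻¹ ^ 2 := by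
      intro e' he'
      obtain ⟨he1, he2⟩ := Finset.mem_filter.1 he'
      have h2 : 1 + |(e.1 : ℝ) - e'.1| ≤ 2 ^ K := by
        rw [← hδ', ← he2]
        have := hκ2 e'
        have h3 : 1 + δ e' ≤ 2 ^ κ e' := by omega
        exact_mod_cast h3
      have h3 : (2 : ℝ) ^ K ≤ 2 * (1 + |(e.1 : ℝ) - e'.1|) := by
        rw [← hδ', ← he2]
        have h3 : 2 ^ κ e' ≤ 2 * (1 + δ e') := by have := hκ1 e' he1; omega
        exact_mod_cast h3
      have h4 : (√(1 + |(e.1 : ℝ) - e'.1|))⁻¹ ≤ √2 * q := by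
        rw [← Real.sqrt_inv, ← Real.sqrt_sq hq0.le, ← Real.sqrt_mul (by norm_num)]
        apply Real.sqrt_le_sqrt
        rw [inv_le_iff_one_le_mul₀ (by positivity)]
        nlinarith [sq_nonneg q]
      refine (hv e e').trans ?_
      refine mul_le_mul (by gcongr) (Finset.prod_le_prod (fun _ _ => by positivity) fun i _ => ?_)
        (Finset.prod_nonneg fun _ _ => by positivity) (by positivity)
      gcongr
    calc ∑ e' ∈ F with κ e' = K, ‖(inner ℂ (v e') (v e) : ℂ)‖
        ≤ ∑ e' ∈ F with κ e' = K, C * (√2 * q) ^ (d - 1) *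
            ∏ i, (1 + |(e.2 i : ℝ) - e'.2 i| / 2 ^ K)⁻¹ ^ 2 := Finset.sum_le_sum h1
      _ ≤ ∑ e' ∈ E with |(e.1 : ℝ) - e'.1| + 1 ≤ 2 ^ K, C * (√2 * q) ^ (d - 1) *
            ∏ i, (1 + |(e.2 i : ℝ) - e'.2 i| / 2 ^ K)⁻¹ ^ 2 := by
          refine Finset.sum_le_sum_of_subset_of_nonneg (fun e' he' => ?_) fun e' _ _ =>
            mul_nonneg (by positivity) (Finset.prod_nonneg fun _ _ => by positivity)
          obtain ⟨he1, he2⟩ := Finset.mem_filter.1 he'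
          rw [Finset.mem_filter]
          refine ⟨(Finset.mem_filter.1 he1).1, ?_⟩
          rw [← hδ', ← he2]
          exact_mod_cast hκ2 e'
      _ ≤ C * (√2 * q) ^ (d - 1) * (3 * (4 * latticeConst) ^ d * √ρ ^ (d - 1) * 2 ^ K) := by
          rw [← Finset.mul_sum]
          gcongr
          exact h.sum_shell_le (by positivity) hK1 hK2 e
      _ = C * √2 ^ (d - 1) * (3 * (4 * latticeConst) ^ d) * ((√ρ * q) ^ (d - 1) * 2 ^ K) := by
          rw [mul_pow, mul_pow]; ring
      _ ≤ C * √2 ^ (d - 1) * (3 * (4 * latticeConst) ^ d) * ((√ρ * q) ^ 3 * 2 ^ K) := by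
          gcongr ?_ * (?_ * _)
          exact pow_le_pow_of_le_one (by positivity) hx1 (by omega)
      _ = C * √2 ^ (d - 1) * (3 * (4 * latticeConst) ^ d) *
            (√ρ ^ 2 * (√ρ * q) * (q ^ 2 * 2 ^ K)) := by ring
      _ = _ := by rw [hq2, Real.sq_sqrt (by linarith)]; ring
  refine (Finset.sum_le_sum key).trans ?_
  rw [← Finset.mul_sum]
  have h8 := sum_inv_sqrt_two_pow_le S (Real.sqrt_nonneg ρ) fun K hK => by
    rw [← Real.sqrt_sq (by positivity : 0 ≤ √2 ^ K), ← pow_mul, mul_comm K 2, pow_mul,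
      Real.sq_sqrt (by norm_num)]
    exact Real.sqrt_le_sqrt (Finset.mem_filter.1 hK).2
  calc _ ≤ C * √2 ^ (d - 1) * (3 * (4 * latticeConst) ^ d) * ρ * geomConst := by gcongr
    _ = _ := by ring

lemma HasDecay.norm_sum_sq_le (hd : 4 ≤ d) (hv : HasDecay v C) (hC : 0 ≤ C) {j : ℕ}
    {E : Finset (ℕ × (Fin d → ℤ))} (hE : ∀ e ∈ E, 2 ^ j ≤ e.1 ∧ e.1 < 2 ^ (j + 1)) {ρ : ℝ}
    (hρ : 1 ≤ ρ) (h : CellBound E j (√ρ ^ (d - 1))) :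
    ‖∑ e ∈ E, v e‖ ^ 2 ≤ C * (3 * latticeConst ^ d +
      √2 ^ (d - 1) * (3 * (4 * latticeConst) ^ d) * geomConst) * ρ * E.card := by
  set s := E.image Prod.fst with hs
  set V : ℕ → H := fun n => ∑ e ∈ E with e.1 = n, v e with hV
  have hmaps : ∀ e ∈ E, e.1 ∈ s := fun e he => Finset.mem_image_of_mem _ he
  have hsum : ∑ e ∈ E, v e = ∑ n ∈ s, V n := (Finset.sum_fiberwise_of_maps_to hmaps v).symm
  have hcard : ∑ n ∈ s, ((E.filter (·.1 = n)).card : ℝ) = E.card := by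
    rw [← Nat.cast_sum, ← Finset.card_eq_sum_card_fiberwise hmaps]
  rw [hsum]
  refine (norm_sum_sq_le_near_add_far s V (r := fun n n' => |(n : ℝ) - n'| ≤ ρ)
    (fun n n' hn => by rwa [abs_sub_comm]) (D := 3 * ρ) fun n _ => ?_).trans ?_
  · have hsub : (s.filter fun n' : ℕ => |(n : ℝ) - n'| ≤ ρ) ⊆
        Finset.Icc (n - ⌊ρ⌋₊) (n + ⌊ρ⌋₊) := by
      intro n' hn'
      have h1 := (Finset.mem_filter.1 hn').2
      have h2 : ((n : ℤ) - n').natAbs ≤ ⌊ρ⌋₊ := by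
        apply Nat.le_floor
        rw [Nat.cast_natAbs]; push_cast; exact h1
      rw [Finset.mem_Icc]; omega
    have h1 := Finset.card_le_card hsub
    rw [Nat.card_Icc] at h1
    have h2 : (s.filter fun n' : ℕ => |(n : ℝ) - n'| ≤ ρ).card ≤ 2 * ⌊ρ⌋₊ + 1 := by omega
    have h3 : ((s.filter fun n' : ℕ => |(n : ℝ) - n'| ≤ ρ).card : ℝ) ≤ 2 * ⌊ρ⌋₊ + 1 := by
      exact_mod_cast h2
    have h4 := Nat.floor_le (by linarith : 0 ≤ ρ)
    linarith
  have hnear : ∑ n ∈ s, ‖V n‖ ^ 2 ≤ C * latticeConst ^ d * E.card := by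
    rw [← hcard, Finset.mul_sum]
    exact Finset.sum_le_sum fun n _ => hv.norm_sum_slice_sq_le hC E n
  have hfar : ∑ n ∈ s, ∑ n' ∈ s with ¬ |(n : ℝ) - (n' : ℕ)| ≤ ρ, ‖(inner ℂ (V n') (V n) : ℂ)‖ ≤
      ∑ e ∈ E, ∑ e' ∈ E with ¬ |(e.1 : ℝ) - e'.1| ≤ ρ, ‖(inner ℂ (v e') (v e) : ℂ)‖ := by
    rw [← Finset.sum_fiberwise_of_maps_to hmaps]
    refine Finset.sum_le_sum fun n _ => ?_
    calc ∑ n' ∈ s with ¬ |(n : ℝ) - (n' : ℕ)| ≤ ρ, ‖(inner ℂ (V n') (V n) : ℂ)‖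
        ≤ ∑ n' ∈ s with ¬ |(n : ℝ) - (n' : ℕ)| ≤ ρ, ∑ e ∈ E with e.1 = n, ∑ e' ∈ E with e'.1 = n',
            ‖(inner ℂ (v e') (v e) : ℂ)‖ :=
          Finset.sum_le_sum fun n' _ => norm_inner_sum_sum_le _ _ _ _
      _ = ∑ e ∈ E with e.1 = n, ∑ n' ∈ s with ¬ |(n : ℝ) - (n' : ℕ)| ≤ ρ, ∑ e' ∈ E with e'.1 = n',
            ‖(inner ℂ (v e') (v e) : ℂ)‖ := Finset.sum_comm
      _ = _ := by
          refine Finset.sum_congr rfl fun e he => ?_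
          rw [(Finset.mem_filter.1 he).2, Finset.sum_filter, Finset.sum_filter,
            ← Finset.sum_fiberwise_of_maps_to hmaps]
          refine Finset.sum_congr rfl fun n' _ => ?_
          refine Eq.trans ?_ (Finset.sum_congr rfl (f := fun e' => if ¬ |(n : ℝ) - n'| ≤ ρ then
            ‖(inner ℂ (v e') (v e) : ℂ)‖ else 0) fun e' he' => by rw [(Finset.mem_filter.1 he').2])
          split_ifs <;> simp
  calc _ ≤ 3 * ρ * (C * latticeConst ^ d * E.card) + ∑ e ∈ E, C * √2 ^ (d - 1) *
        (3 * (4 * latticeConst) ^ d) * geomConst * ρ := by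
        refine add_le_add (by gcongr) (hfar.trans (Finset.sum_le_sum fun e he =>
          hv.sum_far_le hd hC hE hρ h he))
    _ = _ := by rw [Finset.sum_const, nsmul_eq_mul]; ring

end

section

variable {d : ℕ} {H : Type*} [NormedAddCommGroup H] [InnerProductSpace ℂ H]
  {v : ℕ × (Fin d → ℤ) → H} {C : ℝ} {E : ℕ → Finset (ℕ × (Fin d → ℤ))}

/-- The sum of the vectors attached to `E_j`, with the weight `2^{j(d-1)/2}`. -/
def scaleSum (v : ℕ × (Fin d → ℤ) → H) (E : ℕ → Finset (ℕ × (Fin d → ℤ))) (j : ℕ) : H :=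
  (((√2 ^ (d - 1)) ^ j : ℝ) : ℂ) • ∑ e ∈ E j, v e

lemma sqrt_two_pow_sq (n j : ℕ) : ((√2 ^ n) ^ j : ℝ) ^ 2 = (2 ^ n) ^ j := by
  rw [← pow_mul, ← pow_mul, ← pow_mul, ← mul_assoc, mul_comm (n * j) 2, pow_mul,
    Real.sq_sqrt (by norm_num)]

lemma HasDecay.norm_scaleSum_sq_le (hd : 4 ≤ d) (hv : HasDecay v C) (hC : 0 ≤ C) {j : ℕ}
    (hE : ∀ e ∈ E j, 2 ^ j ≤ e.1 ∧ e.1 < 2 ^ (j + 1)) {ρ : ℝ}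
    (hρ : 1 ≤ ρ) (h : CellBound (E j) j (√ρ ^ (d - 1))) :
    ‖scaleSum v E j‖ ^ 2 ≤ C * (3 * latticeConst ^ d +
      √2 ^ (d - 1) * (3 * (4 * latticeConst) ^ d) * geomConst) * ρ *
        ((2 ^ (d - 1)) ^ j * (E j).card) := by
  rw [scaleSum, norm_smul, Complex.norm_real, Real.norm_of_nonneg (by positivity), mul_pow,
    sqrt_two_pow_sq]
  have := hv.norm_sum_sq_le hd hC hE hρ h
  calc _ ≤ (2 ^ (d - 1)) ^ j * (C * (3 * latticeConst ^ d +
      √2 ^ (d - 1) * (3 * (4 * latticeConst) ^ d) * geomConst) * ρ * (E j).card) := by gcongr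
    _ = _ := by ring

lemma HasScaleDecay.norm_inner_scaleSum_le (hd : 4 ≤ d) (hv : HasScaleDecay v C) (hC : 0 ≤ C)
    {Λ : ℝ} (hΛ : 0 ≤ Λ) {j k : ℕ} (hk : 1 ≤ k) (hkj : k + 2 ≤ j)
    (hj : ∀ e ∈ E j, 2 ^ j ≤ e.1 ∧ e.1 < 2 ^ (j + 1))
    (hk' : ∀ e ∈ E k, 2 ^ k ≤ e.1 ∧ e.1 < 2 ^ (k + 1)) (h : CellBound (E k) k Λ) :
    ‖(inner ℂ (scaleSum v E k) (scaleSum v E j) : ℂ)‖ ≤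
      C * 3 ^ d * (Λ * (√2)⁻¹ ^ k) * ((2 ^ (d - 1)) ^ j * (E j).card) := by
  have h1 : ∀ e ∈ E j, ∑ e' ∈ E k, ‖(inner ℂ (v e') (v e) : ℂ)‖ ≤
      C * (3 ^ d * Λ * 2 ^ k) * (√2 ^ (d - 1)) ^ j / (2 ^ (d - 1)) ^ k := fun e he =>
    hv j k e (E k) _ hkj (hj e he).1 (hj e he).2 (fun e' he' => (hk' e' he').2)
      (h.card_ball_le hk hk')
  have h2 : 2 * (√2 : ℝ) ^ (d - 1) / 2 ^ (d - 1) ≤ (√2)⁻¹ := by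
    have e2 : (√2 : ℝ) ^ 2 = 2 := Real.sq_sqrt (by norm_num)
    have e3 : (2 : ℝ) ^ (d - 1) = √2 ^ (d - 1) * √2 ^ (d - 1) := by
      rw [← mul_pow, ← sq, e2]
    have h3 : (√2 : ℝ) ^ 3 ≤ √2 ^ (d - 1) :=
      pow_le_pow_right₀ (by rw [Real.one_le_sqrt]; norm_num) (by omega)
    have h4 : (0 : ℝ) < √2 := by positivity
    rw [e3, inv_eq_one_div, div_le_div_iff₀ (by positivity) (by positivity)]
    have h5 : 2 * √2 ≤ (√2 : ℝ) ^ (d - 1) := by rw [← e2] at *; nlinarith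
    have h6 : (0 : ℝ) < √2 ^ (d - 1) := by positivity
    nlinarith
  rw [scaleSum, scaleSum, inner_smul_left, inner_smul_right, norm_mul, norm_mul, RCLike.norm_conj,
    Complex.norm_real, Complex.norm_real, Real.norm_of_nonneg (by positivity),
    Real.norm_of_nonneg (by positivity)]
  calc _ ≤ (√2 ^ (d - 1)) ^ k * ((√2 ^ (d - 1)) ^ j * ∑ e ∈ E j,
        C * (3 ^ d * Λ * 2 ^ k) * (√2 ^ (d - 1)) ^ j / (2 ^ (d - 1)) ^ k) := by
        gcongr
        exact (norm_inner_sum_sum_le _ _ _ _).trans (Finset.sum_le_sum h1)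
    _ = C * 3 ^ d * (Λ * (2 * √2 ^ (d - 1) / 2 ^ (d - 1)) ^ k) *
          (((√2 ^ (d - 1)) ^ j) ^ 2 * (E j).card) := by
        rw [Finset.sum_const, nsmul_eq_mul, div_pow, mul_pow]; ring
    _ ≤ _ := by
        rw [sqrt_two_pow_sq]
        gcongr

lemma norm_sum_sq_le_of_scales (W : ℕ → H) (J : Finset ℕ) (hJ : ∀ j ∈ J, 1 ≤ j) (N : ℕ)
    {B D : ℝ} (hB : ∀ s ⊆ J, ∑ j ∈ s, ‖W j‖ ^ 2 ≤ B)
    (hD : ∑ j ∈ J with ¬ j ≤ N, ∑ k ∈ J.filter (¬ · ≤ N) with k + 2 ≤ j,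
      ‖(inner ℂ (W k) (W j) : ℂ)‖ ≤ D) :
    ‖∑ j ∈ J, W j‖ ^ 2 ≤ (2 * N + 6) * B + 4 * D := by
  set J₁ := J.filter (· ≤ N) with hJ₁
  set J₂ := J.filter (¬ · ≤ N) with hJ₂
  have hlow : ‖∑ j ∈ J₁, W j‖ ^ 2 ≤ N * B := by
    have := norm_sum_sq_le_near_add_far J₁ W (r := fun _ _ => True) (by simp)
      (D := N) fun j _ => by
        have h1 : J₁.filter (fun _ => True) ⊆ Finset.Icc 1 N := by
          intro k hk
          have h2 := Finset.mem_filter.1 (Finset.mem_filter.1 hk).1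
          exact Finset.mem_Icc.2 ⟨hJ k h2.1, h2.2⟩
        have h2 := Finset.card_le_card h1
        rw [Nat.card_Icc, Nat.add_sub_cancel] at h2
        refine le_trans (le_of_eq ?_) (Nat.cast_le (α := ℝ).2 h2)
        congr
    refine this.trans ?_
    simp only [not_true_eq_false, Finset.filter_false, Finset.sum_empty, Finset.sum_const_zero,
      add_zero]
    exact mul_le_mul_of_nonneg_left (hB _ (Finset.filter_subset _ _)) (Nat.cast_nonneg _)
  have hhigh : ‖∑ j ∈ J₂, W j‖ ^ 2 ≤ 3 * B + 2 * D := by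
    refine (norm_sum_sq_le_near_add_far J₂ W
      (r := fun j k => k < j + 2 ∧ j < k + 2) (fun _ _ hjk => hjk.symm) (D := 3)
      fun j _ => ?_).trans (add_le_add
        (mul_le_mul_of_nonneg_left (hB _ (Finset.filter_subset _ _)) (by norm_num)) ?_)
    · have h1 : J₂.filter (fun k => k < j + 2 ∧ j < k + 2) ⊆ Finset.Icc (j - 1) (j + 1) := by
        intro k hk
        have h2 := (Finset.mem_filter.1 hk).2
        rw [Finset.mem_Icc]; omega
      have h2 := Finset.card_le_card h1
      rw [Nat.card_Icc] at h2
      have h3 : (J₂.filter fun k => k < j + 2 ∧ j < k + 2).card ≤ 3 := h2.trans (by omega)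
      refine le_trans (le_of_eq ?_) (Nat.cast_le_ofNat (α := ℝ).2 h3)
      congr
    · have hsymm : ∑ j ∈ J₂, ∑ k ∈ J₂ with j + 2 ≤ k, ‖(inner ℂ (W k) (W j) : ℂ)‖ =
          ∑ j ∈ J₂, ∑ k ∈ J₂ with k + 2 ≤ j, ‖(inner ℂ (W k) (W j) : ℂ)‖ := by
        simp_rw [Finset.sum_filter]
        rw [Finset.sum_comm]
        refine Finset.sum_congr rfl fun j _ => Finset.sum_congr rfl fun k _ => ?_
        rw [norm_inner_symm]
      rw [two_mul]
      refine le_trans ?_ (add_le_add hD (hsymm.trans_le hD))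
      rw [← Finset.sum_add_distrib]
      refine Finset.sum_le_sum fun j _ => ?_
      simp_rw [Finset.sum_filter]
      rw [← Finset.sum_add_distrib]
      refine Finset.sum_le_sum fun k _ => ?_
      have := norm_nonneg (inner ℂ (W k) (W j) : ℂ)
      split_ifs <;> first | omega | linarith
  rw [← Finset.sum_filter_add_sum_filter_not J (· ≤ N)]
  have h1 := norm_add_le (∑ j ∈ J₁, W j) (∑ j ∈ J₂, W j)
  have h2 := pow_le_pow_left₀ (norm_nonneg _) h1 2
  nlinarith [sq_nonneg (‖∑ j ∈ J₁, W j‖ - ‖∑ j ∈ J₂, W j‖)]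

lemma norm_sum_scaleSum_sq_le {C' : ℝ} (hd : 4 ≤ d) (hv : HasDecay v C) (hC : 0 ≤ C)
    (hv' : HasScaleDecay v C') (hC' : 0 ≤ C') {J : Finset ℕ} (hJ : ∀ j ∈ J, 1 ≤ j)
    (hE : ∀ j ∈ J, ∀ e ∈ E j, 2 ^ j ≤ e.1 ∧ e.1 < 2 ^ (j + 1)) {ρ : ℝ} (hρ : 1 ≤ ρ)
    (h : ∀ j ∈ J, CellBound (E j) j (√ρ ^ (d - 1))) {N : ℕ} (hN : √ρ ^ (d - 1) ≤ √2 ^ N) :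
    ‖∑ j ∈ J, scaleSum v E j‖ ^ 2 ≤ (6 * (C * (3 * latticeConst ^ d +
      √2 ^ (d - 1) * (3 * (4 * latticeConst) ^ d) * geomConst)) + 4 * (C' * 3 ^ d * geomConst)) *
        (N + 1) * ρ * ∑ j ∈ J, (2 ^ (d - 1)) ^ j * ((E j).card : ℝ) := by
  have hL := latticeConst_nonneg
  have hg := geomConst_nonneg
  obtain ⟨B, hB⟩ : ∃ B : ℝ, B = C * (3 * latticeConst ^ d +
      √2 ^ (d - 1) * (3 * (4 * latticeConst) ^ d) * geomConst) := ⟨_, rfl⟩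
  obtain ⟨D, hD⟩ : ∃ D : ℝ, D = C' * 3 ^ d * geomConst := ⟨_, rfl⟩
  obtain ⟨x, hx⟩ : ∃ x : ℕ → ℝ, x = fun j => (2 ^ (d - 1)) ^ j * ((E j).card : ℝ) := ⟨_, rfl⟩
  have hx0 : ∀ j, 0 ≤ x j := fun j => by rw [hx]; positivity
  have hB0 : 0 ≤ B := by rw [hB]; positivity
  have hD0 : 0 ≤ D := by rw [hD]; positivity
  have hsub : ∀ s ⊆ J, ∑ j ∈ s, x j ≤ ∑ j ∈ J, x j := fun s hs =>
    Finset.sum_le_sum_of_subset_of_nonneg hs fun j _ _ => hx0 j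
  have hX0 : 0 ≤ ∑ j ∈ J, x j := Finset.sum_nonneg fun j _ => hx0 j
  have hsq : ∀ s ⊆ J, ∑ j ∈ s, ‖scaleSum v E j‖ ^ 2 ≤ B * ρ * ∑ j ∈ J, x j := by
    intro s hs
    calc _ ≤ ∑ j ∈ s, B * ρ * x j := Finset.sum_le_sum fun j hj => by
          rw [hB, hx]
          exact hv.norm_scaleSum_sq_le hd hC (hE j (hs hj)) hρ (h j (hs hj))
      _ = B * ρ * ∑ j ∈ s, x j := (Finset.mul_sum _ _ _).symm
      _ ≤ _ := mul_le_mul_of_nonneg_left (hsub s hs) (by positivity)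
  have hcross : ∑ j ∈ J with ¬ j ≤ N, ∑ k ∈ J.filter (¬ · ≤ N) with k + 2 ≤ j,
      ‖(inner ℂ (scaleSum v E k) (scaleSum v E j) : ℂ)‖ ≤ D * ∑ j ∈ J, x j := by
    calc _ ≤ ∑ j ∈ J with ¬ j ≤ N, ∑ k ∈ J.filter (¬ · ≤ N) with k + 2 ≤ j,
          C' * 3 ^ d * (√ρ ^ (d - 1) * (√2)⁻¹ ^ k) * x j := by
          refine Finset.sum_le_sum fun j hj => Finset.sum_le_sum fun k hk => ?_
          obtain ⟨h1, h2⟩ := Finset.mem_filter.1 hk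
          have h3 := (Finset.mem_filter.1 h1).1
          have h4 := (Finset.mem_filter.1 hj).1
          rw [hx]
          exact hv'.norm_inner_scaleSum_le hd hC' (by positivity) (hJ k h3) h2 (hE j h4) (hE k h3)
            (h k h3)
      _ ≤ ∑ j ∈ J with ¬ j ≤ N, D * x j := by
          refine Finset.sum_le_sum fun j hj => ?_
          rw [← Finset.sum_mul, ← Finset.mul_sum, hD]
          refine mul_le_mul_of_nonneg_right (mul_le_mul_of_nonneg_left ?_ (by positivity)) (hx0 j)
          refine sum_inv_sqrt_two_pow_le _ (by positivity) fun k hk => hN.trans ?_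
          have h2 := (Finset.mem_filter.1 (Finset.mem_filter.1 hk).1).2
          exact pow_le_pow_right₀ (by rw [Real.one_le_sqrt]; norm_num) (by omega)
      _ = D * ∑ j ∈ J with ¬ j ≤ N, x j := (Finset.mul_sum _ _ _).symm
      _ ≤ _ := mul_le_mul_of_nonneg_left (hsub _ (Finset.filter_subset _ _)) hD0
  refine (norm_sum_sq_le_of_scales _ J hJ N hsq hcross).trans ?_
  have hX : ∑ j ∈ J, (2 ^ (d - 1)) ^ j * ((E j).card : ℝ) = ∑ j ∈ J, x j := by rw [hx]
  rw [hX, ← hB, ← hD]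
  have hN0 : (0 : ℝ) ≤ N := Nat.cast_nonneg _
  have h1 : D ≤ D * (N + 1) * ρ := by
    rw [mul_assoc]
    exact le_mul_of_one_le_right hD0 (by nlinarith)
  have h2 : 0 ≤ N * B * ρ := by positivity
  calc (2 * N + 6) * (B * ρ * ∑ j ∈ J, x j) + 4 * (D * ∑ j ∈ J, x j)
      = ((2 * N + 6) * B * ρ + 4 * D) * ∑ j ∈ J, x j := by ring
    _ ≤ ((6 * B + 4 * D) * (N + 1) * ρ) * ∑ j ∈ J, x j :=
        mul_le_mul_of_nonneg_right (by nlinarith) hX0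

end

/-- the key `L²` estimate (Lemma 2.2): under the density hypothesis
`#(E_j ∩ Q) ≤ λ^p l(Q)` for all `Q ∈ D_j`,
`‖∑_{j≥1} 2^{j(d-1)/2} ∑_{(n,z)∈E_j} B_{n,z}‖₂² ≲ λ^{2p/(d-1)} log₂ λ ∑_{j≥1} 2^{j(d-1)} #E_j`. -/
theorem statement9 (d : ℕ) (hd : 4 ≤ d) (a : Rd d → ℝ) (ha : IsDistFn a)
    (hcurv : CurvNondeg a) (η : ℝ → ℝ) (hη : IsBump η)
    (p : ℝ) (hp1 : 1 < p) (hp2 : p ≤ 2) :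
    ∃ C : ℝ, 0 < C ∧ ∀ lam : ℝ, 2 ≤ lam →
      ∀ E : ℕ → Finset (ℕ × (Fin d → ℤ)), E 0 = ∅ →
      (∀ j : ℕ, ∀ e ∈ E j, (2 : ℝ) ^ j ≤ (e.1 : ℝ) ∧ (e.1 : ℝ) < 2 ^ (j + 1)) →
      (∀ j : ℕ, ∀ Q : DyCube d j,
        (cubeCount ((E j).image (embedPt d)) Q : ℝ) ≤ lam ^ p * Q.len) →
      ∀ b : ℕ × (Fin d → ℤ) → Rd d → ℂ, (∀ e, IsNormalized e.2 (b e)) →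
      eLpNorm (fun x : Rd d =>
            ∑' j : ℕ, (((2 : ℝ) ^ (((j : ℝ) * ((d : ℝ) - 1)) / 2) : ℝ) : ℂ) *
              ∑ e ∈ E j, conv (Kker a η (e.1 : ℝ)) (b e) x) 2 volume ^ (2 : ℝ) ≤
        ENNReal.ofReal (C * lam ^ (2 * p / ((d : ℝ) - 1)) * Real.logb 2 lam) *
          ∑' j : ℕ, 2 ^ (j * (d - 1)) * ((E j).card : ℝ≥0∞) := by
  obtain ⟨n, rfl⟩ : ∃ n, d = n + 1 := ⟨d - 1, by omega⟩
  obtain ⟨C, hC, hdecay⟩ := exists_hasDecay ha hcurv hη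
  obtain ⟨C', hC', hscale⟩ := exists_hasScaleDecay ha hcurv hη
  have hL := latticeConst_nonneg
  have hg := geomConst_nonneg
  set A : ℝ := 6 * (C * (3 * latticeConst ^ (n + 1) + √2 ^ (n + 1 - 1) *
    (3 * (4 * latticeConst) ^ (n + 1)) * geomConst)) + 4 * (C' * 3 ^ (n + 1) * geomConst) with hA
  have hA0 : 0 ≤ A := by positivity
  refine ⟨6 * (A + 1), by positivity, fun lam hlam E hE0 hE hcube b hb => ?_⟩
  set ℓ := Real.logb 2 lam with hℓ
  have hℓ1 : 1 ≤ ℓ := by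
    rw [hℓ, Real.le_logb_iff_rpow_le (by norm_num) (by linarith)]; simpa using hlam
  have hlamℓ : lam = 2 ^ ℓ := (Real.rpow_logb (by norm_num) (by norm_num) (by linarith)).symm
  set ρ : ℝ := lam ^ (2 * p / (((n + 1 : ℕ) : ℝ) - 1)) with hρd
  have hn : ((n + 1 : ℕ) : ℝ) - 1 = n := by push_cast; ring
  have hn3 : (3 : ℝ) ≤ n := by exact_mod_cast (by omega : 3 ≤ n)
  have hρ1 : 1 ≤ ρ := Real.one_le_rpow (by linarith) (by rw [hn]; positivity)
  have hρΛ : √ρ ^ (n + 1 - 1) = lam ^ p := by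
    rw [Nat.add_sub_cancel, Real.sqrt_eq_rpow, ← Real.rpow_natCast, ← Real.rpow_mul (by linarith),
      hρd, ← Real.rpow_mul (by linarith), hn]
    congr 1
    field_simp
  by_cases htop : ∑' j : ℕ, 2 ^ (j * (n + 1 - 1)) * ((E j).card : ℝ≥0∞) = ⊤
  · rw [htop, ENNReal.mul_top]
    · exact le_top
    · rw [Ne, ENNReal.ofReal_eq_zero, not_le]; positivity
  have hfin : {j | (E j).Nonempty}.Finite := by
    refine (ENNReal.finite_const_le_of_tsum_ne_top htop one_ne_zero).subset fun j hj => ?_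
    have h1 : (1 : ℝ≥0∞) ≤ (E j).card := by exact_mod_cast Finset.card_pos.2 hj
    exact one_le_mul (one_le_pow₀ (by norm_num)) h1
  set J := hfin.toFinset with hJ
  have hJE : ∀ j ∉ J, E j = ∅ := fun j hj => by simpa [hJ] using hj
  set v : ℕ × (Fin (n + 1) → ℤ) → Lp ℂ 2 (volume : Measure (Rd (n + 1))) :=
    fun e => (convSpectrum ha hη e.1 (hb e)).toLp 2 with hv
  have hE' : ∀ j, ∀ e ∈ E j, 2 ^ j ≤ e.1 ∧ e.1 < 2 ^ (j + 1) := fun j e he => by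
    exact_mod_cast hE j e he
  have hweight : ∀ j : ℕ, (2 : ℝ) ^ (((j : ℝ) * (((n + 1 : ℕ) : ℝ) - 1)) / 2) =
      (√2 ^ (n + 1 - 1)) ^ j := by
    intro j
    rw [Nat.add_sub_cancel, hn, ← pow_mul, Real.sqrt_eq_rpow, ← Real.rpow_natCast,
      ← Real.rpow_mul (by norm_num)]
    congr 1
    push_cast; ring
  have hfun : (fun x : Rd (n + 1) =>
      ∑' j : ℕ, (((2 : ℝ) ^ (((j : ℝ) * (((n + 1 : ℕ) : ℝ) - 1)) / 2) : ℝ) : ℂ) *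
        ∑ e ∈ E j, conv (Kker a η (e.1 : ℝ)) (b e) x) =
      fun x => ∑ q ∈ J.sigma E, (((√2 ^ (n + 1 - 1)) ^ q.1 : ℝ) : ℂ) *
        conv (Kker a η (q.2.1 : ℝ)) (b q.2) x := by
    ext x
    rw [tsum_eq_sum (s := J) fun j hj => by rw [hJE j hj]; simp, Finset.sum_sigma]
    exact Finset.sum_congr rfl fun j _ => by rw [hweight, Finset.mul_sum]
  rw [hfun, eLpNorm_sum_conv_Kker ha hη (J.sigma E) (fun q => (((√2 ^ (n + 1 - 1)) ^ q.1 : ℝ) : ℂ))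
    (fun q => (q.2.1 : ℝ)) (fun q => q.2.2) (fun q => b q.2) fun q => hb q.2, Finset.sum_sigma]
  have hW : ∑ j ∈ J, ∑ e ∈ E j, (((√2 ^ (n + 1 - 1)) ^ j : ℝ) : ℂ) •
      (convSpectrum ha hη (e.1 : ℝ) (hb e)).toLp 2 (volume : Measure (Rd (n + 1))) =
      ∑ j ∈ J, scaleSum v E j :=
    Finset.sum_congr rfl fun j _ => Finset.smul_sum.symm
  rw [hW]
  set N := ⌈4 * ℓ⌉₊ with hN
  have hNl : 4 * ℓ ≤ N := Nat.le_ceil _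
  have hNu : (N : ℝ) < 4 * ℓ + 1 := Nat.ceil_lt_add_one (by linarith)
  have hΛN : √ρ ^ (n + 1 - 1) ≤ √2 ^ N := by
    rw [hρΛ, hlamℓ, ← Real.rpow_mul (by norm_num), Real.sqrt_eq_rpow, ← Real.rpow_natCast,
      ← Real.rpow_mul (by norm_num)]
    exact Real.rpow_le_rpow_of_exponent_le (by norm_num) (by nlinarith)
  have hmain := norm_sum_scaleSum_sq_le hd (hdecay b hb) hC.le (hscale b hb) hC'.le (J := J)
    (fun j hj => by
      rcases Nat.eq_zero_or_pos j with rfl | h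
      · simp [hJ, hE0] at hj
      · exact h) (fun j _ => hE' j) hρ1
    (fun j _ => CellBound.of_cubeCount (by positivity) (hE' j) (by rw [hρΛ]; exact hcube j)) hΛN
  set X : ℝ := ∑ j ∈ J, (2 ^ (n + 1 - 1)) ^ j * ((E j).card : ℝ) with hX
  have hX0 : 0 ≤ X := Finset.sum_nonneg fun _ _ =>
    mul_nonneg (pow_nonneg (pow_nonneg (by norm_num) _) _)
    (Nat.cast_nonneg _)
  have hXle : ENNReal.ofReal X ≤ ∑' j : ℕ, 2 ^ (j * (n + 1 - 1)) * ((E j).card : ℝ≥0∞) := by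
    refine le_trans (le_of_eq ?_) (ENNReal.sum_le_tsum J)
    rw [hX, ENNReal.ofReal_sum_of_nonneg fun _ _ =>
      mul_nonneg (pow_nonneg (pow_nonneg (by norm_num) _) _)
      (Nat.cast_nonneg _)]
    refine Finset.sum_congr rfl fun j _ => ?_
    rw [ENNReal.ofReal_mul (by positivity), ENNReal.ofReal_natCast, ← pow_mul, mul_comm j,
      ENNReal.ofReal_pow (by norm_num), ENNReal.ofReal_ofNat]
  calc ‖∑ j ∈ J, scaleSum v E j‖ₑ ^ (2 : ℝ) = ENNReal.ofReal (‖∑ j ∈ J, scaleSum v E j‖ ^ 2) := by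
        rw [← ofReal_norm, ENNReal.ofReal_pow (norm_nonneg _)]
        norm_num
    _ ≤ ENNReal.ofReal (6 * (A + 1) * ρ * ℓ * X) := by
        refine ENNReal.ofReal_le_ofReal (hmain.trans ?_)
        rw [← hA]
        have h1 : A * (N + 1) ≤ 6 * (A + 1) * ℓ := by nlinarith
        calc A * (N + 1) * ρ * X ≤ 6 * (A + 1) * ℓ * ρ * X :=
              mul_le_mul_of_nonneg_right (mul_le_mul_of_nonneg_right h1 (by linarith)) hX0
          _ = _ := by ring
    _ = ENNReal.ofReal (6 * (A + 1) * ρ * ℓ) * ENNReal.ofReal X :=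
        ENNReal.ofReal_mul (by positivity)
    _ ≤ _ := by gcongr
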